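/- Assume GRH and LI. Let δ>0, η∈S_δ, m≥1 and q≥3. For n≥1 define E_n(q;η) := (1/φ(q)^n) ∑_{(χ₁,…,χ_n)} ∑_{(γ₁,…,γ_n), γ₁+⋯+γ_n=0} ∏_{j=1}^n η̂(γ_j/(2π)), where (χ₁,…,χ_n) runs over n-tuples of non-principal Dirichlet characters mod q with χ₁⋯χ_n = χ_{0,q}, and each γ_j runs over the imaginary parts of the nontrivial zeros of L(s,χ_j) counted with multiplicity. Then E_{2m+1}(q;η) = 0 and E_{2m}(q;η) = μ_{2m}·((α(η̂²)·log q + β_q(η̂²))/φ(q))^m + O_m((log q)^m/φ(q)^{m+1}). -/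

import Mathlib

open MeasureTheory

/-- Real (cosine) Fourier transform; for even real integrable `f` this agrees with
`f̂(ξ) = ∫ f(t) e^{-2πiξt} dt`. -/
noncomputable def fourierR (f : ℝ → ℝ) (ξ : ℝ) : ℝ :=
  ∫ t : ℝ, f t * Real.cos (2 * Real.pi * ξ * t)

/-- The class `S_δ` of admissible test functions. -/
def MemS (δ : ℝ) (η : ℝ → ℝ) : Prop :=
  η ≠ 0 ∧ Differentiable ℝ η ∧ (∀ t, η (-t) = η t) ∧
  (∃ C > 0, ∀ t : ℝ, |η t| ≤ C * Real.exp (-(1/2 + δ) * |t|) ∧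
      |deriv η t| ≤ C * Real.exp (-(1/2 + δ) * |t|)) ∧
  (∀ ξ : ℝ, 0 ≤ fourierR η ξ) ∧
  (∃ C > 0, ∀ ξ : ℝ, fourierR η ξ ≤ C * ((|ξ| + 1)⁻¹ * Real.log (|ξ| + 2) ^ (-(2 + δ))))

/-- `α(η̂²) = ∫_ℝ η̂(ξ)² dξ`. -/
noncomputable def alphaSq (η : ℝ → ℝ) : ℝ := ∫ ξ : ℝ, (fourierR η ξ) ^ 2
/-- `ĥ(x) = ∫_ℝ η̂(ξ)² e^{-2πixξ} dξ` for the (even) function `h = η̂²`. -/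
noncomputable def hhatSq (η : ℝ → ℝ) (x : ℝ) : ℝ :=
  ∫ ξ : ℝ, (fourierR η ξ) ^ 2 * Real.cos (2 * Real.pi * x * ξ)

/-- The constant `β_q(η̂²)`. -/
noncomputable def betaSq (q : ℕ) (η : ℝ → ℝ) : ℝ :=
  -(alphaSq η) * (Real.log (8 * Real.pi) + Real.eulerMascheroniConstant +
      ∑ p ∈ q.primeFactors, Real.log p / ((p : ℝ) - 1))
  + (1/2) * ∫ x in Set.Ioi (0:ℝ),
      Real.exp (-x/2) / (1 - Real.exp (-x)) * (2 * hhatSq η 0 - hhatSq η x - hhatSq η (-x))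
/-- Order of vanishing (multiplicity) of `f` at `ρ`. -/
noncomputable def zeroOrder (f : ℂ → ℂ) (ρ : ℂ) : ℕ :=
  sInf {k : ℕ | iteratedDeriv k f ρ ≠ 0}
/-- The Generalized Riemann Hypothesis for Dirichlet L-functions: every zero `ρ` with
`0 < Re ρ < 1` of `L(s,χ)` satisfies `Re ρ = 1/2`. -/
def GRH : Prop :=
  ∀ (q : ℕ) [NeZero q] (χ : DirichletCharacter ℂ q) (ρ : ℂ),
    DirichletCharacter.LFunction χ ρ = 0 → 0 < ρ.re → ρ.re < 1 → ρ.re = 1 / 2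
/-- The Linear Independence hypothesis: for each `q ≥ 3`, the multiset of nonnegative
imaginary parts of zeros `ρ` with `Re ρ ≥ 1/2` of `L(s,χ)`, over all Dirichlet characters
`χ` mod `q` and counted with multiplicity, is linearly independent over `ℚ`. -/
def LI : Prop :=
  ∀ (q : ℕ) [NeZero q], 3 ≤ q →
    LinearIndependent ℚ (fun z : {p : DirichletCharacter ℂ q × ℂ × ℕ //
        1/2 ≤ p.2.1.re ∧ 0 ≤ p.2.1.im ∧ DirichletCharacter.LFunction p.1 p.2.1 = 0 ∧
        p.2.2 < zeroOrder (DirichletCharacter.LFunction p.1) p.2.1} => z.1.2.1.im)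

/-- `E_n(q;η)`: the sum over `n`-tuples of non-principal characters mod `q` with product the
principal character, and over tuples of imaginary parts of nontrivial zeros (counted with
multiplicity) summing to `0`, of `∏_j η̂(γ_j/(2π))`, divided by `φ(q)^n`. -/
noncomputable def Emom (q : ℕ) [NeZero q] (n : ℕ) (η : ℝ → ℝ) : ℝ :=
  (1 / (q.totient : ℝ) ^ n) *
    ∑' χ : {χ : Fin n → DirichletCharacter ℂ q // (∀ j, χ j ≠ 1) ∧ ∏ j, χ j = 1},
    ∑' γ : {γ : Fin n → ℝ //
        (∀ j, DirichletCharacter.LFunction (χ.1 j) (1/2 + Complex.I * γ j) = 0) ∧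
        ∑ j, γ j = 0},
      (∏ j, (zeroOrder (DirichletCharacter.LFunction (χ.1 j)) (1/2 + Complex.I * γ.1 j) : ℝ)) *
      ∏ j, fourierR η (γ.1 j / (2 * Real.pi))

lemma fourierR_neg (f : ℝ → ℝ) (ξ : ℝ) : fourierR f (-ξ) = fourierR f ξ := by
  simp [fourierR]

/-- A multiset is stable under `ι` when its image under `ι` is itself. -/
def MapStable {K : Type*} (ι : K → K) (M : Multiset K) : Prop := M.map ι = M

open scoped ENNReal Classical in
/-- The sum of `∏ w (x j)` over all `n`-tuples `x` whose multiset of entries is stable under `ι`. -/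
noncomputable def balancedSum {K : Type*} (ι : K → K) (w : K → ℝ≥0∞) (n : ℕ) : ℝ≥0∞ :=
  ∑' x : Fin n → K,
    if MapStable ι (Finset.univ.val.map x) then ∏ j, w (x j) else 0

section BalancedTuples
open scoped ENNReal Classical Nat

variable {K : Type*} {ι : K → K} {w : K → ℝ≥0∞}

lemma map_univ_insertNth {n : ℕ} (i : Fin (n + 1)) (a : K) (z : Fin n → K) :
    (Finset.univ.val.map (Fin.insertNth (α := fun _ => K) i a z) : Multiset K) =
      a ::ₘ Finset.univ.val.map z := by
  rw [Fin.univ_succAbove n i]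
  simp [Function.comp_def]

lemma tsum_tuple_succ {n : ℕ} (i : Fin (n + 1)) (f : (Fin (n + 1) → K) → ℝ≥0∞) :
    ∑' x, f x = ∑' a, ∑' z : Fin n → K, f (Fin.insertNth (α := fun _ => K) i a z) := by
  rw [← (Fin.insertNthEquiv (fun _ => K) i).tsum_eq,
    ← ENNReal.tsum_prod (f := fun a z => f (Fin.insertNth (α := fun _ => K) i a z))]
  rfl

lemma MapStable.mem_of_cons (hfix : ∀ k, ι k ≠ k) {a : K}
    {M : Multiset K} (h : MapStable ι (a ::ₘ M)) : ι a ∈ M := by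
  have h1 : ι a ∈ (a ::ₘ M).map ι := Multiset.mem_map_of_mem _ (Multiset.mem_cons_self _ _)
  rw [show Multiset.map ι (a ::ₘ M) = a ::ₘ M from h, Multiset.mem_cons] at h1
  exact h1.resolve_left (hfix a)

lemma mapStable_cons_cons_iff (hι : Function.Involutive ι) {a : K} {M : Multiset K} :
    MapStable ι (a ::ₘ ι a ::ₘ M) ↔ MapStable ι M := by
  simp only [MapStable, Multiset.map_cons, hι a]
  rw [Multiset.cons_swap, Multiset.cons_inj_right, Multiset.cons_inj_right]

/-- Sum over a first entry `a`, and tuples with a marked entry equal to `ι a`. -/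
lemma tsum_marked (hι : Function.Involutive ι) (hw : ∀ k, w (ι k) = w k) {n : ℕ}
    (a : K) (j : Fin (n + 1)) (g : (Fin n → K) → ℝ≥0∞) :
    ∑' y : Fin (n + 1) → K, (if y j = ι a then
      (if MapStable ι (a ::ₘ Finset.univ.val.map y) then
        w a * ∏ i, w (y i) else 0) * g (j.removeNth y) else 0) =
    w a ^ 2 * ∑' z : Fin n → K,
      (if MapStable ι (Finset.univ.val.map z) then ∏ i, w (z i) else 0) * g z := by
  rw [tsum_tuple_succ j, tsum_eq_single (ι a), ← ENNReal.tsum_mul_left]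
  · refine tsum_congr fun z => ?_
    rw [map_univ_insertNth, mapStable_cons_cons_iff hι]
    simp only [Fin.insertNth_apply_same, if_true, Fin.removeNth_insertNth]
    split_ifs
    · rw [Fin.prod_univ_succAbove _ j]
      simp [hw]
      ring
    · simp
  · intro b hb
    simp [hb]

lemma balancedSum_succ {n : ℕ} : balancedSum ι w (n + 1) =
    ∑' a, ∑' y : Fin n → K, (if MapStable ι (a ::ₘ Finset.univ.val.map y)
      then w a * ∏ i, w (y i) else 0) := by
  rw [balancedSum, tsum_tuple_succ 0]
  simp only [map_univ_insertNth]
  simp [Fin.prod_univ_succ]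

/-- Sum over balanced tuples of the number of entries equal to `ι a`, given the first entry `a`. -/
lemma tsum_marked_count (hι : Function.Involutive ι) (hw : ∀ k, w (ι k) = w k) {n : ℕ} (a : K) :
    ∑' y : Fin (n + 1) → K, ∑ j, (if y j = ι a then
      (if MapStable ι (a ::ₘ Finset.univ.val.map y) then
        w a * ∏ i, w (y i) else 0) else 0) = (n + 1) * w a ^ 2 * balancedSum ι w n := by
  rw [Summable.tsum_finsetSum (fun _ _ => ENNReal.summable)]
  have := fun j => tsum_marked (n := n) hι hw a j (fun _ => 1)
  simp only [mul_one] at this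
  simp only [this, balancedSum]
  simp [mul_assoc]

lemma le_count_mul (hfix : ∀ k, ι k ≠ k) {n : ℕ} (a : K)
    (y : Fin n → K) :
    (if MapStable ι (a ::ₘ Finset.univ.val.map y) then
        w a * ∏ i, w (y i) else 0) ≤ ∑ j, (if y j = ι a then
      (if MapStable ι (a ::ₘ Finset.univ.val.map y) then
        w a * ∏ i, w (y i) else 0) else 0) := by
  by_cases h : MapStable ι (a ::ₘ Finset.univ.val.map y)
  · obtain ⟨j, -, hj⟩ := Multiset.mem_map.1 (h.mem_of_cons hfix)
    simp only [if_pos h]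
    refine le_trans ?_ (Finset.single_le_sum (fun _ _ => zero_le) (Finset.mem_univ j))
    simp [hj]
  · rw [if_neg h]
    exact zero_le

lemma tsum_cons_le (hι : Function.Involutive ι) (hfix : ∀ k, ι k ≠ k) (hw : ∀ k, w (ι k) = w k)
    {n : ℕ} (a : K) :
    ∑' y : Fin (n + 1) → K,
      (if MapStable ι (a ::ₘ Finset.univ.val.map y) then
        w a * ∏ i, w (y i) else 0) ≤ (n + 1) * w a ^ 2 * balancedSum ι w n := by
  rw [← tsum_marked_count hι hw]
  exact ENNReal.tsum_le_tsum fun y => le_count_mul hfix a y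

lemma balancedSum_add_two_le (hι : Function.Involutive ι) (hfix : ∀ k, ι k ≠ k)
    (hw : ∀ k, w (ι k) = w k) (n : ℕ) :
    balancedSum ι w (n + 2) ≤ (n + 1) * (∑' k, w k ^ 2) * balancedSum ι w n := by
  rw [balancedSum_succ, ← ENNReal.tsum_mul_left, ← ENNReal.tsum_mul_right]
  exact ENNReal.tsum_le_tsum fun a => tsum_cons_le hι hfix hw a

lemma tsum_count_le (hι : Function.Involutive ι) (hfix : ∀ k, ι k ≠ k)
    (hw : ∀ k, w (ι k) = w k) {n : ℕ} (a : K) :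
    ∑' z : Fin (n + 2) → K,
      (if MapStable ι (Finset.univ.val.map z) then ∏ i, w (z i) else 0) *
        ∑ i, (if z i = a then 1 else 0) ≤ (n + 2) * ((n + 1) * w a ^ 2 * balancedSum ι w n) := by
  simp only [Finset.mul_sum]
  rw [Summable.tsum_finsetSum (fun _ _ => ENNReal.summable)]
  have key : ∀ i : Fin (n + 2), ∑' z : Fin (n + 2) → K,
      (if MapStable ι (Finset.univ.val.map z) then ∏ i, w (z i) else 0) *
        (if z i = a then 1 else 0) ≤ (n + 1) * w a ^ 2 * balancedSum ι w n := by
    intro i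
    rw [tsum_tuple_succ i, tsum_eq_single a]
    · refine le_trans (le_of_eq (tsum_congr fun y => ?_)) (tsum_cons_le hι hfix hw a)
      rw [map_univ_insertNth]
      simp [Fin.prod_univ_succAbove _ i]
    · intro b hb
      simp [hb]
  refine (Finset.sum_le_sum fun i _ => key i).trans ?_
  simp

lemma count_le_one_add {n : ℕ} (p : Fin (n + 1) → Prop) :
    ∑ j, (if p j then (1 : ℝ≥0∞) else 0) ≤
      1 + ∑ j, (if p j then ∑ i, (if p (j.succAbove i) then (1 : ℝ≥0∞) else 0) else 0) := by
  by_cases h : ∃ j₀, p j₀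
  · obtain ⟨j₀, hj₀⟩ := h
    rw [Fin.sum_univ_succAbove _ j₀, if_pos hj₀]
    gcongr
    refine le_trans (le_of_eq ?_) (Finset.single_le_sum (fun _ _ => zero_le) (Finset.mem_univ j₀))
    simp [hj₀]
  · push Not at h
    simp [h]

lemma marked_le_balancedSum_add (hι : Function.Involutive ι) (hw : ∀ k, w (ι k) = w k) (n : ℕ) :
    (n + 1) * (∑' k, w k ^ 2) * balancedSum ι w n ≤ balancedSum ι w (n + 2) +
      (n + 1) * ∑' k, w k ^ 2 * ∑' z : Fin n → K,
      (if MapStable ι (Finset.univ.val.map z) then ∏ i, w (z i) else 0) *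
        ∑ i, (if z i = ι k then 1 else 0) := by
  rw [balancedSum_succ, ← ENNReal.tsum_mul_left, ← ENNReal.tsum_mul_right, ← ENNReal.tsum_mul_left,
    ← ENNReal.tsum_add]
  refine ENNReal.tsum_le_tsum fun a => ?_
  rw [← tsum_marked_count hι hw]
  have h1 : (n + 1 : ℝ≥0∞) * (w a ^ 2 * ∑' z : Fin n → K,
      (if MapStable ι (Finset.univ.val.map z) then ∏ i, w (z i) else 0) *
        ∑ i, (if z i = ι a then 1 else 0)) = ∑ j : Fin (n + 1), ∑' y : Fin (n + 1) → K,
        (if y j = ι a then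
      (if MapStable ι (a ::ₘ Finset.univ.val.map y) then
        w a * ∏ i, w (y i) else 0) * ∑ i, (if (j.removeNth y) i = ι a then 1 else 0) else 0) := by
    have := fun j => tsum_marked (n := n) hι hw a j (fun z => ∑ i, (if z i = ι a then 1 else 0))
    simp only [this]
    simp
  rw [h1, ← Summable.tsum_finsetSum (fun _ _ => ENNReal.summable), ← ENNReal.tsum_add]
  refine ENNReal.tsum_le_tsum fun y => ?_
  set t := (if MapStable ι (a ::ₘ Finset.univ.val.map y) then
        w a * ∏ i, w (y i) else 0) with ht
  have := mul_le_mul_right (count_le_one_add fun j => y j = ι a) t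
  simp only [mul_add, Finset.mul_sum, mul_ite, mul_one, mul_zero] at this
  refine (le_of_eq ?_).trans (this.trans (le_of_eq ?_))
  · rfl
  · congr 1
    refine Finset.sum_congr rfl fun j _ => ?_
    split_ifs
    · rw [Finset.mul_sum]
      refine Finset.sum_congr rfl fun i _ => ?_
      change _ = t * if y (j.succAbove i) = ι a then 1 else 0
      split_ifs <;> simp
    · rfl

lemma balancedSum_zero : balancedSum ι w 0 = 1 := by
  rw [balancedSum, tsum_eq_single default fun x hx => absurd (Subsingleton.elim x _) hx]
  simp [MapStable]

lemma balancedSum_two_mul_le (hι : Function.Involutive ι) (hfix : ∀ k, ι k ≠ k)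
    (hw : ∀ k, w (ι k) = w k) (m : ℕ) :
    balancedSum ι w (2 * m) ≤ (Nat.doubleFactorial (2 * m - 1) : ℕ) * (∑' k, w k ^ 2) ^ m := by
  induction m with
  | zero => simp [balancedSum_zero]
  | succ m ih =>
    refine (balancedSum_add_two_le hι hfix hw (2 * m)).trans ?_
    have h1 : 2 * (m + 1) - 1 = 2 * m + 1 := by omega
    have h2 : (2 * m + 1)‼ = (2 * m + 1) * (2 * m - 1)‼ := by
      rcases m with _ | m
      · rfl
      · rw [show 2 * (m + 1) + 1 = (2 * m + 1) + 2 by ring, Nat.doubleFactorial_add_two]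
        rfl
    calc _ ≤ ((2 * m : ℕ) + 1) * (∑' k, w k ^ 2) * ((2 * m - 1)‼ * (∑' k, w k ^ 2) ^ m) := by gcongr
      _ = _ := by
        rw [h1, h2]
        push_cast
        ring

/-- The balanced sum over `2m`-tuples is approximately that of a Gaussian moment. -/
lemma exists_le_balancedSum_two_mul (m : ℕ) : ∃ C : ℕ, ∀ (K : Type) (ι : K → K) (w : K → ℝ≥0∞)
    (_ : Function.Involutive ι) (_ : ∀ k, ι k ≠ k) (_ : ∀ k, w (ι k) = w k) (W : ℝ≥0∞)
    (_ : ∀ k, w k ^ 2 ≤ W),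
    ((2 * m - 1)‼ : ℕ) * (∑' k, w k ^ 2) ^ m ≤
      balancedSum ι w (2 * m) + (m * C : ℕ) * W * (∑' k, w k ^ 2) ^ (m - 1) := by
  induction m with
  | zero => exact ⟨0, fun K ι w _ _ _ W _ => by simp [balancedSum_zero]⟩
  | succ m ih =>
    obtain ⟨C, hC⟩ := ih
    refine ⟨(2 * m + 1) * (m * C + 2 * m * (2 * m) * (2 * (m - 1) - 1)‼),
      fun K ι w hι hfix hw W hW => ?_⟩
    set Z := ∑' k, w k ^ 2 with hZ
    have h1 : 2 * (m + 1) - 1 = 2 * m + 1 := by omega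
    have h2 : (2 * m + 1)‼ = (2 * m + 1) * (2 * m - 1)‼ := by
      rcases m with _ | m
      · rfl
      · rw [show 2 * (m + 1) + 1 = (2 * m + 1) + 2 by ring, Nat.doubleFactorial_add_two]
        rfl
    have h3 := marked_le_balancedSum_add hι hw (2 * m)
    have h4 : ∑' k, w k ^ 2 * ∑' z : Fin (2 * m) → K,
        (if MapStable ι (Finset.univ.val.map z) then ∏ i, w (z i) else 0) *
          ∑ i, (if z i = ι k then 1 else 0) ≤
        (2 * m * (2 * m) * (2 * (m - 1) - 1)‼ : ℕ) * W * Z ^ m := by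
      rcases m with _ | m
      · simp
      have h5 := balancedSum_two_mul_le hι hfix hw m
      have h6 : ∀ k, ∑' z : Fin (2 * (m + 1)) → K,
        (if MapStable ι (Finset.univ.val.map z) then ∏ i, w (z i) else 0) *
          ∑ i, (if z i = ι k then 1 else 0) ≤
          (2 * (m + 1) * (2 * (m + 1)) * (2 * m - 1)‼ : ℕ) * W * Z ^ m := by
        intro k
        refine (tsum_count_le (n := 2 * m) hι hfix hw (ι k)).trans ?_
        calc _ ≤ ((2 * m : ℕ) + 2) * (((2 * m : ℕ) + 2) * W * ((2 * m - 1)‼ * Z ^ m)) := by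
              gcongr
              · norm_num
              · exact hW _
          _ = _ := by push_cast; ring
      calc _ ≤ ∑' k, w k ^ 2 * ((2 * (m + 1) * (2 * (m + 1)) * (2 * m - 1)‼ : ℕ) * W * Z ^ m) :=
            ENNReal.tsum_le_tsum fun k => by gcongr; exact h6 k
        _ = _ := by
          rw [ENNReal.tsum_mul_right, ← hZ, Nat.add_sub_cancel]
          ring
    have h7 := hC K ι w hι hfix hw W hW
    have h8 : (m : ℕ) ≠ 0 → Z * Z ^ (m - 1) = Z ^ m := fun h => by
      rw [← pow_succ', Nat.sub_add_cancel (Nat.one_le_iff_ne_zero.2 h)]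
    have h9 : Z * (balancedSum ι w (2 * m) + (m * C : ℕ) * W * Z ^ (m - 1)) ≤
        Z * balancedSum ι w (2 * m) + (m * C : ℕ) * W * Z ^ m := by
      rcases Nat.eq_zero_or_pos m with h | h
      · simp [h]
      · rw [← h8 h.ne']
        apply le_of_eq
        ring
    rw [h1, h2, Nat.add_sub_cancel]
    calc (((2 * m + 1) * (2 * m - 1)‼ : ℕ) : ℝ≥0∞) * Z ^ (m + 1)
        = (2 * m + 1 : ℕ) * (Z * ((2 * m - 1)‼ * Z ^ m)) := by push_cast; ring
      _ ≤ (2 * m + 1 : ℕ) * (Z * (balancedSum ι w (2 * m) + (m * C : ℕ) * W * Z ^ (m - 1))) := by gcongr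
      _ ≤ (2 * m + 1 : ℕ) * (Z * balancedSum ι w (2 * m) + (m * C : ℕ) * W * Z ^ m) := by gcongr
      _ = ((2 * m : ℕ) + 1) * Z * balancedSum ι w (2 * m) +
          ((2 * m : ℕ) + 1) * ((m * C : ℕ) * W * Z ^ m) := by push_cast; ring
      _ ≤ (balancedSum ι w (2 * m + 2) + ((2 * m : ℕ) + 1) *
          ((2 * m * (2 * m) * (2 * (m - 1) - 1)‼ : ℕ) * W * Z ^ m)) +
          ((2 * m : ℕ) + 1) * ((m * C : ℕ) * W * Z ^ m) := by
        gcongr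
        exact h3.trans (by gcongr)
      _ = balancedSum ι w (2 * m + 2) + 1 * ((2 * m + 1) *
          (m * C + 2 * m * (2 * m) * (2 * (m - 1) - 1)‼) : ℕ) * W * Z ^ m := by
        push_cast
        ring
      _ ≤ _ := by
        rw [show 2 * (m + 1) = 2 * m + 2 by ring, Nat.cast_mul (m + 1)]
        gcongr
        exact_mod_cast Nat.le_add_left 1 m

end BalancedTuples

section Conjugation
open Complex ComplexConjugate

lemma entire_eq_of_eqOn_re_gt_one {f g : ℂ → ℂ} (hf : Differentiable ℂ f) (hg : Differentiable ℂ g)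
    (h : ∀ s : ℂ, 1 < s.re → f s = g s) : f = g := by
  refine AnalyticOnNhd.eq_of_eventuallyEq (z₀ := 2) (fun z _ => hf.analyticAt z)
    (fun z _ => hg.analyticAt z) ?_
  filter_upwards [(isOpen_lt continuous_const continuous_re).mem_nhds
    (show (2 : ℂ) ∈ {s : ℂ | 1 < s.re} by simp)] with s hs using h s hs

variable {q : ℕ} [NeZero q] {χ : DirichletCharacter ℂ q}

lemma LFunction_inv_conj (hχ : χ ≠ 1) (s : ℂ) :
    DirichletCharacter.LFunction χ⁻¹ (conj s) = conj (DirichletCharacter.LFunction χ s) := by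
  have h1 : (fun s => DirichletCharacter.LFunction χ⁻¹ s) =
      fun s => conj (DirichletCharacter.LFunction χ (conj s)) := by
    refine entire_eq_of_eqOn_re_gt_one
      (DirichletCharacter.differentiable_LFunction (inv_ne_one.2 hχ))
      (fun z => ?_) fun s hs => ?_
    · have := (DirichletCharacter.differentiable_LFunction hχ (conj z)).conj_conj
      rwa [conj_conj] at this
    rw [DirichletCharacter.LFunction_eq_LSeries _ hs,
      DirichletCharacter.LFunction_eq_LSeries _ (by simpa using hs), LSeries, LSeries, conj_tsum]
    refine tsum_congr fun n => ?_
    rcases eq_or_ne n 0 with rfl | hn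
    · simp
    rw [LSeries.term_of_ne_zero hn, LSeries.term_of_ne_zero hn, map_div₀, ← MulChar.star_apply',
      cpow_conj _ _ (by rw [natCast_arg]; exact Real.pi_pos.ne), conj_conj, conj_natCast,
      starRingEnd_apply]
  rw [show DirichletCharacter.LFunction χ⁻¹ (conj s) =
    conj (DirichletCharacter.LFunction χ (conj (conj s))) from congrFun h1 _, conj_conj]

lemma conj_half_add_I_mul (γ : ℝ) : conj (1/2 + I * γ) = 1/2 + I * ((-γ : ℝ) : ℂ) := by
  apply Complex.ext <;> simp

lemma zeroOrder_pos {f : ℂ → ℂ} (hf : Differentiable ℂ f) (hf0 : ∃ z, f z ≠ 0) {ρ : ℂ}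
    (hρ : f ρ = 0) : 0 < zeroOrder f ρ := by
  rw [Nat.pos_iff_ne_zero]
  intro h
  rw [zeroOrder, Nat.sInf_eq_zero] at h
  rcases h with h | h
  · simp [hρ] at h
  · obtain ⟨z, hz⟩ := hf0
    refine hz ?_
    rw [← Complex.taylorSeries_eq_of_entire' ρ z hf]
    have : ∀ n, iteratedDeriv n f ρ = 0 := fun n => by
      by_contra hn
      exact (Set.eq_empty_iff_forall_notMem.1 h) n hn
    simp [this]

end Conjugation

/-- The pairs `(χ, γ)` with `χ` a non-principal character mod `q` and `L(1/2 + iγ, χ) = 0`. -/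
abbrev CriticalZero (q : ℕ) [NeZero q] : Type :=
  {p : DirichletCharacter ℂ q × ℝ //
    p.1 ≠ 1 ∧ DirichletCharacter.LFunction p.1 (1/2 + Complex.I * p.2) = 0}

namespace CriticalZero
open Complex ComplexConjugate

variable {q : ℕ} [NeZero q]

lemma LFunction_inv_neg_eq_zero {χ : DirichletCharacter ℂ q} {γ : ℝ} (hχ : χ ≠ 1)
    (h : DirichletCharacter.LFunction χ (1/2 + I * γ) = 0) :
    DirichletCharacter.LFunction χ⁻¹ (1/2 + I * ((-γ : ℝ) : ℂ)) = 0 := by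
  have := LFunction_inv_conj hχ (1/2 + I * γ)
  rwa [h, map_zero, conj_half_add_I_mul] at this

/-- The involution `(χ, γ) ↦ (χ̄, -γ)`. -/
noncomputable def dual (k : CriticalZero q) : CriticalZero q :=
  ⟨(k.1.1⁻¹, -k.1.2), inv_ne_one.2 k.2.1, LFunction_inv_neg_eq_zero k.2.1 k.2.2⟩

lemma dual_involutive : Function.Involutive (dual (q := q)) := fun k => by
  simp [dual]

/-- The index type of the family whose linear independence is asserted by `LI`. -/
abbrev LIIndex (q : ℕ) [NeZero q] : Type := {p : DirichletCharacter ℂ q × ℂ × ℕ //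
        1/2 ≤ p.2.1.re ∧ 0 ≤ p.2.1.im ∧ DirichletCharacter.LFunction p.1 p.2.1 = 0 ∧
        p.2.2 < zeroOrder (DirichletCharacter.LFunction p.1) p.2.1}

lemma exists_LFunction_ne_zero {χ : DirichletCharacter ℂ q} (hχ : χ ≠ 1) :
    ∃ z, DirichletCharacter.LFunction χ z ≠ 0 :=
  ⟨1, DirichletCharacter.LFunction_apply_one_ne_zero hχ⟩

lemma zeroOrder_pos (k : CriticalZero q) :
    0 < zeroOrder (DirichletCharacter.LFunction k.1.1) (1/2 + I * k.1.2) :=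
  _root_.zeroOrder_pos (DirichletCharacter.differentiable_LFunction k.2.1)
    (exists_LFunction_ne_zero k.2.1) k.2.2

/-- The `LI` index of a zero with nonnegative imaginary part. -/
noncomputable def toIndex (k : CriticalZero q) (hk : 0 ≤ k.1.2) : LIIndex q :=
  ⟨(k.1.1, 1/2 + I * k.1.2, 0), by simp, by simpa using hk, k.2.2, k.zeroOrder_pos⟩

lemma im_toIndex (k : CriticalZero q) (hk : 0 ≤ k.1.2) : (k.toIndex hk).1.2.1.im = k.1.2 := by
  simp [toIndex]

lemma toIndex_injective {k l : CriticalZero q} {hk : 0 ≤ k.1.2} {hl : 0 ≤ l.1.2}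
    (h : k.toIndex hk = l.toIndex hl) : k = l := by
  have h1 := congrArg (fun z => z.1.2.1.im) h
  simp only [im_toIndex] at h1
  exact Subtype.ext (Prod.ext (congrArg (fun z => z.1.1) h) h1)

variable (hLI : LI) (hq : 3 ≤ q)
include hLI hq

lemma im_ne_zero (k : CriticalZero q) : k.1.2 ≠ 0 := fun h => by
  have := (hLI q hq).ne_zero (k.toIndex h.ge)
  rw [im_toIndex] at this
  exact this h

lemma dual_ne (k : CriticalZero q) : k.dual ≠ k := fun h => by
  have h1 : -k.1.2 = k.1.2 := congrArg (fun z => z.1.2) h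
  exact im_ne_zero hLI hq k (by linarith)

lemma zeroOrder_eq_one_of_nonneg (k : CriticalZero q) (hk : 0 ≤ k.1.2) :
    zeroOrder (DirichletCharacter.LFunction k.1.1) (1/2 + I * k.1.2) = 1 := by
  by_contra h
  have h0 := k.zeroOrder_pos
  have h1 : (k.toIndex hk) = ⟨(k.1.1, 1/2 + I * k.1.2, 1), by simp, by simpa using hk, k.2.2,
    by change 1 < zeroOrder (DirichletCharacter.LFunction k.1.1) (1/2 + I * k.1.2); omega⟩ := (hLI q hq).injective rfl
  simpa [toIndex] using congrArg (fun z => z.1.2.2) h1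

omit hLI hq in
lemma zeroOrder_eq_one_iff {χ : DirichletCharacter ℂ q} {ρ : ℂ} (hχ : χ ≠ 1)
    (hρ : DirichletCharacter.LFunction χ ρ = 0) :
    zeroOrder (DirichletCharacter.LFunction χ) ρ = 1 ↔
      deriv (DirichletCharacter.LFunction χ) ρ ≠ 0 := by
  have h0 := _root_.zeroOrder_pos (DirichletCharacter.differentiable_LFunction hχ)
    (exists_LFunction_ne_zero hχ) hρ
  constructor
  · intro h
    have := Nat.sInf_mem (Nat.nonempty_of_pos_sInf h0)
    change iteratedDeriv (zeroOrder _ _) _ _ ≠ 0 at this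
    rwa [h, iteratedDeriv_one] at this
  · intro h
    refine le_antisymm (Nat.sInf_le ?_) h0
    simpa using h

lemma deriv_ne_zero (k : CriticalZero q) :
    deriv (DirichletCharacter.LFunction k.1.1) (1/2 + I * k.1.2) ≠ 0 := by
  rcases le_total 0 k.1.2 with h | h
  · exact (zeroOrder_eq_one_iff k.2.1 k.2.2).1 (zeroOrder_eq_one_of_nonneg hLI hq k h)
  · have h1 := (zeroOrder_eq_one_iff k.dual.2.1 k.dual.2.2).1
      (zeroOrder_eq_one_of_nonneg hLI hq k.dual (neg_nonneg.2 h))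
    intro h2
    apply h1
    have h3 : DirichletCharacter.LFunction k.1.1⁻¹ = 
        conj ∘ DirichletCharacter.LFunction k.1.1 ∘ conj := by
      ext s
      simp [← LFunction_inv_conj k.2.1]
    change deriv (DirichletCharacter.LFunction k.1.1⁻¹) (1/2 + I * ((-k.1.2 : ℝ) : ℂ)) = 0
    rw [h3, deriv_conj_conj, Function.comp_apply, Function.comp_apply, conj_half_add_I_mul, neg_neg,
      h2, map_zero]

lemma zeroOrder_eq_one (k : CriticalZero q) :
    zeroOrder (DirichletCharacter.LFunction k.1.1) (1/2 + I * k.1.2) = 1 :=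
  (zeroOrder_eq_one_iff k.2.1 k.2.2).2 (deriv_ne_zero hLI hq k)

omit hLI hq in
/-- The `LI` index of a zero, up to duality. -/
noncomputable def index (k : CriticalZero q) : LIIndex q :=
  if h : 0 ≤ k.1.2 then k.toIndex h else k.dual.toIndex (neg_nonneg.2 (not_le.1 h).le)

omit hLI hq in
/-- The sign of the imaginary part of a zero. -/
noncomputable def sgn (k : CriticalZero q) : ℚ := if 0 ≤ k.1.2 then 1 else -1

omit hLI hq in
lemma sgn_smul_im_index (k : CriticalZero q) : k.sgn • k.index.1.2.1.im = k.1.2 := by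
  rw [sgn, index]
  split_ifs with h
  · rw [im_toIndex]; simp
  · simp [toIndex, dual]

lemma sgn_dual (k : CriticalZero q) : k.dual.sgn = -k.sgn := by
  have := im_ne_zero hLI hq k
  rcases lt_or_gt_of_ne this with h | h
  · simp [sgn, dual, h.le, h.not_ge]
  · simp [sgn, dual, h.le, h.not_ge]

lemma index_dual (k : CriticalZero q) : k.dual.index = k.index := by
  have := im_ne_zero hLI hq k
  by_cases h : 0 ≤ k.1.2
  · rw [index, index, dif_pos h, dif_neg (by simpa [dual] using lt_of_le_of_ne h this.symm)]
    exact Subtype.ext (by simp [toIndex, dual_involutive k])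
  · rw [index, index, dif_neg h, dif_pos (by simpa [dual] using (not_le.1 h).le)]

lemma index_eq_index_iff {k l : CriticalZero q} : k.index = l.index ↔ k = l ∨ k = l.dual := by
  constructor
  · intro h
    rw [index, index] at h
    split_ifs at h with h1 h2 h2
    · exact Or.inl (toIndex_injective h)
    · exact Or.inr (toIndex_injective h)
    · exact Or.inr (by rw [← toIndex_injective h, dual_involutive])
    · exact Or.inl (dual_involutive.injective (toIndex_injective h))
  · rintro (rfl | rfl)
    · rfl
    · exact index_dual hLI hq l

open Classical in
lemma sum_single_apply (M : Multiset (CriticalZero q)) (k : CriticalZero q) :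
    (M.map fun x => Finsupp.single x.index x.sgn).sum k.index =
      k.sgn * ((M.count k : ℚ) - M.count k.dual) := by
  induction M using Multiset.induction with
  | empty => simp
  | cons a M ih =>
    rw [Multiset.map_cons, Multiset.sum_cons, Finsupp.add_apply, ih, Multiset.count_cons,
      Multiset.count_cons, Finsupp.single_apply]
    by_cases h1 : k = a
    · subst h1
      simp [dual_ne hLI hq]
      ring
    by_cases h2 : k.dual = a
    · subst h2
      simp [index_dual hLI hq, h1, sgn_dual hLI hq]
      ring
    · have : ¬ a.index = k.index := by
        rw [index_eq_index_iff hLI hq]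
        rintro (h | h)
        · exact h1 h.symm
        · exact h2 h.symm
      simp [this, h1, h2]

lemma mapStable_of_sum_eq_zero {M : Multiset (CriticalZero q)}
    (hM : (M.map fun k => k.1.2).sum = 0) : MapStable dual M := by
  classical
  have h1 : (M.map fun x => Finsupp.single x.index x.sgn).sum = 0 := by
    refine linearIndependent_iff.1 (hLI q hq) _ ?_
    rw [map_multiset_sum, Multiset.map_map]
    refine Eq.trans (congrArg _ (Multiset.map_congr rfl fun k _ => ?_)) hM
    simp only [Function.comp_apply, Finsupp.linearCombination_single]
    exact sgn_smul_im_index k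
  ext k
  have h2 := sum_single_apply hLI hq M k
  rw [h1, Finsupp.zero_apply, eq_comm, mul_eq_zero, sub_eq_zero] at h2
  have h3 : k.sgn ≠ 0 := by rw [sgn]; split_ifs <;> simp
  rw [← Nat.cast_inj (R := ℚ), h2.resolve_left h3]
  conv_lhs => rw [← dual_involutive k]
  rw [Multiset.count_map_eq_count' _ _ dual_involutive.injective]

omit hLI hq in
lemma sum_eq_zero_of_mapStable {M : Multiset (CriticalZero q)} (hM : MapStable dual M) :
    (M.map fun k => k.1.2).sum = 0 := by
  have h := congrArg (fun M => (M.map fun k : CriticalZero q => k.1.2).sum) hM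
  simp only [Multiset.map_map] at h
  have h2 : ((M.map fun k : CriticalZero q => k.1.2).map Neg.neg).sum =
      (M.map fun k : CriticalZero q => k.1.2).sum := by
    rw [Multiset.map_map]
    exact h
  rw [Multiset.sum_map_neg, Multiset.map_id'] at h2
  linarith

lemma prod_eq_one_of_mapStable {M : Multiset (CriticalZero q)} (hM : MapStable dual M) :
    (M.map fun k => k.1.1).prod = 1 := by
  induction hn : M.card using Nat.strong_induction_on generalizing M with
  | _ n ih =>
    rcases M.empty_or_exists_mem with rfl | ⟨a, ha⟩
    · simp
    obtain ⟨M, rfl⟩ := Multiset.exists_cons_of_mem ha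
    obtain ⟨M, rfl⟩ := Multiset.exists_cons_of_mem (hM.mem_of_cons (dual_ne hLI hq))
    rw [mapStable_cons_cons_iff dual_involutive] at hM
    simp only [Multiset.map_cons, Multiset.prod_cons]
    rw [ih M.card (by simp [← hn]) hM rfl]
    simp [dual]

end CriticalZero

namespace CriticalZero
open Complex ComplexConjugate
open scoped ENNReal

variable {q : ℕ} [NeZero q]

/-- The weight `η̂(γ/(2π))` of a zero. -/
noncomputable def weight (η : ℝ → ℝ) (k : CriticalZero q) : ℝ≥0∞ :=
  ENNReal.ofReal (fourierR η (k.1.2 / (2 * Real.pi)))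

lemma weight_dual (η : ℝ → ℝ) (k : CriticalZero q) : weight η k.dual = weight η k := by
  simp only [weight, dual]
  rw [neg_div, fourierR_neg]

variable (hLI : LI) (hq : 3 ≤ q)
include hLI hq

/-- Stable tuples of zeros, sorted by their characters. -/
noncomputable def stableTupleEquiv (n : ℕ) :
    {x : Fin n → CriticalZero q // MapStable dual (Finset.univ.val.map x)} ≃
    Σ χ : {χ : Fin n → DirichletCharacter ℂ q // (∀ j, χ j ≠ 1) ∧ ∏ j, χ j = 1},
      {γ : Fin n → ℝ //
        (∀ j, DirichletCharacter.LFunction (χ.1 j) (1/2 + Complex.I * γ j) = 0) ∧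
        ∑ j, γ j = 0} where
  toFun x := ⟨⟨fun j => (x.1 j).1.1, fun j => (x.1 j).2.1, by
      have := prod_eq_one_of_mapStable hLI hq x.2
      rwa [Multiset.map_map] at this⟩,
    ⟨fun j => (x.1 j).1.2, fun j => (x.1 j).2.2, by
      have := sum_eq_zero_of_mapStable x.2
      rwa [Multiset.map_map] at this⟩⟩
  invFun y := ⟨fun j => ⟨(y.1.1 j, y.2.1 j), y.1.2.1 j, y.2.2.1 j⟩,
    mapStable_of_sum_eq_zero hLI hq (by rw [Multiset.map_map]; exact y.2.2.2)⟩
  left_inv x := rfl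
  right_inv y := rfl

theorem Emom_eq {η : ℝ → ℝ} (hη : ∀ ξ, 0 ≤ fourierR η ξ) {n : ℕ}
    (hfin : balancedSum dual (weight (q := q) η) n ≠ ∞) :
    Emom q n η = 1 / (q.totient : ℝ) ^ n *
      (balancedSum dual (weight (q := q) η) n).toReal := by
  classical
  have h1 : balancedSum dual (weight (q := q) η) n =
      ∑' χ : {χ : Fin n → DirichletCharacter ℂ q // (∀ j, χ j ≠ 1) ∧ ∏ j, χ j = 1},
      ∑' γ : {γ : Fin n → ℝ //
        (∀ j, DirichletCharacter.LFunction (χ.1 j) (1/2 + Complex.I * γ j) = 0) ∧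
        ∑ j, γ j = 0}, ∏ j, ENNReal.ofReal (fourierR η (γ.1 j / (2 * Real.pi))) := by
    rw [← ENNReal.tsum_sigma, ← (stableTupleEquiv hLI hq n).tsum_eq, balancedSum]
    have h := tsum_subtype {x : Fin n → CriticalZero q | MapStable dual (Finset.univ.val.map x)}
      (fun x => ∏ j, weight η (x j))
    refine Eq.trans ?_ h.symm
    refine tsum_congr fun x => ?_
    rw [Set.indicator_apply]
    congr
  rw [Emom, h1]
  congr 1
  rw [h1] at hfin
  rw [ENNReal.tsum_toReal_eq fun χ => ENNReal.ne_top_of_tsum_ne_top hfin χ]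
  refine tsum_congr fun χ => ?_
  rw [ENNReal.tsum_toReal_eq fun γ =>
    ENNReal.prod_ne_top fun j _ => ENNReal.ofReal_ne_top]
  refine tsum_congr fun γ => ?_
  rw [ENNReal.toReal_prod, Finset.prod_congr rfl fun j _ =>
    ENNReal.toReal_ofReal (hη (γ.1 j / (2 * Real.pi))), Finset.prod_eq_one, one_mul]
  intro j _
  exact_mod_cast zeroOrder_eq_one hLI hq ⟨(χ.1 j, γ.1 j), χ.2.1 j, γ.2.1 j⟩

theorem balancedSum_odd (η : ℝ → ℝ) (m : ℕ) :
    balancedSum dual (weight (q := q) η) (2 * m + 1) = 0 := by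
  induction m with
  | zero =>
    rw [balancedSum]
    simp only [ENNReal.tsum_eq_zero]
    intro x
    rw [if_neg]
    intro h
    have : Finset.univ.val.map x = x 0 ::ₘ 0 := by simp
    rw [this] at h
    simpa using h.mem_of_cons (dual_ne hLI hq)
  | succ m ih =>
    have := balancedSum_add_two_le dual_involutive (dual_ne hLI hq)
      (weight_dual (q := q) η) (2 * m + 1)
    rw [ih, mul_zero] at this
    exact le_antisymm this bot_le

end CriticalZero

section PartialFractions
open Complex ComplexConjugate Metric

lemma norm_logDeriv_sub_le {F : ℂ → ℂ} {R M : ℝ} (hR : 0 < R) (hM : 0 < M)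
    (hF : Differentiable ℂ F) (h0 : ∀ z ∈ ball (0 : ℂ) R, F z ≠ 0)
    (hb : ∀ z ∈ ball (0 : ℂ) R, ‖F z‖ ≤ Real.exp M * ‖F 0‖) {z w : ℂ}
    (hz : z ∈ ball (0 : ℂ) (R / 8)) (hw : w ∈ ball (0 : ℂ) (R / 8)) :
    ‖logDeriv F z - logDeriv F w‖ ≤ 64 * M / R ^ 2 * ‖z - w‖ := by
  have hmem0 : (0 : ℂ) ∈ ball (0 : ℂ) R := mem_ball_self hR
  have hh : DifferentiableOn ℂ (logDeriv F) (ball 0 R) :=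
    (hF.deriv.differentiableOn).div hF.differentiableOn h0
  obtain ⟨g, hg0, hg⟩ := hh.isExactOn_ball.with_val_at 0 0
  have hFg : ∀ z ∈ ball (0 : ℂ) R, F z = F 0 * exp (g z) := by
    have h1 : ∀ z ∈ ball (0 : ℂ) R, HasDerivAt (fun z => F z * exp (-g z)) 0 z := fun z hz => by
      refine ((hF z).hasDerivAt.mul ((hg z hz).neg.cexp)).congr_deriv ?_
      rw [logDeriv_apply]
      have := h0 z hz
      field_simp
      ring
    intro z hz
    have h2 := isOpen_ball.is_const_of_deriv_eq_zero (convex_ball (0 : ℂ) R).isPreconnected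
      (fun z hz => (h1 z hz).differentiableAt.differentiableWithinAt)
      (fun z hz => (h1 z hz).deriv) hz hmem0
    simp only [hg0, neg_zero, exp_zero, mul_one] at h2
    rw [← h2, mul_assoc, ← exp_add]
    simp
  have hre : ∀ z ∈ ball (0 : ℂ) R, (g z).re ≤ M := fun z hz => by
    have h1 := hb z hz
    rw [hFg z hz, norm_mul, mul_comm, norm_exp] at h1
    have := le_of_mul_le_mul_right h1 (norm_pos_iff.2 (h0 0 hmem0))
    exact Real.exp_le_exp.1 this
  have hgb : ∀ z ∈ ball (0 : ℂ) (R / 2), ‖g z‖ ≤ 2 * M := fun z hz => by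
    have hz' : ‖z‖ < R / 2 := by simpa using hz
    refine (borelCaratheodory_zero hM (fun z hz => (hg z hz).differentiableAt.differentiableWithinAt)
      hre hR (ball_subset_ball (by linarith) hz) hg0).trans ?_
    rw [div_le_iff₀ (by linarith)]
    nlinarith
  have hhb : ∀ z ∈ ball (0 : ℂ) (R / 4), ‖logDeriv F z‖ ≤ 8 * M / R := fun z hz => by
    have hz' : ‖z‖ < R / 4 := by simpa using hz
    rw [← (hg z (ball_subset_ball (by linarith) hz)).deriv]
    have hsub : closedBall z (R / 4) ⊆ ball 0 (R / 2) := fun u hu => by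
      rw [mem_closedBall, dist_eq_norm] at hu
      rw [mem_ball_zero_iff]
      calc ‖u‖ = ‖(u - z) + z‖ := by simp
        _ ≤ _ := norm_add_le _ _
        _ < R / 2 := by linarith
    refine (norm_deriv_le_of_forall_mem_sphere_norm_le (R := R / 4) (C := 2 * M) (by positivity)
      ?_ fun u hu => hgb u (hsub (sphere_subset_closedBall hu))).trans_eq (by field_simp; ring)
    refine DifferentiableOn.diffContOnCl_ball (U := ball 0 (R / 2)) (fun u hu => ?_) hsub
    exact (hg u (ball_subset_ball (by linarith) hu)).differentiableAt.differentiableWithinAt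
  refine (convex_ball (0 : ℂ) (R / 8)).norm_image_sub_le_of_norm_deriv_le (𝕜 := ℂ)
    (fun u hu => ?_) (fun u hu => ?_) hw hz
  · exact hh.differentiableAt (isOpen_ball.mem_nhds (ball_subset_ball (by linarith) hu))
  · have hz' : ‖u‖ < R / 8 := by simpa using hu
    have hsub : closedBall u (R / 8) ⊆ ball 0 (R / 4) := fun v hv => by
      rw [mem_closedBall, dist_eq_norm] at hv
      rw [mem_ball_zero_iff]
      calc ‖v‖ = ‖(v - u) + u‖ := by simp
        _ ≤ _ := norm_add_le _ _
        _ < R / 4 := by linarith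
    refine (norm_deriv_le_of_forall_mem_sphere_norm_le (R := R / 8) (C := 8 * M / R) (by positivity)
      ?_ fun v hv => hhb v (hsub (sphere_subset_closedBall hv))).trans_eq (by field_simp; ring)
    exact DifferentiableOn.diffContOnCl_ball
      (hh.mono (ball_subset_ball (by linarith))) hsub

/-- Dividing an entire function by linear factors at finitely many zeros. -/
lemma exists_eq_prod_mul {f : ℂ → ℂ} (hf : Differentiable ℂ f) (S : Finset ℂ)
    (hS : ∀ ρ ∈ S, f ρ = 0) (hS0 : (0 : ℂ) ∉ S) :
    ∃ F : ℂ → ℂ, Differentiable ℂ F ∧ ∀ z, f z = (∏ ρ ∈ S, (1 - z / ρ)) * F z := by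
  induction S using Finset.induction_on with
  | empty => exact ⟨f, hf, by simp⟩
  | insert ρ S hρ ih =>
    obtain ⟨F, hF, hfF⟩ := ih (fun z hz => hS z (Finset.mem_insert_of_mem hz))
      (fun h => hS0 (Finset.mem_insert_of_mem h))
    have hne : ρ ≠ 0 := fun h => hS0 (h ▸ Finset.mem_insert_self _ _)
    have hFρ : F ρ = 0 := by
      have h1 := hS ρ (Finset.mem_insert_self _ _)
      rw [hfF, mul_eq_zero, Finset.prod_eq_zero_iff] at h1
      refine h1.resolve_left ?_
      rintro ⟨σ, hσ, h2⟩
      have hσ0 : σ ≠ 0 := fun h => hS0 (h ▸ Finset.mem_insert_of_mem hσ)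
      rw [sub_eq_zero, eq_comm, div_eq_one_iff_eq hσ0] at h2
      exact hρ (h2 ▸ hσ)
    refine ⟨fun z => -ρ * dslope F ρ z, ?_, fun z => ?_⟩
    · refine Differentiable.const_mul ?_ _
      rw [← differentiableOn_univ]
      exact (differentiableOn_dslope Filter.univ_mem).2 hF.differentiableOn
    · have h1 := sub_smul_dslope F ρ z
      rw [hFρ, sub_zero, smul_eq_mul] at h1
      rw [Finset.prod_insert hρ, hfF z, ← h1]
      field_simp
      ring

lemma finite_zeros {f : ℂ → ℂ} (hf : Differentiable ℂ f) (h0 : f 0 ≠ 0) (R : ℝ) :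
    {z | f z = 0 ∧ ‖z‖ ≤ R}.Finite := by
  by_contra h
  have h : {z | f z = 0 ∧ ‖z‖ ≤ R}.Infinite := h
  obtain ⟨x, -, hx⟩ := h.exists_accPt_of_subset_isCompact (isCompact_closedBall (0 : ℂ) R)
    (fun z hz => by simpa using hz.2)
  refine h0 ?_
  refine (AnalyticOnNhd.eq_of_frequently_eq (f := f) (g := 0) (z₀ := x) (fun z _ => hf.analyticAt z)
    (fun z _ => analyticAt_const) ?_ ▸ rfl : f 0 = (0 : ℂ → ℂ) 0)
  rw [accPt_iff_frequently_nhdsNE] at hx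
  exact hx.mono fun z hz => hz.1

end PartialFractions

section PartialFractions
open Complex ComplexConjugate Metric

lemma norm_logDeriv_sub_sum_sub_le {f : ℂ → ℂ} (hf : Differentiable ℂ f) (h0 : f 0 ≠ 0)
    (hsimple : ∀ ρ, f ρ = 0 → deriv f ρ ≠ 0) {R M : ℝ} (hR : 0 < R) (hM : 0 < M)
    (hb : ∀ z, ‖z‖ = 2 * R → ‖f z‖ ≤ Real.exp M * ‖f 0‖) {z w : ℂ}
    (hz : z ∈ ball (0 : ℂ) (R / 8)) (hw : w ∈ ball (0 : ℂ) (R / 8)) (hfz : f z ≠ 0)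
    (hfw : f w ≠ 0) :
    ‖(logDeriv f z - ∑ ρ ∈ (finite_zeros hf h0 R).toFinset, 1 / (z - ρ)) -
      (logDeriv f w - ∑ ρ ∈ (finite_zeros hf h0 R).toFinset, 1 / (w - ρ))‖ ≤
      64 * M / R ^ 2 * ‖z - w‖ := by
  set S := (finite_zeros hf h0 R).toFinset with hS
  have hSmem : ∀ ρ, ρ ∈ S ↔ f ρ = 0 ∧ ‖ρ‖ ≤ R := fun ρ => by simp [hS]
  have hS0 : (0 : ℂ) ∉ S := fun h => h0 ((hSmem 0).1 h).1
  obtain ⟨F, hF, hfF⟩ := exists_eq_prod_mul hf S (fun ρ h => ((hSmem ρ).1 h).1) hS0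
  have hne : ∀ ρ ∈ S, ρ ≠ 0 := fun ρ h h' => hS0 (h' ▸ h)
  have hdP : Differentiable ℂ fun z : ℂ => ∏ ρ ∈ S, (1 - z / ρ) := by fun_prop
  have hF0 : F 0 = f 0 := by simp [hfF 0]
  have hlog : ∀ z, f z ≠ 0 → logDeriv f z - ∑ ρ ∈ S, 1 / (z - ρ) = logDeriv F z := by
    intro z hz
    have h1 : f = fun z => (∏ ρ ∈ S, (1 - z / ρ)) * F z := funext hfF
    have h2 := hfF z ▸ hz
    have h3 : ∀ ρ ∈ S, 1 - z / ρ ≠ 0 := Finset.prod_ne_zero_iff.1 (left_ne_zero_of_mul h2)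
    conv_lhs => rw [h1]
    rw [logDeriv_mul (f := fun z => ∏ ρ ∈ S, (1 - z / ρ)) z (left_ne_zero_of_mul h2)
      (right_ne_zero_of_mul h2) hdP.differentiableAt
      hF.differentiableAt, logDeriv_prod (f := fun ρ z => 1 - z / ρ) h3 fun ρ _ => by fun_prop]
    rw [sub_eq_iff_eq_add, add_comm]
    congr 1
    refine Finset.sum_congr rfl fun ρ hρ => ?_
    have h4 := h3 ρ hρ
    have h5 : deriv (fun z : ℂ => 1 - z / ρ) z = -(1 / ρ) :=
      (((hasDerivAt_id z).div_const ρ).const_sub 1).deriv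
    rw [logDeriv_apply, h5]
    have h6 := hne ρ hρ
    have h7 : z - ρ ≠ 0 := fun h => h4 (by rw [sub_eq_zero.1 h, div_self h6, sub_self])
    have h8 : ρ - z ≠ 0 := fun h => h7 (by rw [← neg_sub, h, neg_zero])
    field_simp
    ring
  rw [hlog z hfz, hlog w hfw]
  refine norm_logDeriv_sub_le hR hM hF (fun u hu hFu => ?_) (fun u hu => ?_) hz hw
  · have h1 : f u = 0 := by rw [hfF, hFu, mul_zero]
    have h2 : u ∈ S := (hSmem u).2 ⟨h1, (mem_ball_zero_iff.1 hu).le⟩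
    refine hsimple u h1 ?_
    have h3 : f = fun z => (∏ ρ ∈ S, (1 - z / ρ)) * F z := funext hfF
    have h4 := (hdP.differentiableAt (x := u)).hasDerivAt.mul (hF.differentiableAt (x := u)).hasDerivAt
    rw [hFu, mul_zero, zero_add, Finset.prod_eq_zero h2 (by simp [hne u h2]), zero_mul] at h4
    rw [h3]
    exact h4.deriv
  · rw [hF0]
    refine norm_le_of_forall_mem_frontier_norm_le (U := ball 0 (2 * R)) isBounded_ball
      hF.diffContOnCl (fun v hv => ?_)
      (subset_closure (ball_subset_ball (by linarith) hu))
    rw [frontier_ball _ (by positivity), mem_sphere_zero_iff_norm] at hv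
    refine le_trans ?_ (hb v hv)
    rw [hfF, norm_mul]
    refine le_mul_of_one_le_left (norm_nonneg _) ?_
    rw [norm_prod]
    rw [← Finset.prod_const_one (s := S)]
    refine Finset.prod_le_prod (fun _ _ => zero_le_one) (fun ρ hρ => ?_)
    have h1 : 2 ≤ ‖v / ρ‖ := by
      rw [norm_div, hv, le_div_iff₀ (norm_pos_iff.2 (hne ρ hρ))]
      linarith [((hSmem ρ).1 hρ).2]
    have h2 := norm_sub_norm_le (v / ρ) 1
    rw [norm_sub_rev, norm_one] at h2
    linarith

theorem hasSum_re_logDeriv {f : ℂ → ℂ} (hf : Differentiable ℂ f) (h0 : f 0 ≠ 0)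
    (hsimple : ∀ ρ, f ρ = 0 → deriv f ρ ≠ 0) (hline : ∀ ρ, f ρ = 0 → ρ.re = 0)
    {C : ℝ} (hgrowth : ∀ z, ‖f z‖ ≤ Real.exp (C * (1 + ‖z‖) ^ (3 / 2 : ℝ)))
    (hsymm : ∀ z, logDeriv f (-conj z) = -conj (logDeriv f z)) {z : ℂ} (hz : 0 < z.re) :
    HasSum (fun γ : {γ : ℝ // f (I * γ) = 0} => z.re / (z.re ^ 2 + (z.im - γ) ^ 2))
      (logDeriv f z).re := by
  set p : {γ : ℝ // f (I * γ) = 0} → ℝ := fun γ => z.re / (z.re ^ 2 + (z.im - γ) ^ 2) with hp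
  have hp0 : ∀ γ, 0 ≤ p γ := fun γ => by positivity
  have hinj : Function.Injective fun γ : {γ : ℝ // f (I * γ) = 0} => I * (γ.1 : ℂ) := fun a b h => by
    simpa [Subtype.ext_iff] using h
  set S : ℝ → Finset ℂ := fun R => (finite_zeros hf h0 R).toFinset with hS
  have hSmem : ∀ R ρ, ρ ∈ S R ↔ f ρ = 0 ∧ ‖ρ‖ ≤ R := fun R ρ => by simp [hS]
  set T : ℝ → Finset {γ : ℝ // f (I * γ) = 0} := fun R => (S R).preimage _ hinj.injOn with hT
  have hTmem : ∀ R γ, γ ∈ T R ↔ |γ.1| ≤ R := fun R γ => by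
    rw [hT, Finset.mem_preimage, hSmem]
    simp [γ.2]
  have hsum : ∀ R, (∑ ρ ∈ S R, 1 / (z - ρ)) - (∑ ρ ∈ S R, 1 / (-conj z - ρ)) =
      2 * ((∑ γ ∈ T R, p γ : ℝ) : ℂ) := fun R => by
    rw [← Finset.sum_sub_distrib, ← Finset.sum_preimage _ (S R) hinj.injOn
      (fun ρ => 1 / (z - ρ) - 1 / (-conj z - ρ)), ofReal_sum, Finset.mul_sum]
    · refine Finset.sum_congr rfl fun γ _ => ?_
      have h1 : -conj z - I * (γ.1 : ℂ) = -conj (z - I * γ.1) := by simp; ring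
      have h2 : z - I * γ.1 ≠ 0 := fun h => by
        have := congrArg re h; simp at this; exact hz.ne' this
      rw [h1, div_neg, sub_neg_eq_add, ← map_one conj, ← map_div₀, map_one, add_conj, one_div, inv_re]
      simp [hp, normSq_apply]
      ring
    · intro ρ hρ hρ'
      have h1 := ((hSmem R ρ).1 hρ).1
      have h2 : ρ = I * (ρ.im : ℂ) := by
        apply Complex.ext
        · simp [hline ρ h1]
        · simp
      exact absurd ⟨⟨ρ.im, h2 ▸ h1⟩, h2.symm⟩ hρ'
  have hfz : f z ≠ 0 := fun h => hz.ne' (hline z h)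
  have hfw : f (-conj z) ≠ 0 := fun h => by
    have := hline _ h
    simp at this
    exact hz.ne' this
  set M : ℝ → ℝ := fun R => |C| * (1 + 2 * R) ^ (3 / 2 : ℝ) + |Real.log ‖f 0‖| + 1 with hMdef
  have hbound : ∀ R, 1 ≤ R → 8 * ‖z‖ < R →
      |(logDeriv f z).re - ∑ γ ∈ T R, p γ| ≤ 64 * M R / R ^ 2 * ‖z‖ := by
    intro R hR hzR
    have hM : 0 < M R := by positivity
    have h1 := norm_logDeriv_sub_sum_sub_le hf h0 hsimple (R := R) (M := M R) (z := z)
      (w := -conj z) (by linarith) hM (fun u hu => ?_)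
      (by rw [mem_ball_zero_iff]; linarith)
      (by rw [mem_ball_zero_iff, norm_neg, norm_conj]; linarith) hfz hfw
    · have h2 : (logDeriv f z - ∑ ρ ∈ S R, 1 / (z - ρ)) -
          (logDeriv f (-conj z) - ∑ ρ ∈ S R, 1 / (-conj z - ρ)) =
          ((2 * ((logDeriv f z).re - ∑ γ ∈ T R, p γ) : ℝ) : ℂ) := by
        rw [hsymm, sub_sub_sub_comm, hsum, sub_neg_eq_add, add_conj]
        push_cast
        ring
      rw [h2, norm_real, norm_mul, Real.norm_eq_abs, Real.norm_eq_abs, abs_two] at h1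
      have h3 : ‖z - -conj z‖ ≤ 2 * ‖z‖ := by
        rw [sub_neg_eq_add]
        refine (norm_add_le _ _).trans_eq ?_
        rw [norm_conj]; ring
      have h4 : 64 * M R / R ^ 2 * ‖z - -conj z‖ ≤ 64 * M R / R ^ 2 * (2 * ‖z‖) := by gcongr
      linarith
    · refine (hgrowth u).trans ?_
      rw [hu]
      have h5 : ‖f 0‖ = Real.exp (Real.log ‖f 0‖) := (Real.exp_log (norm_pos_iff.2 h0)).symm
      refine le_of_le_of_eq ?_ (congrArg (Real.exp (M R) * ·) h5.symm)
      rw [← Real.exp_add]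
      refine Real.exp_le_exp.2 ?_
      have h6 := neg_abs_le (Real.log ‖f 0‖)
      have h7 : C * (1 + 2 * R) ^ (3 / 2 : ℝ) ≤ |C| * (1 + 2 * R) ^ (3 / 2 : ℝ) := by
        gcongr; exact le_abs_self C
      simp only [hMdef]
      linarith
  have hlim : Filter.Tendsto (fun R => ∑ γ ∈ T R, p γ) Filter.atTop (nhds (logDeriv f z).re) := by
    have hz0 : Filter.Tendsto (fun R : ℝ => 64 * (|C| * 3 ^ (3 / 2 : ℝ) + |Real.log ‖f 0‖| + 1) *
        ‖z‖ * R ^ (-(1 / 2) : ℝ)) Filter.atTop (nhds 0) := by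
      simpa using (tendsto_rpow_neg_atTop (y := 1 / 2) (by norm_num)).const_mul
        (64 * (|C| * 3 ^ (3 / 2 : ℝ) + |Real.log ‖f 0‖| + 1) * ‖z‖)
    rw [tendsto_iff_norm_sub_tendsto_zero]
    refine squeeze_zero' (Filter.Eventually.of_forall fun _ => norm_nonneg _) ?_ hz0
    filter_upwards [Filter.eventually_ge_atTop 1, Filter.eventually_gt_atTop (8 * ‖z‖)] with R hR hzR
    rw [norm_sub_rev]
    refine (hbound R hR hzR).trans ?_
    have hR0 : 0 < R := by linarith
    have h1 : M R ≤ (|C| * 3 ^ (3 / 2 : ℝ) + |Real.log ‖f 0‖| + 1) * R ^ (3 / 2 : ℝ) := by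
      have h2 : (1 + 2 * R) ^ (3 / 2 : ℝ) ≤ 3 ^ (3 / 2 : ℝ) * R ^ (3 / 2 : ℝ) := by
        rw [← Real.mul_rpow (by norm_num) hR0.le]
        gcongr
        linarith
      have h3 : 1 ≤ R ^ (3 / 2 : ℝ) := Real.one_le_rpow hR (by norm_num)
      have h4 := mul_le_mul_of_nonneg_left h2 (abs_nonneg C)
      have h5 := mul_le_mul_of_nonneg_left h3 (abs_nonneg (Real.log ‖f 0‖))
      simp only [hMdef]
      linarith
    have h2 : R ^ (3 / 2 : ℝ) = R ^ 2 * R ^ (-(1 / 2) : ℝ) := by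
      rw [← Real.rpow_natCast, ← Real.rpow_add hR0]; norm_num
    rw [h2] at h1
    rw [div_mul_eq_mul_div, div_le_iff₀ (by positivity)]
    calc 64 * M R * ‖z‖ ≤ 64 * ((|C| * 3 ^ (3 / 2 : ℝ) + |Real.log ‖f 0‖| + 1) *
          (R ^ 2 * R ^ (-(1 / 2) : ℝ))) * ‖z‖ := by gcongr
      _ = _ := by ring
  refine hasSum_of_isLUB_of_nonneg _ hp0 ⟨?_, fun b hb => ?_⟩
  · rintro _ ⟨U, rfl⟩
    refine ge_of_tendsto hlim ?_
    have h1 : ∀ γ ∈ U, ∀ᶠ R in Filter.atTop, γ ∈ T R := fun γ _ => by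
      filter_upwards [Filter.eventually_ge_atTop |γ.1|] with R hR using (hTmem R γ).2 hR
    filter_upwards [(Finset.eventually_all U).2 h1] with R hR
    exact Finset.sum_le_sum_of_subset_of_nonneg hR fun γ _ _ => hp0 γ
  · exact le_of_tendsto hlim (Filter.Eventually.of_forall fun R => hb ⟨T R, rfl⟩)

end PartialFractions

section Digamma
open Complex Filter Topology

lemma norm_one_sub_exp_neg_mul_le {w : ℂ} (hw : 0 < w.re) {y : ℝ} (hy : 0 ≤ y) :
    ‖1 - exp (-(w * y))‖ ≤ ‖w‖ / w.re * (1 - Real.exp (-(w.re * y))) := by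
  have h1 : ∀ u : ℝ, HasDerivAt (fun u : ℝ => 1 - exp (-(w * u))) (w * exp (-(w * u))) u := by
    intro u
    have h := ((((hasDerivAt_id (u : ℂ)).const_mul w).neg.cexp).const_sub 1).comp_ofReal
    refine h.congr_deriv ?_
    simp
    ring
  have h2 : ∀ u : ℝ, HasDerivAt (fun u : ℝ => ‖w‖ / w.re * (1 - Real.exp (-(w.re * u))))
      (‖w‖ * Real.exp (-(w.re * u))) u := by
    intro u
    have h := ((((hasDerivAt_id u).const_mul w.re).neg.exp).const_sub 1).const_mul (‖w‖ / w.re)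
    refine h.congr_deriv ?_
    simp
    field_simp
  refine image_norm_le_of_norm_deriv_right_le_deriv_boundary (a := 0) (b := y)
    (fun u _ => (h1 u).continuousAt.continuousWithinAt) (fun u _ => (h1 u).hasDerivWithinAt)
    (by simp) h2 (fun u _ => ?_) ⟨hy, le_rfl⟩
  rw [norm_mul, norm_exp]
  simp

lemma norm_one_sub_exp_neg_mul_le' {w : ℂ} (hw : 0 < w.re) (hw1 : w.re ≤ 1) {y : ℝ} (hy : 0 ≤ y) :
    ‖1 - exp (-(w * y))‖ ≤ ‖w‖ / w.re * (1 - Real.exp (-y)) := by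
  refine (norm_one_sub_exp_neg_mul_le hw hy).trans ?_
  gcongr
  nlinarith

lemma image_exp_neg_Ioi : (fun y : ℝ => Real.exp (-y)) '' Set.Ioi 0 = Set.Ioo 0 1 := by
  ext x
  constructor
  · rintro ⟨y, hy, rfl⟩
    exact ⟨Real.exp_pos _, by simpa using hy⟩
  · rintro ⟨h0, h1⟩
    exact ⟨-Real.log x, by simpa using Real.log_neg h0 h1, by simp [Real.exp_log h0]⟩

lemma norm_one_sub_cpow_le {w : ℂ} (hw : 0 < w.re) (hw1 : w.re ≤ 1) {x : ℝ}
    (hx : x ∈ Set.Ioo (0 : ℝ) 1) : ‖1 - (x : ℂ) ^ w‖ ≤ ‖w‖ / w.re * (1 - x) := by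
  rw [← image_exp_neg_Ioi] at hx
  obtain ⟨y, hy, rfl⟩ := hx
  refine le_of_eq_of_le ?_ (norm_one_sub_exp_neg_mul_le' hw hw1 (le_of_lt hy))
  rw [cpow_def_of_ne_zero (by exact_mod_cast (Real.exp_pos _).ne'), ← ofReal_log (Real.exp_pos _).le,
    Real.log_exp]
  congr 3
  push_cast
  ring

lemma tendsto_betaIntegral_sub {w : ℂ} (hw : 0 < w.re) (hw1 : w.re ≤ 1) :
    Tendsto (fun v : ℝ => betaIntegral 1 v - betaIntegral (1 + w) v) (𝓝[>] 0)
      (𝓝 (∫ x in (0 : ℝ)..1, (1 - (x : ℂ) ^ w) * ((1 - x : ℝ) : ℂ) ^ (-1 : ℂ))) := by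
  have h1 : ∀ᶠ v : ℝ in 𝓝[>] 0, (∫ x in (0 : ℝ)..1, (1 - (x : ℂ) ^ w) * ((1 - x : ℝ) : ℂ) ^ ((v : ℂ) - 1)) =
      betaIntegral 1 v - betaIntegral (1 + w) v := by
    filter_upwards [self_mem_nhdsWithin] with v hv
    have hv : 0 < v := hv
    rw [betaIntegral, betaIntegral, ← intervalIntegral.integral_sub
      (betaIntegral_convergent (by simp) (by simpa using hv))
      (betaIntegral_convergent (by simp; linarith) (by simpa using hv))]
    refine intervalIntegral.integral_congr fun x _ => ?_
    simp
    ring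
  refine Tendsto.congr' h1 ?_
  refine intervalIntegral.tendsto_integral_filter_of_dominated_convergence
    (fun _ => ‖w‖ / w.re) ?_ ?_ (by simp) ?_
  · filter_upwards with v
    refine Measurable.aestronglyMeasurable ?_
    fun_prop
  · filter_upwards [self_mem_nhdsWithin] with v hv
    have hv : 0 < v := hv
    have hae : ∀ᵐ x : ℝ, x ≠ 1 := by simp [ae_iff]
    filter_upwards [hae] with x hx1 hx
    rw [Set.uIoc_of_le zero_le_one] at hx
    have hx' : x < 1 := lt_of_le_of_ne hx.2 hx1
    have h2 := norm_one_sub_cpow_le hw hw1 ⟨hx.1, hx'⟩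
    rw [norm_mul, norm_cpow_eq_rpow_re_of_pos (by linarith)]
    calc _ ≤ (‖w‖ / w.re * (1 - x)) * (1 - x) ^ (((v : ℂ) - 1).re) := by gcongr
      _ = ‖w‖ / w.re * (1 - x) ^ v := by
        rw [mul_assoc]
        congr 1
        have := Real.rpow_add (show 0 < 1 - x by linarith) 1 (v - 1)
        rw [Real.rpow_one, add_sub_cancel] at this
        simpa using this.symm
      _ ≤ ‖w‖ / w.re * 1 := by
        gcongr
        exact Real.rpow_le_one (by linarith) (by linarith [hx.1]) hv.le
      _ = _ := mul_one _
  · have hae : ∀ᵐ x : ℝ, x ≠ 1 := by simp [ae_iff]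
    filter_upwards [hae] with x hx1 hx
    rw [Set.uIoc_of_le zero_le_one] at hx
    have hx' : x < 1 := lt_of_le_of_ne hx.2 hx1
    refine Tendsto.const_mul _ ?_
    have h3 : Tendsto (fun v : ℝ => (v : ℂ) - 1) (𝓝[>] 0) (𝓝 (-1)) := by
      have : Continuous fun v : ℝ => (v : ℂ) - 1 := by fun_prop
      have h := this.tendsto 0
      simp only [ofReal_zero, zero_sub] at h
      exact h.mono_left nhdsWithin_le_nhds
    exact h3.const_cpow (Or.inl (by exact_mod_cast (show (1 - x : ℝ) ≠ 0 by linarith)))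

lemma tendsto_betaIntegral_sub_digamma {w : ℂ} (hw : 0 < w.re) :
    Tendsto (fun v : ℝ => betaIntegral 1 v - betaIntegral (1 + w) v) (𝓝[>] 0)
      (𝓝 (digamma (1 + w) + Real.eulerMascheroniConstant)) := by
  have hne : ∀ z : ℂ, 0 < z.re → Gamma z ≠ 0 := fun z hz => Gamma_ne_zero_of_re_pos hz
  have hd : ∀ z : ℂ, 0 < z.re → DifferentiableAt ℂ Gamma z := fun z hz =>
    differentiableAt_Gamma _ fun m h => by rw [h] at hz; simp at hz; linarith [m.cast_nonneg (α := ℝ)]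
  have hs : 0 < (1 + w).re := by simp; linarith
  have hder : ∀ z : ℂ, 0 < z.re → HasDerivAt (fun v : ℝ => Gamma z / Gamma (z + v))
      (-digamma z) 0 := fun z hz => by
    have h2 : HasDerivAt (fun v : ℝ => z + (v : ℂ)) 1 0 := by
      simpa using ((hasDerivAt_id (0 : ℂ)).const_add z).comp_ofReal
    have h3 : HasDerivAt (fun v : ℝ => Gamma (z + v)) (deriv Gamma z) 0 := by
      have h := HasDerivAt.comp (𝕜 := ℝ) (𝕜' := ℂ) (0 : ℝ) (h₂ := Gamma) (h := fun v : ℝ => z + (v : ℂ))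
        (h₂' := deriv Gamma z) (h' := 1) (by simpa using (hd z hz).hasDerivAt) h2
      rw [mul_one] at h
      exact h
    refine ((h3.inv (by simpa using hne z hz)).const_mul (Gamma z)).congr_deriv ?_
    rw [digamma_def, logDeriv_apply]
    have := hne z hz
    simp
    field_simp
  have hD := (hder 1 (by simp)).sub (hder (1 + w) hs)
  have hlim := hD.tendsto_slope_zero_right
  have hG : Tendsto (fun v : ℝ => Gamma (1 + v)) (𝓝[>] 0) (𝓝 1) := by
    have h : ContinuousAt (fun v : ℝ => Gamma (1 + v)) 0 :=
      ContinuousAt.comp (g := Gamma) (by simpa using (hd 1 (by simp)).continuousAt) (by fun_prop)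
    have h2 := h.tendsto
    simp only [ofReal_zero, add_zero, Gamma_one] at h2
    exact h2.mono_left nhdsWithin_le_nhds
  have := hG.mul hlim
  rw [digamma_one, one_mul] at this
  refine (this.congr' ?_).trans_eq ?_
  · filter_upwards [self_mem_nhdsWithin] with v hv
    have hv : 0 < v := hv
    have hvr : 0 < ((v : ℂ)).re := by simpa using hv
    have h1 := Gamma_mul_Gamma_eq_betaIntegral (s := 1) (t := v) (by simp) hvr
    have h2 := Gamma_mul_Gamma_eq_betaIntegral (s := 1 + w) (t := v) hs hvr
    have h3 := hne (1 + v) (by simp; linarith)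
    have h4 := hne (1 + w + v) (by simp; linarith)
    have hv0 : (v : ℂ) ≠ 0 := by exact_mod_cast hv.ne'
    have h5 : Gamma (1 + v) = v * Gamma v := by rw [add_comm, Gamma_add_one _ hv0]
    rw [Gamma_one, one_mul] at h1
    have h6 : betaIntegral 1 v = Gamma v / Gamma (1 + v) := by rw [h1]; field_simp
    have h7 : betaIntegral (1 + w) v = Gamma (1 + w) * Gamma v / Gamma (1 + w + v) := by
      rw [h2]; field_simp
    rw [h6, h7]
    simp only [zero_add, ofReal_zero, add_zero, Gamma_one, real_smul, Pi.sub_apply]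
    rw [div_self (hne _ hs), h5]
    rw [h5] at h3
    have h8 := right_ne_zero_of_mul h3
    push_cast
    field_simp
    ring
  · congr 1
    ring

theorem digamma_one_add_eq_integral {w : ℂ} (hw : 0 < w.re) (hw1 : w.re ≤ 1) :
    digamma (1 + w) = -Real.eulerMascheroniConstant + ∫ y in Set.Ioi (0 : ℝ),
      (1 - exp (-(w * y))) * ((Real.exp (-y) / (1 - Real.exp (-y)) : ℝ) : ℂ) := by
  have h := tendsto_nhds_unique (tendsto_betaIntegral_sub hw hw1) (tendsto_betaIntegral_sub_digamma hw)
  rw [intervalIntegral.integral_of_le zero_le_one, integral_Ioc_eq_integral_Ioo, ← image_exp_neg_Ioi,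
    integral_image_eq_integral_abs_deriv_smul measurableSet_Ioi
      (f' := fun y => -Real.exp (-y)) (fun y _ => by
        simpa using ((hasDerivAt_id y).neg.exp).hasDerivWithinAt)
      (fun a _ b _ h => by simpa using h)] at h
  rw [← sub_eq_iff_eq_add.2 h, sub_eq_neg_add]
  congr 1
  refine setIntegral_congr_fun measurableSet_Ioi fun y hy => ?_
  rw [abs_neg, abs_of_pos (Real.exp_pos _), cpow_def_of_ne_zero (by exact_mod_cast (Real.exp_pos _).ne'),
    ← ofReal_log (Real.exp_pos _).le, Real.log_exp, cpow_neg_one, real_smul]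
  push_cast
  rw [show -(y : ℂ) * w = -(w * y) by ring]
  ring

end Digamma

section Digamma
open Complex Filter Topology

lemma norm_one_sub_exp_mul_kernel_le {w : ℂ} (hw : 0 < w.re) (hw1 : w.re ≤ 1) {y : ℝ}
    (hy : 0 < y) :
    ‖(1 - exp (-(w * y))) * ((Real.exp (-y) / (1 - Real.exp (-y)) : ℝ) : ℂ)‖ ≤
      √(2 * ‖w‖ / w.re) * (Real.exp (-y) / √(1 - Real.exp (-y))) := by
  have h1 : 0 < 1 - Real.exp (-y) := by simpa using hy
  have h2 := norm_one_sub_exp_neg_mul_le' hw hw1 hy.le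
  have h3 : ‖1 - exp (-(w * y))‖ ≤ 2 := by
    refine (norm_sub_le _ _).trans ?_
    have : ‖exp (-(w * y))‖ ≤ 1 := by
      rw [norm_exp, Real.exp_le_one_iff]
      simp
      positivity
    rw [norm_one]
    linarith
  have h4 : ‖1 - exp (-(w * y))‖ ≤ √(2 * ‖w‖ / w.re) * √(1 - Real.exp (-y)) := by
    rw [← Real.sqrt_mul (by positivity)]
    refine Real.le_sqrt_of_sq_le ?_
    rw [sq]
    refine (mul_le_mul h3 h2 (norm_nonneg _) zero_le_two).trans_eq ?_
    ring
  rw [norm_mul, norm_real, Real.norm_of_nonneg (by positivity)]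
  refine (mul_le_mul_of_nonneg_right h4 (by positivity)).trans_eq ?_
  rw [mul_assoc]
  congr 1
  have h5 := Real.mul_self_sqrt h1.le
  have h6 : 0 < √(1 - Real.exp (-y)) := Real.sqrt_pos.2 h1
  conv_lhs => rw [← h5]
  rw [Real.sqrt_mul_self h6.le]
  field_simp

lemma integrableOn_exp_neg_div_sqrt :
    IntegrableOn (fun y => Real.exp (-y) / √(1 - Real.exp (-y))) (Set.Ioi 0) := by
  have hd : ∀ y ∈ Set.Ioi (0 : ℝ), HasDerivAt (fun y => 2 * √(1 - Real.exp (-y)))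
      (Real.exp (-y) / √(1 - Real.exp (-y))) y := fun y hy => by
    have h1 : 0 < 1 - Real.exp (-y) := by simpa using hy
    have h := ((((hasDerivAt_id y).neg.exp).const_sub 1).sqrt h1.ne').const_mul 2
    refine h.congr_deriv ?_
    simp
    field_simp
  refine integrableOn_Ioi_deriv_of_nonneg (l := 2) (by fun_prop) hd (fun y _ => by positivity) ?_
  have h := ((Real.tendsto_exp_neg_atTop_nhds_zero.const_sub 1).sqrt).const_mul 2
  simpa using h

lemma integrableOn_one_sub_exp_mul_kernel {w : ℂ} (hw : 0 < w.re) (hw1 : w.re ≤ 1) :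
    IntegrableOn (fun y : ℝ => (1 - exp (-(w * y))) *
      ((Real.exp (-y) / (1 - Real.exp (-y)) : ℝ) : ℂ)) (Set.Ioi 0) := by
  refine (integrableOn_exp_neg_div_sqrt.const_mul (√(2 * ‖w‖ / w.re))).mono' ?_ ?_
  · exact Measurable.aestronglyMeasurable (by fun_prop)
  · filter_upwards [ae_restrict_mem measurableSet_Ioi] with y hy
    exact norm_one_sub_exp_mul_kernel_le hw hw1 hy

lemma norm_digamma_one_add_le {w : ℂ} (hw : 0 < w.re) (hw1 : w.re ≤ 1) :
    ‖digamma (1 + w)‖ ≤ |Real.eulerMascheroniConstant| + √(2 * ‖w‖ / w.re) *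
      ∫ y in Set.Ioi (0 : ℝ), Real.exp (-y) / √(1 - Real.exp (-y)) := by
  rw [digamma_one_add_eq_integral hw hw1]
  refine (norm_add_le _ _).trans ?_
  rw [norm_neg, norm_real, Real.norm_eq_abs, ← integral_const_mul]
  gcongr
  refine norm_integral_le_of_norm_le (integrableOn_exp_neg_div_sqrt.const_mul _) ?_
  filter_upwards [ae_restrict_mem measurableSet_Ioi] with y hy
  exact norm_one_sub_exp_mul_kernel_le hw hw1 hy

lemma exists_norm_digamma_le {θ : ℝ} (hθ : 0 < θ) (hθ1 : θ ≤ 1) :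
    ∃ C, 0 ≤ C ∧ ∀ t : ℝ, ‖digamma (1 + θ + t * I)‖ ≤ C * √(1 + |t|) := by
  set K := ∫ y in Set.Ioi (0 : ℝ), Real.exp (-y) / √(1 - Real.exp (-y)) with hK
  have hK0 : 0 ≤ K := setIntegral_nonneg measurableSet_Ioi fun y _ => by positivity
  refine ⟨|Real.eulerMascheroniConstant| + √(2 / θ) * K, by positivity, fun t => ?_⟩
  have h := norm_digamma_one_add_le (w := θ + t * I) (by simpa using hθ) (by simpa using hθ1)
  rw [← add_assoc] at h
  refine h.trans ?_
  have h1 : ‖(θ : ℂ) + t * I‖ ≤ 1 + |t| := by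
    refine (norm_add_le _ _).trans ?_
    simp only [norm_mul, norm_real, norm_I, mul_one, Real.norm_eq_abs, abs_of_pos hθ]
    linarith
  have h2 : 1 ≤ √(1 + |t|) := Real.one_le_sqrt.2 (by linarith [abs_nonneg t])
  have h3 : √(2 * ‖(θ : ℂ) + t * I‖ / ((θ : ℂ) + t * I).re) ≤ √(2 / θ) * √(1 + |t|) := by
    rw [← Real.sqrt_mul (by positivity)]
    refine Real.sqrt_le_sqrt ?_
    simp only [add_re, ofReal_re, mul_re, I_re, mul_zero, ofReal_im, I_im, mul_one, sub_self,
      add_zero]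
    rw [div_mul_eq_mul_div]
    gcongr
  rw [add_mul]
  refine add_le_add (le_mul_of_one_le_right (abs_nonneg _) h2) ?_
  calc _ ≤ (√(2 / θ) * √(1 + |t|)) * K := by gcongr
    _ = _ := by ring

lemma differentiableAt_Gamma_of_re_pos {z : ℂ} (hz : 0 < z.re) : DifferentiableAt ℂ Gamma z :=
  differentiableAt_Gamma _ fun m h => by
    rw [h] at hz; simp at hz; linarith [m.cast_nonneg (α := ℝ)]

lemma continuousAt_digamma {z : ℂ} (hz : 0 < z.re) : ContinuousAt digamma z := by
  have h1 : DifferentiableOn ℂ Gamma {z | 0 < z.re} := fun z hz =>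
    (differentiableAt_Gamma_of_re_pos hz).differentiableWithinAt
  have hmem := (isOpen_lt continuous_const continuous_re).mem_nhds hz
  have h2 := ((h1.deriv (isOpen_lt continuous_const continuous_re)).differentiableAt hmem)
  exact h2.continuousAt.div (differentiableAt_Gamma_of_re_pos hz).continuousAt
    (Gamma_ne_zero_of_re_pos hz)

lemma digamma_half_add_digamma_half {s : ℂ} (hs : 0 < s.re) :
    digamma (s / 2) + digamma ((s + 1) / 2) = 2 * digamma s - 2 * Real.log 2 := by
  have hs2 : 0 < (s / 2).re := by simpa using hs
  have hs3 : 0 < (s / 2 + 1 / 2).re := by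
    have : ((1 / 2 : ℂ)).re = 1 / 2 := by simp
    rw [add_re, this]; linarith
  have hss : 2 * (s / 2) = s := by ring
  have hG := Gamma_ne_zero_of_re_pos hs
  have h2pi : ((√Real.pi : ℝ) : ℂ) ≠ 0 := by exact_mod_cast (Real.sqrt_pos.2 Real.pi_pos).ne'
  have h1 : logDeriv (fun z => Gamma z * Gamma (z + 1 / 2)) (s / 2) =
      digamma (s / 2) + digamma (s / 2 + 1 / 2) := by
    rw [logDeriv_mul (f := Gamma) (g := fun z => Gamma (z + 1 / 2)) _ (Gamma_ne_zero_of_re_pos hs2)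
      (Gamma_ne_zero_of_re_pos hs3) (differentiableAt_Gamma_of_re_pos hs2)
      ((differentiableAt_Gamma_of_re_pos hs3).comp (s / 2) (by fun_prop))]
    congr 1
    rw [digamma_def, logDeriv_apply, logDeriv_apply, deriv_comp_add_const]
  have h2 : HasDerivAt (fun z : ℂ => Gamma (2 * z)) (2 * deriv Gamma s) (s / 2) := by
    have h := HasDerivAt.comp (s / 2) (h₂ := Gamma) (h := fun z : ℂ => 2 * z) (h₂' := deriv Gamma s)
      (by rw [hss]; exact (differentiableAt_Gamma_of_re_pos hs).hasDerivAt)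
      ((hasDerivAt_id _).const_mul 2)
    refine h.congr_deriv ?_
    ring
  have h3 : HasDerivAt (fun z : ℂ => (2 : ℂ) ^ (1 - 2 * z)) ((2 : ℂ) ^ (1 - s) * log 2 * (-2)) (s / 2) := by
    have h := (((hasDerivAt_id (s / 2)).const_mul 2).const_sub 1).const_cpow (c := (2 : ℂ))
      (Or.inl two_ne_zero)
    refine h.congr_deriv ?_
    simp [hss]
  have h4 : logDeriv (fun z => Gamma z * Gamma (z + 1 / 2)) (s / 2) = 2 * digamma s - 2 * Real.log 2 := by
    have hf : (fun z => Gamma z * Gamma (z + 1 / 2)) = fun z => Gamma (2 * z) * (2 : ℂ) ^ (1 - 2 * z) * ↑(√Real.pi) :=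
      funext Gamma_mul_Gamma_add_half
    have h2c : (2 : ℂ) ^ (1 - s) ≠ 0 := by simp [cpow_eq_zero_iff]
    have h5 : deriv (fun z : ℂ => Gamma (2 * z) * (2 : ℂ) ^ (1 - 2 * z)) (s / 2) = _ := (h2.mul h3).deriv
    rw [hf, logDeriv_mul_const _ _ h2pi, logDeriv_apply, h5, digamma_def, logDeriv_apply, hss,
      ofReal_log zero_le_two]
    push_cast
    field_simp
    ring
  rw [← h4, h1]
  congr 2
  ring

end Digamma

section FourierCosine

open FourierTransform Filter Topology

lemma integrable_exp_neg_mul_abs {c : ℝ} (hc : 0 < c) :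
    Integrable fun u : ℝ => Real.exp (-c * |u|) := by
  rw [← integrableOn_univ, ← Set.Iic_union_Ioi (a := (0:ℝ)), integrableOn_union]
  constructor
  · refine (integrableOn_exp_mul_Iic hc 0).congr_fun (fun u hu => ?_) measurableSet_Iic
    simp [abs_of_nonpos (Set.mem_Iic.mp hu)]
  · refine (integrableOn_exp_mul_Ioi (neg_lt_zero.mpr hc) 0).congr_fun (fun u hu => ?_)
      measurableSet_Ioi
    simp [abs_of_pos (Set.mem_Ioi.mp hu)]

lemma integrable_of_abs_le_exp {f : ℝ → ℝ} (hf : AEStronglyMeasurable f) {C c : ℝ} (hc : 0 < c)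
    (h : ∀ t, |f t| ≤ C * Real.exp (-c * |t|)) : Integrable f :=
  ((integrable_exp_neg_mul_abs hc).const_mul C).mono' hf (.of_forall h)

lemma integrableOn_Ioi_of_abs_le_exp {f : ℝ → ℝ} (hf : AEStronglyMeasurable f) {C c : ℝ}
    (hc : 0 < c) (h : ∀ t, 0 ≤ t → |f t| ≤ C * Real.exp (-c * t)) :
    IntegrableOn f (Set.Ioi 0) := by
  refine ((integrableOn_exp_mul_Ioi (neg_lt_zero.mpr hc) 0).const_mul C).mono' hf.restrict ?_
  filter_upwards [ae_restrict_mem measurableSet_Ioi] with t ht using h t (le_of_lt ht)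

lemma integral_mul_sin_eq_zero {f : ℝ → ℝ} (heven : ∀ t, f (-t) = f t) (x : ℝ) :
    ∫ t, f t * Real.sin (x * t) = 0 := by
  have := integral_neg_eq_self (fun t => f t * Real.sin (x * t)) volume
  simp only [heven, mul_neg, Real.sin_neg, integral_neg] at this
  linarith

lemma fourier_ofReal_eq {f : ℝ → ℝ} (hf : Integrable f) (heven : ∀ t, f (-t) = f t) (ξ : ℝ) :
    𝓕 (fun t => (f t : ℂ)) ξ = (fourierR f ξ : ℂ) := by
  have hc : Integrable fun t => f t * Real.cos (2 * Real.pi * ξ * t) :=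
    hf.mul_bdd (c := 1) (by fun_prop) (.of_forall fun t => Real.abs_cos_le_one _)
  have hs : Integrable fun t => f t * Real.sin (2 * Real.pi * ξ * t) :=
    hf.mul_bdd (c := 1) (by fun_prop) (.of_forall fun t => Real.abs_sin_le_one _)
  have hz := integral_mul_sin_eq_zero heven (2 * Real.pi * ξ)
  have : ∀ t : ℝ, Complex.exp (↑(-2 * Real.pi * t * ξ) * Complex.I) • (f t : ℂ)
      = ((f t * Real.cos (2 * Real.pi * ξ * t) : ℝ) : ℂ)
        - ((f t * Real.sin (2 * Real.pi * ξ * t) : ℝ) : ℂ) * Complex.I := by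
    intro t
    rw [show -2 * Real.pi * t * ξ = -(2 * Real.pi * ξ * t) by ring, Complex.exp_mul_I,
      ← Complex.ofReal_cos, ← Complex.ofReal_sin, Real.cos_neg, Real.sin_neg]
    push_cast
    simp only [smul_eq_mul]
    ring
  rw [Real.fourier_real_eq_integral_exp_smul, integral_congr_ae (.of_forall this),
    integral_sub hc.ofReal (hs.ofReal.mul_const _), integral_mul_const, integral_complex_ofReal,
    integral_complex_ofReal, hz]
  simp [fourierR]

lemma fourierR_fourierR {f : ℝ → ℝ} (hcont : Continuous f) (hf : Integrable f)
    (heven : ∀ t, f (-t) = f t) (hF : Integrable (fourierR f)) (y : ℝ) :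
    fourierR (fourierR f) y = f y := by
  have hfour : 𝓕 (fun t => (f t : ℂ)) = fun ξ => (fourierR f ξ : ℂ) :=
    funext (fourier_ofReal_eq hf heven)
  have h := congrFun (Continuous.fourierInv_fourier_eq (f := fun t => (f t : ℂ))
    (by fun_prop) hf.ofReal (by rw [hfour]; exact hF.ofReal)) y
  rw [hfour, Real.fourierInv_eq_fourier_neg,
    fourier_ofReal_eq hF (fourierR_neg f), fourierR_neg] at h
  exact_mod_cast h

lemma fourierR_eq_two_mul {f : ℝ → ℝ} (heven : ∀ t, f (-t) = f t) (ξ : ℝ) :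
    fourierR f ξ = 2 * ∫ t in Set.Ioi (0:ℝ), f t * Real.cos (2 * Real.pi * ξ * t) := by
  rw [← integral_comp_abs (f := fun t => f t * Real.cos (2 * Real.pi * ξ * t)), fourierR]
  refine integral_congr_ae (.of_forall fun t => ?_)
  rcases abs_cases t with ⟨h, -⟩ | ⟨h, -⟩ <;> simp [h, heven]

lemma abs_integral_mul_cos_le {g g' g'' : ℝ → ℝ} {K c : ℝ} (hc : 0 < c)
    (h1 : ∀ y, HasDerivAt g (g' y) y) (h2 : ∀ y, HasDerivAt g' (g'' y) y)
    (b0 : ∀ y, 0 ≤ y → |g y| ≤ K * Real.exp (-c * y))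
    (b1 : ∀ y, 0 ≤ y → |g' y| ≤ K * Real.exp (-c * y))
    (b2 : ∀ y, 0 ≤ y → |g'' y| ≤ K * Real.exp (-c * y)) (t : ℝ) :
    |∫ y in Set.Ioi (0:ℝ), g y * Real.cos (t * y)| ≤ (K + 2 * K / c) * (1 + t ^ 2)⁻¹ := by
  have hK : ∫ y in Set.Ioi (0:ℝ), K * Real.exp (-c * y) = K / c := by
    rw [integral_const_mul, integral_exp_mul_Ioi (neg_lt_zero.mpr hc)]
    simp; ring
  have hKi : IntegrableOn (fun y => K * Real.exp (-c * y)) (Set.Ioi 0) :=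
    (integrableOn_exp_mul_Ioi (neg_lt_zero.mpr hc) 0).const_mul K
  have hlim : Tendsto (fun y => K * Real.exp (-c * y)) atTop (𝓝 0) := by
    have : Tendsto (fun y => -c * y) atTop atBot :=
      tendsto_id.const_mul_atTop_of_neg (neg_lt_zero.mpr hc)
    simpa using (Real.tendsto_exp_atBot.comp this).const_mul K
  have hgc : Continuous g := continuous_iff_continuousAt.mpr fun y => (h1 y).continuousAt
  have hgc' : Continuous g' := continuous_iff_continuousAt.mpr fun y => (h2 y).continuousAt
  have hm : Measurable g'' := by
    rw [show g'' = deriv g' from funext fun y => (h2 y).deriv.symm]; exact measurable_deriv _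
  have bound : ∀ f : ℝ → ℝ, (∀ y, 0 ≤ y → |f y| ≤ K * Real.exp (-c * y)) →
      |∫ y in Set.Ioi (0:ℝ), f y * Real.cos (t * y)| ≤ K / c := by
    intro f hf
    rw [← hK, ← Real.norm_eq_abs]
    refine norm_integral_le_of_norm_le (g := fun y => K * Real.exp (-c * y)) hKi ?_
    filter_upwards [ae_restrict_mem measurableSet_Ioi] with y hy
    rw [norm_mul]
    exact (mul_le_of_le_one_right (norm_nonneg _) (Real.abs_cos_le_one _)).trans (hf y (le_of_lt hy))
  have hi0 : IntegrableOn (fun y => g y * Real.cos (t * y)) (Set.Ioi 0) :=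
    (integrableOn_Ioi_of_abs_le_exp hgc.aestronglyMeasurable hc b0).mul_bdd (c := 1)
      (by fun_prop) (.of_forall fun y => Real.abs_cos_le_one _)
  have hi2 : IntegrableOn (fun y => g'' y * Real.cos (t * y)) (Set.Ioi 0) :=
    (integrableOn_Ioi_of_abs_le_exp hm.aestronglyMeasurable hc b2).mul_bdd (c := 1)
      (by fun_prop) (.of_forall fun y => Real.abs_cos_le_one _)
  have hparts : ∫ y in Set.Ioi (0:ℝ), (t ^ 2 * (g y * Real.cos (t * y)) + g'' y * Real.cos (t * y))
      = 0 - (t * g 0 * Real.sin (t * 0) + g' 0 * Real.cos (t * 0)) := by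
    refine integral_Ioi_of_hasDerivAt_of_tendsto
      (f := fun y => t * g y * Real.sin (t * y) + g' y * Real.cos (t * y))
      (by fun_prop) (fun y _ => ?_) ((hi0.const_mul _).add hi2) ?_
    · have hs : HasDerivAt (fun y => Real.sin (t * y)) (Real.cos (t * y) * t) y := by
        simpa using ((hasDerivAt_id y).const_mul t).sin
      have hcs : HasDerivAt (fun y => Real.cos (t * y)) (-Real.sin (t * y) * t) y := by
        simpa using ((hasDerivAt_id y).const_mul t).cos
      refine ((((h1 y).const_mul t).mul hs).add ((h2 y).mul hcs)).congr_deriv ?_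
      ring
    · have hb : ∀ᶠ y in atTop, ‖t * g y * Real.sin (t * y) + g' y * Real.cos (t * y)‖
          ≤ |t| * (K * Real.exp (-c * y)) + K * Real.exp (-c * y) := by
        filter_upwards [eventually_ge_atTop 0] with y hy
        refine (norm_add_le _ _).trans (add_le_add ?_ ?_)
        · rw [norm_mul, norm_mul]
          exact (mul_le_of_le_one_right (by positivity) (Real.abs_sin_le_one _)).trans
            (mul_le_mul_of_nonneg_left (b0 y hy) (abs_nonneg _))
        · rw [norm_mul]
          exact (mul_le_of_le_one_right (by positivity) (Real.abs_cos_le_one _)).trans (b1 y hy)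
      exact squeeze_zero_norm' hb (by simpa using (hlim.const_mul |t|).add hlim)
  rw [integral_add (hi0.const_mul _) hi2, integral_const_mul] at hparts
  simp only [mul_zero, Real.sin_zero, Real.cos_zero, mul_one, zero_add, zero_sub] at hparts
  have e0 := bound g b0
  have e2 := bound g'' b2
  have e1 : |g' 0| ≤ K := by simpa using b1 0 le_rfl
  rw [← div_eq_mul_inv, le_div_iff₀ (by positivity)]
  have : |∫ y in Set.Ioi (0:ℝ), g y * Real.cos (t * y)| * t ^ 2
      ≤ K + K / c := by
    rw [← abs_of_nonneg (sq_nonneg t), ← abs_mul, mul_comm, show t ^ 2 * ∫ y in Set.Ioi (0:ℝ), g y * Real.cos (t * y)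
        = -g' 0 - ∫ y in Set.Ioi (0:ℝ), g'' y * Real.cos (t * y) by linarith]
    refine (abs_sub _ _).trans ?_
    rw [abs_neg]
    exact add_le_add e1 e2
  have : 2 * K / c = K / c + K / c := by ring
  nlinarith

lemma integrable_fourierR {f : ℝ → ℝ} (hf : Continuous f) {C : ℝ}
    (h : ∀ ξ, |fourierR f ξ| ≤ C * (1 + (2 * Real.pi * ξ) ^ 2)⁻¹)
    (hfi : Integrable f) : Integrable (fourierR f) := by
  have hm : Continuous (fourierR f) := by
    refine continuous_of_dominated (bound := fun t => |f t|) (fun ξ => by fun_prop)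
      (fun ξ => .of_forall fun t => ?_) hfi.abs (.of_forall fun t => by fun_prop)
    rw [norm_mul]
    exact mul_le_of_le_one_right (norm_nonneg _) (Real.abs_cos_le_one _)
  refine ((integrable_inv_one_add_sq.comp_mul_left' (R := 2 * Real.pi)
    (by positivity)).const_mul C).mono' hm.aestronglyMeasurable (.of_forall h)

end FourierCosine

section Autocorrelation

open FourierTransform Filter Topology

lemma norm_mul_le_of_abs_le_exp {f₁ f₂ : ℝ → ℝ} {C b c : ℝ} (hc : 0 ≤ c) (hcb : c ≤ b)
    (h1 : ∀ t, |f₁ t| ≤ C * Real.exp (-b * |t|)) (h2 : ∀ t, |f₂ t| ≤ C * Real.exp (-b * |t|))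
    (y u : ℝ) :
    ‖f₁ u * f₂ (y - u)‖ ≤ C ^ 2 * Real.exp (-c * |y|) * Real.exp (-(b - c) * |u|) := by
  have hC : 0 ≤ C := by simpa using (abs_nonneg _).trans (h1 0)
  rw [norm_mul]
  refine (mul_le_mul (h1 u) (h2 (y - u)) (abs_nonneg _) (by positivity)).trans ?_
  rw [show C * Real.exp (-b * |u|) * (C * Real.exp (-b * |y - u|))
    = C ^ 2 * Real.exp (-b * |u| + -b * |y - u|) by rw [Real.exp_add]; ring, mul_assoc,
    ← Real.exp_add]
  have : |y| ≤ |y - u| + |u| := by simpa using abs_add_le (y - u) u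
  refine mul_le_mul_of_nonneg_left (Real.exp_le_exp.mpr ?_) (sq_nonneg C)
  nlinarith [abs_nonneg (y - u), abs_nonneg u]

lemma abs_integral_mul_comp_sub_le {f₁ f₂ : ℝ → ℝ} {C b c : ℝ} (hc : 0 ≤ c) (hcb : c < b)
    (h1 : ∀ t, |f₁ t| ≤ C * Real.exp (-b * |t|)) (h2 : ∀ t, |f₂ t| ≤ C * Real.exp (-b * |t|))
    (y : ℝ) :
    |∫ u, f₁ u * f₂ (y - u)|
      ≤ (C ^ 2 * ∫ u : ℝ, Real.exp (-(b - c) * |u|)) * Real.exp (-c * |y|) := by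
  have := norm_integral_le_of_norm_le
    ((integrable_exp_neg_mul_abs (sub_pos.mpr hcb)).const_mul (C ^ 2 * Real.exp (-c * |y|)))
    (.of_forall (norm_mul_le_of_abs_le_exp hc hcb.le h1 h2 y))
  rw [integral_const_mul, Real.norm_eq_abs] at this
  linarith

lemma hasDerivAt_integral_mul_comp_sub {f₁ f₂ : ℝ → ℝ} (h1 : Integrable f₁)
    (h2 : Differentiable ℝ f₂) {C : ℝ} (hb : ∀ t, |f₂ t| ≤ C) (hb' : ∀ t, |deriv f₂ t| ≤ C)
    (y : ℝ) :
    HasDerivAt (fun y => ∫ u, f₁ u * f₂ (y - u)) (∫ u, f₁ u * deriv f₂ (y - u)) y := by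
  have hcont := h2.continuous
  refine (hasDerivAt_integral_of_dominated_loc_of_deriv_le (s := Set.univ)
    (bound := fun u => |f₁ u| * C) (F := fun y u => f₁ u * f₂ (y - u))
    (F' := fun y u => f₁ u * deriv f₂ (y - u)) Filter.univ_mem (.of_forall fun y => ?_) ?_ ?_ ?_
    (h1.abs.mul_const C) ?_).2
  · exact h1.aestronglyMeasurable.mul (by fun_prop : Continuous fun u => f₂ (y - u)).aestronglyMeasurable
  · exact h1.mul_bdd (c := C) (by fun_prop : Continuous fun u => f₂ (y - u)).aestronglyMeasurable
      (.of_forall fun u => hb _)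
  · exact h1.aestronglyMeasurable.mul
      ((measurable_deriv f₂).comp (measurable_const.sub measurable_id)).aestronglyMeasurable
  · refine .of_forall fun u x _ => ?_
    rw [norm_mul]
    exact mul_le_mul_of_nonneg_left (hb' _) (norm_nonneg _)
  · refine .of_forall fun u x _ => ?_
    have := ((h2 (x - u)).hasDerivAt.comp x ((hasDerivAt_id x).sub_const u)).const_mul (f₁ u)
    simpa using! this

/-- The autocorrelation of a real function. -/
noncomputable def autocorr (η : ℝ → ℝ) (y : ℝ) : ℝ := ∫ u, η u * η (y - u)

lemma autocorr_neg {η : ℝ → ℝ} (heven : ∀ t, η (-t) = η t) (y : ℝ) :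
    autocorr η (-y) = autocorr η y := by
  rw [autocorr, ← integral_neg_eq_self]
  refine integral_congr_ae (.of_forall fun u => ?_)
  simp only [heven]
  rw [← heven (y - u)]
  ring_nf

variable {δ : ℝ} {η : ℝ → ℝ}

lemma MemS.integrable (hδ : 0 < δ) (h : MemS δ η) : Integrable η := by
  obtain ⟨-, hd, -, ⟨C, -, hC⟩, -⟩ := h
  exact integrable_of_abs_le_exp hd.continuous.aestronglyMeasurable (by linarith : 0 < 1/2 + δ)
    fun t => (hC t).1

lemma MemS.exists_autocorr_bounds (hδ : 0 < δ) (h : MemS δ η) :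
    ∃ (K : ℝ) (F' F'' : ℝ → ℝ), (∀ y, HasDerivAt (autocorr η) (F' y) y) ∧
      (∀ y, HasDerivAt F' (F'' y) y) ∧
      (∀ y, |autocorr η y| ≤ K * Real.exp (-(1/2 + δ/2) * |y|)) ∧
      (∀ y, |F' y| ≤ K * Real.exp (-(1/2 + δ/2) * |y|)) ∧
      (∀ y, |F'' y| ≤ K * Real.exp (-(1/2 + δ/2) * |y|)) := by
  have hi := h.integrable hδ
  obtain ⟨-, hd, -, ⟨C, hC0, hC⟩, -⟩ := h
  have hbd : ∀ t : ℝ, C * Real.exp (-(1/2 + δ) * |t|) ≤ C := fun t =>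
    mul_le_of_le_one_right hC0.le (Real.exp_le_one_iff.mpr
      (mul_nonpos_of_nonpos_of_nonneg (by linarith) (abs_nonneg t)))
  have hi' : Integrable (deriv η) := integrable_of_abs_le_exp
    (measurable_deriv η).aestronglyMeasurable (by linarith : 0 < 1/2 + δ) fun t => (hC t).2
  have hsub : ∀ y, ∫ u, η u * deriv η (y - u) = ∫ u, deriv η u * η (y - u) := by
    intro y
    rw [← integral_sub_left_eq_self _ volume y]
    refine integral_congr_ae (.of_forall fun u => ?_)
    simp only [sub_sub_cancel]
    ring
  refine ⟨C ^ 2 * ∫ u : ℝ, Real.exp (-((1/2 + δ) - (1/2 + δ/2)) * |u|),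
    fun y => ∫ u, deriv η u * η (y - u), fun y => ∫ u, deriv η u * deriv η (y - u),
    fun y => ?_, fun y => ?_, ?_, ?_, ?_⟩
  · simp only [← hsub]
    exact hasDerivAt_integral_mul_comp_sub hi hd (fun t => (hC t).1.trans (hbd t))
      (fun t => (hC t).2.trans (hbd t)) y
  · exact hasDerivAt_integral_mul_comp_sub hi' hd (fun t => (hC t).1.trans (hbd t))
      (fun t => (hC t).2.trans (hbd t)) y
  · exact abs_integral_mul_comp_sub_le (by linarith) (by linarith) (fun t => (hC t).1)
      fun t => (hC t).1
  · exact abs_integral_mul_comp_sub_le (by linarith) (by linarith) (fun t => (hC t).2)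
      fun t => (hC t).1
  · exact abs_integral_mul_comp_sub_le (by linarith) (by linarith) (fun t => (hC t).2)
      fun t => (hC t).2

lemma MemS.continuous_autocorr (hδ : 0 < δ) (h : MemS δ η) : Continuous (autocorr η) := by
  obtain ⟨K, F', F'', h1, -⟩ := h.exists_autocorr_bounds hδ
  exact continuous_iff_continuousAt.mpr fun y => (h1 y).continuousAt

lemma MemS.integrable_autocorr (hδ : 0 < δ) (h : MemS δ η) : Integrable (autocorr η) := by
  obtain ⟨K, F', F'', -, -, h3, -⟩ := h.exists_autocorr_bounds hδ
  exact integrable_of_abs_le_exp (h.continuous_autocorr hδ).aestronglyMeasurable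
    (by linarith : 0 < 1/2 + δ/2) h3

lemma MemS.fourierR_autocorr (hδ : 0 < δ) (h : MemS δ η) (ξ : ℝ) :
    fourierR (autocorr η) ξ = fourierR η ξ ^ 2 := by
  have hi := h.integrable hδ
  have heven := h.2.2.1
  have hconv := Real.fourier_mul_convolution_eq (f₁ := fun t => (η t : ℂ))
    (f₂ := fun t => (η t : ℂ)) hi.ofReal hi.ofReal ξ
  rw [fourier_ofReal_eq hi heven] at hconv
  have : MeasureTheory.convolution (fun t => (η t : ℂ)) (fun t => (η t : ℂ))
      (ContinuousLinearMap.mul ℂ ℂ) volume = fun y => (autocorr η y : ℂ) := by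
    funext y
    rw [convolution_def, autocorr, ← integral_complex_ofReal]
    simp
  rw [this, fourier_ofReal_eq (h.integrable_autocorr hδ) (autocorr_neg heven)] at hconv
  rw [sq]
  exact_mod_cast hconv

lemma MemS.exists_weighted_transform_bound (hδ : 0 < δ) (h : MemS δ η) {a : ℝ} (ha : 0 ≤ a)
    (ha' : a < 1/2 + δ/2) :
    ∃ C, ∀ ξ, |fourierR (fun y => autocorr η y * Real.exp (a * |y|)) ξ|
      ≤ C * (1 + (2 * Real.pi * ξ) ^ 2)⁻¹ := by
  obtain ⟨K, F', F'', h1, h2, b0, b1, b2⟩ := h.exists_autocorr_bounds hδ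
  set F := autocorr η
  have hK : 0 ≤ K := by simpa using (abs_nonneg _).trans (b0 0)
  set c := 1/2 + δ/2 - a with hcdef
  have hexp : ∀ y, HasDerivAt (fun y => Real.exp (a * y)) (a * Real.exp (a * y)) y := by
    intro y
    simpa [mul_comm] using ((hasDerivAt_id y).const_mul a).exp
  have key : ∀ (f : ℝ → ℝ), (∀ y, |f y| ≤ K * Real.exp (-(1/2 + δ/2) * |y|)) → ∀ y, 0 ≤ y →
      |f y| * Real.exp (a * y) ≤ K * Real.exp (-c * y) := by
    intro f hf y hy
    refine (mul_le_mul_of_nonneg_right (hf y) (Real.exp_nonneg _)).trans (le_of_eq ?_)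
    rw [mul_assoc, ← Real.exp_add, abs_of_nonneg hy, hcdef]
    ring_nf
  set K' := K * (1 + 2 * a + a ^ 2)
  refine ⟨2 * (K' + 2 * K' / c), fun ξ => ?_⟩
  have main := abs_integral_mul_cos_le (g := fun y => F y * Real.exp (a * y))
    (g' := fun y => (F' y + a * F y) * Real.exp (a * y))
    (g'' := fun y => (F'' y + 2 * a * F' y + a ^ 2 * F y) * Real.exp (a * y)) (K := K')
    (sub_pos.mpr ha') (fun y => ((h1 y).mul (hexp y)).congr_deriv (by ring))
    (fun y => (((h2 y).add ((h1 y).const_mul a)).mul (hexp y)).congr_deriv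
      (by simp only [Pi.add_apply]; ring)) ?_ ?_ ?_ (2 * Real.pi * ξ)
  · have hev : ∀ t, (fun y => F y * Real.exp (a * |y|)) (-t)
        = (fun y => F y * Real.exp (a * |y|)) t := fun t => by
      simp [F, autocorr_neg h.2.2.1]
    rw [fourierR_eq_two_mul hev, abs_mul, abs_two, mul_assoc 2 (K' + 2 * K' / c)]
    refine mul_le_mul_of_nonneg_left (le_trans (le_of_eq ?_) main) zero_le_two
    congr 1
    refine setIntegral_congr_fun measurableSet_Ioi fun y hy => ?_
    simp [abs_of_pos (Set.mem_Ioi.mp hy)]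
  all_goals
    intro y hy
    have k0 := key F b0 y hy
    have k1 := key F' b1 y hy
    have k2 := key F'' b2 y hy
    have hE := Real.exp_nonneg (a * y)
    have hE' := Real.exp_nonneg (-c * y)
    rw [abs_mul, Real.abs_exp, show K' * Real.exp (-c * y)
      = (1 + 2 * a + a ^ 2) * (K * Real.exp (-c * y)) by ring]
    have hKE : 0 ≤ K * Real.exp (-c * y) := by positivity
  · nlinarith [mul_nonneg ha hKE, sq_nonneg a, mul_nonneg (sq_nonneg a) hKE]
  · have : |F' y + a * F y| ≤ |F' y| + a * |F y| := by
      refine (abs_add_le _ _).trans ?_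
      rw [abs_mul, abs_of_nonneg ha]
    have := mul_le_mul_of_nonneg_right this hE
    nlinarith [mul_nonneg ha hKE, mul_nonneg (sq_nonneg a) hKE, mul_le_mul_of_nonneg_left k0 ha]
  · have : |F'' y + 2 * a * F' y + a ^ 2 * F y| ≤ |F'' y| + 2 * a * |F' y| + a ^ 2 * |F y| := by
      refine (abs_add_three _ _ _).trans ?_
      rw [abs_mul, abs_mul (a ^ 2), abs_of_nonneg (by positivity : 0 ≤ 2 * a),
        abs_of_nonneg (sq_nonneg a)]
    have := mul_le_mul_of_nonneg_right this hE
    nlinarith [mul_le_mul_of_nonneg_left k0 (sq_nonneg a), mul_le_mul_of_nonneg_left k1 ha]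

lemma MemS.integrable_weighted (hδ : 0 < δ) (h : MemS δ η) {a : ℝ} (ha' : a < 1/2 + δ/2) :
    Integrable fun y => autocorr η y * Real.exp (a * |y|) := by
  have hc := h.continuous_autocorr hδ
  obtain ⟨K, F', F'', -, -, b0, -⟩ := h.exists_autocorr_bounds hδ
  refine integrable_of_abs_le_exp (by fun_prop : Continuous fun y => autocorr η y *
    Real.exp (a * |y|)).aestronglyMeasurable (C := K) (sub_pos.mpr ha') fun y => ?_
  rw [abs_mul, Real.abs_exp]
  refine (mul_le_mul_of_nonneg_right (b0 y) (Real.exp_nonneg _)).trans (le_of_eq ?_)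
  rw [mul_assoc, ← Real.exp_add]
  ring_nf

lemma MemS.integrable_fourierR_weighted (hδ : 0 < δ) (h : MemS δ η) {a : ℝ} (ha : 0 ≤ a)
    (ha' : a < 1/2 + δ/2) :
    Integrable (fourierR fun y => autocorr η y * Real.exp (a * |y|)) := by
  have hc := h.continuous_autocorr hδ
  obtain ⟨C, hC⟩ := h.exists_weighted_transform_bound hδ ha ha'
  exact integrable_fourierR (by fun_prop) hC (h.integrable_weighted hδ ha')

lemma MemS.fourierR_fourierR_weighted (hδ : 0 < δ) (h : MemS δ η) {a : ℝ} (ha : 0 ≤ a)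
    (ha' : a < 1/2 + δ/2) (y : ℝ) :
    fourierR (fourierR fun y => autocorr η y * Real.exp (a * |y|)) y
      = autocorr η y * Real.exp (a * |y|) := by
  have hc := h.continuous_autocorr hδ
  exact fourierR_fourierR (by fun_prop) (h.integrable_weighted hδ ha')
    (fun t => by simp [autocorr_neg h.2.2.1]) (h.integrable_fourierR_weighted hδ ha ha') y

lemma MemS.hhatSq_eq (hδ : 0 < δ) (h : MemS δ η) (x : ℝ) : hhatSq η x = autocorr η x := by
  have := h.fourierR_fourierR_weighted hδ le_rfl (by linarith) x
  simp only [zero_mul, Real.exp_zero, mul_one] at this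
  rw [← this]
  simp only [hhatSq, fourierR_autocorr hδ h, fourierR.eq_1 (fourierR (autocorr η))]

lemma MemS.alphaSq_eq (hδ : 0 < δ) (h : MemS δ η) : alphaSq η = autocorr η 0 := by
  rw [← h.hhatSq_eq hδ]
  simp [alphaSq, hhatSq]

end Autocorrelation

section PoissonKernel

lemma integral_Ioi_exp_neg_mul_cos {a : ℝ} (ha : 0 < a) (u : ℝ) :
    ∫ y in Set.Ioi (0:ℝ), Real.exp (-a * y) * Real.cos (u * y) = a / (a ^ 2 + u ^ 2) := by
  have hre : (-a + u * Complex.I : ℂ).re < 0 := by simpa using ha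
  have h := congrArg Complex.re (integral_exp_mul_complex_Ioi hre 0)
  have hInt := integrableOn_exp_mul_complex_Ioi hre 0
  rw [← RCLike.re_eq_complex_re, ← integral_re hInt] at h
  rw [RCLike.re_eq_complex_re] at h
  have hpt : ∀ y : ℝ, (Complex.exp ((-a + u * Complex.I) * y)).re
      = Real.exp (-a * y) * Real.cos (u * y) := by
    intro y
    rw [Complex.exp_re]
    simp
  simp only [hpt] at h
  rw [h]
  simp only [Complex.ofReal_zero, mul_zero, Complex.exp_zero]
  rw [Complex.div_re]
  simp [Complex.normSq_apply]
  field_simp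

/-- `G` is an even continuous function of size `O(1 / (1 + t ^ 2))` whose cosine transform is
`2 * π * F y * exp (a * |y|)`. -/
structure IsCosineKernel (F : ℝ → ℝ) (a : ℝ) (G : ℝ → ℝ) : Prop where
  continuous : Continuous G
  even : ∀ t, G (-t) = G t
  bound : ∃ C, ∀ t, |G t| ≤ C * (1 + t ^ 2)⁻¹
  integral_cos : ∀ y, ∫ t, G t * Real.cos (y * t) = 2 * Real.pi * (F y * Real.exp (a * |y|))

variable {δ : ℝ} {η : ℝ → ℝ}

theorem MemS.exists_kernel (hδ : 0 < δ) (h : MemS δ η) {a : ℝ} (ha : 0 < a)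
    (ha' : a < 1/2 + δ/2) :
    ∃ G : ℝ → ℝ, IsCosineKernel (autocorr η) a G ∧
      (∀ γ, ∫ t, G t * (a / (a ^ 2 + (t - γ) ^ 2))
        = Real.pi * fourierR η (γ / (2 * Real.pi)) ^ 2) := by
  have hpi := Real.pi_pos
  set k : ℝ → ℝ := fun y => autocorr η y * Real.exp (a * |y|) with hk
  have hki : Integrable k := h.integrable_weighted hδ ha'
  have hkf : Integrable (fourierR k) := h.integrable_fourierR_weighted hδ ha.le ha'
  obtain ⟨C, hC⟩ := h.exists_weighted_transform_bound hδ ha.le ha'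
  have hcos : ∀ y, ∫ t, fourierR k (t / (2 * Real.pi)) * Real.cos (y * t)
      = 2 * Real.pi * k y := by
    intro y
    have h1 := h.fourierR_fourierR_weighted hδ ha.le ha' y
    have h2 := Measure.integral_comp_div
      (fun ξ => fourierR k ξ * Real.cos (2 * Real.pi * y * ξ)) (2 * Real.pi)
    rw [abs_of_pos (by positivity), smul_eq_mul] at h2
    rw [← hk] at h1
    rw [← show _ = k y from h1, fourierR.eq_1 (fourierR k), ← h2]
    refine integral_congr_ae (.of_forall fun t => ?_)
    simp only
    congr 2
    field_simp
  have hGc : Continuous fun t => fourierR k (t / (2 * Real.pi)) := by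
    have : Continuous (fourierR k) := by
      refine continuous_of_dominated (bound := fun t => |k t|)
        (fun ξ => hki.aestronglyMeasurable.mul (by fun_prop))
        (fun ξ => .of_forall fun t => ?_) hki.abs (.of_forall fun t => by fun_prop)
      rw [norm_mul]
      exact mul_le_of_le_one_right (norm_nonneg _) (Real.abs_cos_le_one _)
    fun_prop
  have hGeven : ∀ t, fourierR k (-t / (2 * Real.pi)) = fourierR k (t / (2 * Real.pi)) := by
    intro t
    rw [neg_div, fourierR_neg]
  have hGi : Integrable fun t => fourierR k (t / (2 * Real.pi)) :=
    hkf.comp_div (by positivity)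
  refine ⟨fun t => fourierR k (t / (2 * Real.pi)), ⟨hGc, hGeven, ⟨C, fun t => ?_⟩, hcos⟩,
    fun γ => ?_⟩
  · simpa [mul_div_cancel₀ t (by positivity : (2 * Real.pi) ≠ 0)] using hC (t / (2 * Real.pi))
  · set G : ℝ → ℝ := fun t => fourierR k (t / (2 * Real.pi)) with hG
    have hexp : IntegrableOn (fun y => Real.exp (-a * y)) (Set.Ioi 0) :=
      integrableOn_exp_mul_Ioi (neg_lt_zero.mpr ha) 0
    have hprod : Integrable (Function.uncurry fun t y =>
        G t * (Real.exp (-a * y) * Real.cos ((t - γ) * y)))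
        (volume.prod (volume.restrict (Set.Ioi 0))) := by
      have := (hGi.mul_prod hexp).mul_bdd (c := 1) (g := fun p : ℝ × ℝ =>
        Real.cos ((p.1 - γ) * p.2)) (by fun_prop) (.of_forall fun p => Real.abs_cos_le_one _)
      simpa only [Function.uncurry_def, mul_assoc] using this
    have step1 : ∫ t, G t * (a / (a ^ 2 + (t - γ) ^ 2))
        = ∫ t, ∫ y in Set.Ioi (0:ℝ), G t * (Real.exp (-a * y) * Real.cos ((t - γ) * y)) := by
      refine integral_congr_ae (.of_forall fun t => ?_)
      simp only [integral_const_mul, integral_Ioi_exp_neg_mul_cos ha]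
    rw [step1, integral_integral_swap hprod]
    have step2 : ∀ y ∈ Set.Ioi (0:ℝ),
        ∫ t, G t * (Real.exp (-a * y) * Real.cos ((t - γ) * y))
          = 2 * Real.pi * (autocorr η y * Real.cos (2 * Real.pi * (γ / (2 * Real.pi)) * y)) := by
      intro y hy
      have hc : Integrable fun t => G t * Real.cos (y * t) :=
        hGi.mul_bdd (c := 1) (by fun_prop) (.of_forall fun t => Real.abs_cos_le_one _)
      have hs : Integrable fun t => G t * Real.sin (y * t) :=
        hGi.mul_bdd (c := 1) (by fun_prop) (.of_forall fun t => Real.abs_sin_le_one _)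
      have hpt : ∀ t, G t * (Real.exp (-a * y) * Real.cos ((t - γ) * y))
          = Real.exp (-a * y) * Real.cos (γ * y) * (G t * Real.cos (y * t))
            + Real.exp (-a * y) * Real.sin (γ * y) * (G t * Real.sin (y * t)) := by
        intro t
        rw [show (t - γ) * y = y * t - γ * y by ring, Real.cos_sub]
        ring
      simp only [hpt]
      rw [integral_add (hc.const_mul _) (hs.const_mul _), integral_const_mul, integral_const_mul,
        integral_mul_sin_eq_zero hGeven, hcos,
        show k y = autocorr η y * Real.exp (a * |y|) from rfl, abs_of_pos (Set.mem_Ioi.mp hy),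
        mul_div_cancel₀ γ (by positivity : (2 * Real.pi) ≠ 0)]
      have : Real.exp (-a * y) * Real.exp (a * y) = 1 := by rw [← Real.exp_add]; simp
      linear_combination 2 * Real.pi * autocorr η y * Real.cos (γ * y) * this
    rw [setIntegral_congr_fun measurableSet_Ioi step2, integral_const_mul,
      ← h.fourierR_autocorr hδ, fourierR_eq_two_mul (autocorr_neg h.2.2.1)]
    ring

end PoissonKernel

section DigammaIntegral

open Filter Topology

lemma integrable_sqrt_mul_inv_one_add_sq :
    Integrable fun t : ℝ => √(1 + |t|) * (1 + t ^ 2)⁻¹ := by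
  have h := (integrable_one_add_norm (E := ℝ) (μ := volume) (r := 3 / 2)
    (by norm_num)).const_mul 2
  refine h.mono' (Continuous.aestronglyMeasurable ?_) (.of_forall fun t => ?_)
  · exact (by fun_prop : Continuous fun t : ℝ => √(1 + |t|)).mul
      ((by fun_prop : Continuous fun t : ℝ => 1 + t ^ 2).inv₀ fun t => by positivity)
  · have hp : 0 < 1 + |t| := by positivity
    rw [Real.norm_of_nonneg (by positivity), Real.norm_eq_abs, Real.sqrt_eq_rpow,
      show -(3 / 2 : ℝ) = 1 / 2 - 2 by norm_num, Real.rpow_sub hp, Real.rpow_two,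
      ← div_eq_mul_inv, div_le_iff₀ (by positivity)]
    have : 1 ≤ 2 * (1 + t ^ 2) / (1 + |t|) ^ 2 := by
      rw [one_le_div (by positivity)]
      nlinarith [sq_nonneg (|t| - 1), sq_abs t]
    have h0 : 0 ≤ (1 + |t|) ^ (1 / 2 : ℝ) := by positivity
    calc (1 + |t|) ^ (1 / 2 : ℝ) ≤ (1 + |t|) ^ (1 / 2 : ℝ) * (2 * (1 + t ^ 2) / (1 + |t|) ^ 2) :=
          le_mul_of_one_le_right h0 this
      _ = _ := by ring

namespace IsCosineKernel

variable {F : ℝ → ℝ} {a : ℝ} {G : ℝ → ℝ}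

lemma integrable_mul_of_le (hG : IsCosineKernel F a G) {f : ℝ → ℝ} (hf : AEStronglyMeasurable f)
    {D : ℝ} (h : ∀ t, |f t| ≤ D * √(1 + |t|)) : Integrable fun t => G t * f t := by
  obtain ⟨C, hC⟩ := hG.bound
  refine (integrable_sqrt_mul_inv_one_add_sq.const_mul (C * D)).mono'
    (hG.continuous.aestronglyMeasurable.mul hf) (.of_forall fun t => ?_)
  rw [norm_mul]
  refine (mul_le_mul (hC t) (h t) (abs_nonneg _) ((abs_nonneg _).trans (hC t))).trans
    (le_of_eq (by ring))

lemma integrable (hG : IsCosineKernel F a G) : Integrable G := by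
  have := hG.integrable_mul_of_le (f := fun _ => 1) (by fun_prop) (D := 1) fun t => by
    rw [one_mul, abs_one, Real.one_le_sqrt]
    linarith [abs_nonneg t]
  simpa using this

lemma integral_eq (hG : IsCosineKernel F a G) : ∫ t, G t = 2 * Real.pi * F 0 := by
  simpa using hG.integral_cos 0

lemma exists_abs_re_digamma_le {θ : ℝ} (hθ : 0 < θ) (hθ1 : θ ≤ 1) :
    (∃ D, ∀ t : ℝ, |(Complex.digamma (1 + θ + t * Complex.I)).re| ≤ D * √(1 + |t|)) ∧
    (∃ D, ∀ t : ℝ, |(Complex.digamma ((1 + θ + t * Complex.I + 1) / 2)).re| ≤ D * √(1 + |t|)) ∧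
    (∃ D, ∀ t : ℝ, |(Complex.digamma ((1 + θ + t * Complex.I) / 2)).re| ≤ D * √(1 + |t|)) := by
  obtain ⟨C₁, hC₁, h1⟩ := exists_norm_digamma_le hθ hθ1
  obtain ⟨C₂, hC₂, h2⟩ := exists_norm_digamma_le (θ := θ / 2) (by linarith) (by linarith)
  have h2' : ∀ t : ℝ, ‖Complex.digamma ((1 + θ + t * Complex.I + 1) / 2)‖ ≤ C₂ * √(1 + |t|) := by
    intro t
    have := h2 (t / 2)
    push_cast at this
    rw [show (1 + (θ : ℂ) + t * Complex.I + 1) / 2 = 1 + θ / 2 + t / 2 * Complex.I by ring]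
    refine this.trans ?_
    refine mul_le_mul_of_nonneg_left (Real.sqrt_le_sqrt ?_) hC₂
    rw [abs_div, abs_two]
    linarith [abs_nonneg t]
  refine ⟨⟨C₁, fun t => (Complex.abs_re_le_norm _).trans (h1 t)⟩,
    ⟨C₂, fun t => (Complex.abs_re_le_norm _).trans (h2' t)⟩,
    ⟨2 * C₁ + 2 * Real.log 2 + C₂, fun t => (Complex.abs_re_le_norm _).trans ?_⟩⟩
  have hd := digamma_half_add_digamma_half (s := 1 + θ + t * Complex.I) (by simp; linarith)
  rw [eq_sub_of_add_eq hd]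
  have hs : 1 ≤ √(1 + |t|) := by
    rw [Real.one_le_sqrt]; linarith [abs_nonneg t]
  have hlog : 0 ≤ Real.log 2 := Real.log_nonneg (by norm_num)
  refine (norm_sub_le _ _).trans ((add_le_add ((norm_sub_le _ _).trans
    (add_le_add (le_of_eq (norm_mul _ _)) (le_of_eq (norm_mul _ _)))) (h2' t)).trans ?_)
  rw [Complex.norm_real, Real.norm_of_nonneg hlog, Complex.norm_ofNat]
  nlinarith [h1 t]

lemma continuous_re_digamma {z : ℝ → ℂ} (hz : Continuous z) (hre : ∀ t, 0 < (z t).re) :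
    Continuous fun t => (Complex.digamma (z t)).re :=
  Complex.continuous_re.comp (continuous_iff_continuousAt.mpr fun t =>
    (continuousAt_digamma (hre t)).comp hz.continuousAt)

lemma integral_mul_re_digamma (hG : IsCosineKernel F a G) {θ : ℝ} (hθ : 0 < θ) (hθ1 : θ ≤ 1) :
    IntegrableOn (fun y => (F 0 - Real.exp (-θ * y) * (F y * Real.exp (a * y))) *
      (Real.exp (-y) / (1 - Real.exp (-y)))) (Set.Ioi 0) ∧
    ∫ t, G t * (Complex.digamma (1 + θ + t * Complex.I)).re
      = 2 * Real.pi * (-Real.eulerMascheroniConstant * F 0 + ∫ y in Set.Ioi (0:ℝ),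
        (F 0 - Real.exp (-θ * y) * (F y * Real.exp (a * y))) *
          (Real.exp (-y) / (1 - Real.exp (-y)))) := by
  set k : ℝ → ℝ := fun y => Real.exp (-y) / (1 - Real.exp (-y)) with hk
  have hGi := hG.integrable
  have hre : ∀ t : ℝ, ((θ : ℂ) + t * Complex.I).re = θ := by simp
  set f : ℝ → ℝ → ℝ := fun t y => (1 - Real.exp (-θ * y) * Real.cos (y * t)) * k y with hf
  have hfre : ∀ t y : ℝ, ((1 - Complex.exp (-((θ + t * Complex.I) * y))) * ((k y : ℝ) : ℂ)).re
      = f t y := by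
    intro t y
    rw [Complex.re_mul_ofReal, Complex.sub_re, Complex.exp_re]
    simp [hf, mul_comm]
  have hdig : ∀ t : ℝ, (Complex.digamma (1 + θ + t * Complex.I)).re
      = -Real.eulerMascheroniConstant + ∫ y in Set.Ioi (0:ℝ), f t y := by
    intro t
    have hpos : 0 < ((θ : ℂ) + t * Complex.I).re := by rw [hre]; exact hθ
    have hle : ((θ : ℂ) + t * Complex.I).re ≤ 1 := by rw [hre]; exact hθ1
    have hi := integrableOn_one_sub_exp_mul_kernel hpos hle
    rw [add_assoc, digamma_one_add_eq_integral hpos hle, Complex.add_re, ← RCLike.re_eq_complex_re,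
      ← integral_re hi]
    simp only [RCLike.re_eq_complex_re, Complex.neg_re, Complex.ofReal_re]
    exact congrArg _ (integral_congr_ae (.of_forall fun y => hfre t y))
  have hprod : Integrable (Function.uncurry fun t y => G t * f t y)
      (volume.prod (volume.restrict (Set.Ioi 0))) := by
    have hD : Integrable fun t : ℝ => |G t| * √(2 * ‖(θ : ℂ) + t * Complex.I‖ / θ) := by
      have := hG.integrable_mul_of_le (f := fun t : ℝ => √(2 * ‖(θ : ℂ) + t * Complex.I‖ / θ))
        (D := √(2 / θ)) (by fun_prop) fun t => by
          rw [abs_of_nonneg (Real.sqrt_nonneg _), ← Real.sqrt_mul (by positivity)]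
          apply Real.sqrt_le_sqrt
          rw [mul_div_right_comm]
          gcongr
          refine (norm_add_le _ _).trans ?_
          rw [norm_mul, Complex.norm_I, mul_one, Complex.norm_real, Complex.norm_real,
            Real.norm_of_nonneg hθ.le, Real.norm_eq_abs]
          linarith
      refine this.abs.congr (.of_forall fun t => ?_)
      simp only [abs_mul, abs_of_nonneg (Real.sqrt_nonneg _)]
    refine (hD.mul_prod integrableOn_exp_neg_div_sqrt).mono' (Measurable.aestronglyMeasurable ?_) ?_
    · have := hG.continuous.measurable
      simp only [Function.uncurry_def, hf, hk]
      fun_prop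
    · rw [← Measure.restrict_univ (μ := (volume : Measure ℝ)), Measure.prod_restrict]
      filter_upwards [ae_restrict_mem (MeasurableSet.univ.prod measurableSet_Ioi)] with p hp
      have hpos : 0 < ((θ : ℂ) + p.1 * Complex.I).re := by rw [hre]; exact hθ
      have hle : ((θ : ℂ) + p.1 * Complex.I).re ≤ 1 := by rw [hre]; exact hθ1
      have hb := norm_one_sub_exp_mul_kernel_le hpos hle hp.2
      rw [hre] at hb
      simp only [Function.uncurry_def, norm_mul]
      rw [mul_assoc, ← hfre, Real.norm_eq_abs]
      refine mul_le_mul_of_nonneg_left ?_ (abs_nonneg _)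
      exact (Complex.abs_re_le_norm _).trans hb
  have hinner : ∀ y ∈ Set.Ioi (0:ℝ), ∫ t, G t * f t y
      = 2 * Real.pi * ((F 0 - Real.exp (-θ * y) * (F y * Real.exp (a * y))) * k y) := by
    intro y hy
    have hc : Integrable fun t => G t * Real.cos (y * t) :=
      hGi.mul_bdd (c := 1) (by fun_prop) (.of_forall fun t => Real.abs_cos_le_one _)
    have hpt : ∀ t, G t * f t y
        = k y * G t - k y * Real.exp (-θ * y) * (G t * Real.cos (y * t)) := by
      intro t; simp only [hf]; ring
    simp only [hpt]
    rw [integral_sub (hGi.const_mul _) (hc.const_mul _), integral_const_mul, integral_const_mul,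
      hG.integral_eq, hG.integral_cos, abs_of_pos (Set.mem_Ioi.mp hy)]
    ring
  have hInt : IntegrableOn (fun y => (F 0 - Real.exp (-θ * y) * (F y * Real.exp (a * y))) * k y)
      (Set.Ioi 0) := by
    have h1 : IntegrableOn (fun y => ∫ t, G t * f t y) (Set.Ioi 0) := hprod.integral_prod_right
    have h2 := (IntegrableOn.congr_fun h1 hinner measurableSet_Ioi).const_mul (2 * Real.pi)⁻¹
    refine h2.congr (.of_forall fun y => ?_)
    simp only
    rw [inv_mul_cancel_left₀ (by positivity)]
  refine ⟨hInt, ?_⟩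
  have hinti : Integrable fun t => G t * ∫ y in Set.Ioi (0:ℝ), f t y := by
    simpa only [Function.uncurry_def, integral_const_mul] using hprod.integral_prod_left
  simp only [hdig, mul_add]
  rw [integral_add (hGi.mul_const _) hinti, integral_mul_const, hG.integral_eq]
  simp only [← integral_const_mul]
  rw [integral_integral_swap hprod, setIntegral_congr_fun measurableSet_Ioi hinner]
  ring

lemma integral_exp_sub_exp_half_div :
    IntegrableOn (fun y => (Real.exp (-y) - Real.exp (-y / 2)) / (1 - Real.exp (-y)))
      (Set.Ioi 0) ∧
    ∫ y in Set.Ioi (0:ℝ), (Real.exp (-y) - Real.exp (-y / 2)) / (1 - Real.exp (-y))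
      = -2 * Real.log 2 := by
  have heq : ∀ y ∈ Set.Ioi (0:ℝ), -Real.exp (-y / 2) / (1 + Real.exp (-y / 2))
      = (Real.exp (-y) - Real.exp (-y / 2)) / (1 - Real.exp (-y)) := by
    intro y hy
    have hsq : Real.exp (-y) = Real.exp (-y / 2) ^ 2 := by rw [← Real.exp_nat_mul]; congr 1; ring
    have hlt : Real.exp (-y / 2) < 1 := by
      rw [Real.exp_lt_one_iff]
      have := Set.mem_Ioi.mp hy
      linarith
    have hpos := Real.exp_pos (-y / 2)
    rw [hsq, div_eq_div_iff (by positivity) (by nlinarith)]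
    ring
  have hInt : IntegrableOn (fun y => -Real.exp (-y / 2) / (1 + Real.exp (-y / 2)))
      (Set.Ioi 0) := by
    refine (integrableOn_exp_mul_Ioi (a := -(1/2)) (by norm_num) 0).mono' ?_
      (.of_forall fun y => ?_)
    · exact Measurable.aestronglyMeasurable (by fun_prop)
    · have hpos := Real.exp_pos (-y / 2)
      rw [norm_div, norm_neg, Real.norm_of_nonneg hpos.le, Real.norm_of_nonneg (by positivity),
        show -(1/2) * y = -y / 2 by ring]
      exact div_le_self hpos.le (by linarith)
  refine ⟨IntegrableOn.congr_fun hInt heq measurableSet_Ioi, ?_⟩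
  rw [← setIntegral_congr_fun measurableSet_Ioi heq]
  have hd : ∀ y : ℝ, HasDerivAt (fun y => 2 * Real.log (1 + Real.exp (-y / 2)))
      (-Real.exp (-y / 2) / (1 + Real.exp (-y / 2))) y := by
    intro y
    have hpos := Real.exp_pos (-y / 2)
    have h1 : HasDerivAt (fun y : ℝ => Real.exp (-y / 2)) (Real.exp (-y / 2) * (-1 / 2)) y :=
      ((hasDerivAt_id y).neg.div_const 2).exp
    refine (((h1.const_add 1).log (by positivity)).const_mul 2).congr_deriv ?_
    field_simp
  have hlim : Tendsto (fun y => 2 * Real.log (1 + Real.exp (-y / 2))) atTop (𝓝 0) := by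
    have h1 : Tendsto (fun y : ℝ => -y / 2) atTop atBot :=
      tendsto_neg_atTop_atBot.atBot_div_const (by norm_num)
    have h2 := ((Real.tendsto_exp_atBot.comp h1).const_add 1).log (by norm_num)
    simpa using h2.const_mul 2
  rw [integral_Ioi_of_hasDerivAt_of_tendsto' (fun y _ => hd y) hInt hlim]
  norm_num

theorem integral_mul_re_digamma_half {ε : ℝ} (hG : IsCosineKernel F (1/2 + ε) G) (hε : 0 < ε)
    (hε1 : ε ≤ 1) :
    Integrable (fun t => G t * (Complex.digamma ((1 + ε + t * Complex.I) / 2)).re) ∧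
    Integrable (fun t => G t * (Complex.digamma ((1 + ε + t * Complex.I + 1) / 2)).re) ∧
    (∫ t, G t * (Complex.digamma ((1 + ε + t * Complex.I) / 2)).re)
      + ∫ t, G t * (Complex.digamma ((1 + ε + t * Complex.I + 1) / 2)).re
      = 4 * Real.pi * (-(Real.eulerMascheroniConstant + 3 * Real.log 2) * F 0
        + ∫ y in Set.Ioi (0:ℝ), Real.exp (-y / 2) / (1 - Real.exp (-y)) * (F 0 - F y)) := by
  obtain ⟨⟨D₁, h1⟩, ⟨D₂, h2⟩, ⟨D₃, h3⟩⟩ := exists_abs_re_digamma_le hε hε1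
  have c1 : Continuous fun t : ℝ => (Complex.digamma (1 + ε + t * Complex.I)).re :=
    continuous_re_digamma (by fun_prop) fun t => by simp; linarith
  have c2 : Continuous fun t : ℝ => (Complex.digamma ((1 + ε + t * Complex.I + 1) / 2)).re :=
    continuous_re_digamma (by fun_prop) fun t => by simp; linarith
  have c3 : Continuous fun t : ℝ => (Complex.digamma ((1 + ε + t * Complex.I) / 2)).re :=
    continuous_re_digamma (by fun_prop) fun t => by simp; linarith
  have i1 := hG.integrable_mul_of_le c1.aestronglyMeasurable h1
  have i2 := hG.integrable_mul_of_le c2.aestronglyMeasurable h2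
  have i3 := hG.integrable_mul_of_le c3.aestronglyMeasurable h3
  refine ⟨i3, i2, ?_⟩
  obtain ⟨k1, k2⟩ := hG.integral_mul_re_digamma hε hε1
  obtain ⟨l1, l2⟩ := integral_exp_sub_exp_half_div
  have hdup : ∀ t : ℝ, G t * (Complex.digamma ((1 + ε + t * Complex.I) / 2)).re
      + G t * (Complex.digamma ((1 + ε + t * Complex.I + 1) / 2)).re
      = 2 * (G t * (Complex.digamma (1 + ε + t * Complex.I)).re) - 2 * Real.log 2 * G t := by
    intro t
    have := congrArg Complex.re
      (digamma_half_add_digamma_half (s := 1 + ε + t * Complex.I) (by simp; linarith))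
    rw [Complex.add_re, Complex.sub_re, show (2 : ℂ) = ((2 : ℝ) : ℂ) by simp,
      Complex.re_ofReal_mul, ← Complex.ofReal_mul, Complex.ofReal_re] at this
    simp only [Complex.ofReal_ofNat] at this
    linear_combination G t * this
  have hsplit : ∫ y in Set.Ioi (0:ℝ), (F 0 - Real.exp (-ε * y) * (F y * Real.exp ((1/2 + ε) * y)))
        * (Real.exp (-y) / (1 - Real.exp (-y)))
      = F 0 * (-2 * Real.log 2) + ∫ y in Set.Ioi (0:ℝ),
          Real.exp (-y / 2) / (1 - Real.exp (-y)) * (F 0 - F y) := by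
    rw [← l2, ← integral_const_mul, ← sub_eq_iff_eq_add', ← integral_sub k1 (l1.const_mul _)]
    refine integral_congr_ae (.of_forall fun y => ?_)
    simp only
    have e1 : Real.exp (-ε * y) * Real.exp ((1/2 + ε) * y) * Real.exp (-y)
        = Real.exp (-y / 2) := by
      rw [← Real.exp_add, ← Real.exp_add]; congr 1; ring
    rw [← e1]
    ring
  rw [← integral_add i3 i2, integral_congr_ae (.of_forall hdup),
    integral_sub (i1.const_mul _) (hG.integrable.const_mul _), integral_const_mul,
    integral_const_mul, k2, hG.integral_eq, hsplit]
  ring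

end IsCosineKernel

end DigammaIntegral

section MellinBound
open Complex Set

lemma exists_norm_mellin_le {f : ℝ → ℂ} {a b : ℝ} (ha : MellinConvergent f a)
    (hb : MellinConvergent f b) :
    ∃ C, ∀ s : ℂ, a ≤ s.re → s.re ≤ b → ‖mellin f s‖ ≤ C := by
  have hnorm : ∀ (s : ℂ) (t : ℝ), t ∈ Ioi (0 : ℝ) →
      ‖(t : ℂ) ^ (s - 1) • f t‖ = t ^ (s.re - 1) * ‖f t‖ := fun s t ht => by
    rw [norm_smul, norm_cpow_eq_rpow_re_of_pos ht]
    simp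
  have hInt : ∀ c : ℝ, MellinConvergent f c →
      IntegrableOn (fun t : ℝ => t ^ (c - 1) * ‖f t‖) (Ioi 0) := fun c hc =>
    (IntegrableOn.congr_fun hc.norm (fun t ht => hnorm c t ht) measurableSet_Ioi)
  refine ⟨∫ t in Ioi (0 : ℝ), (t ^ (a - 1) * ‖f t‖ + t ^ (b - 1) * ‖f t‖), fun s hs hs' => ?_⟩
  rw [mellin]
  refine norm_integral_le_of_norm_le ((hInt a ha).add (hInt b hb)) ?_
  filter_upwards [ae_restrict_mem measurableSet_Ioi] with t ht
  have ht : 0 < t := ht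
  rw [hnorm s t ht, ← add_mul]
  refine mul_le_mul_of_nonneg_right ?_ (norm_nonneg _)
  rcases le_total 1 t with h | h
  · exact (Real.rpow_le_rpow_of_exponent_le h (by linarith)).trans
      (le_add_of_nonneg_left (by positivity))
  · exact (Real.rpow_le_rpow_of_exponent_ge ht h (by linarith)).trans
      (le_add_of_nonneg_right (by positivity))

lemma exists_norm_Λ_le {P : WeakFEPair ℂ} (hP : IsStrongFEPair P) (a b : ℝ) :
    ∃ C, ∀ s : ℂ, a ≤ s.re → s.re ≤ b → ‖P.Λ s‖ ≤ C := by
  rw [hP.Λ_eq]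
  exact exists_norm_mellin_le (hP.hasMellin a).1 (hP.hasMellin b).1

lemma exists_norm_Λ₀_le (P : WeakFEPair ℂ) (a b : ℝ) :
    ∃ C, ∀ s : ℂ, a ≤ s.re → s.re ≤ b → ‖P.Λ₀ s‖ ≤ C :=
  exists_norm_mellin_le (P.isStrongFEPair_toStrongFEPair.hasMellin a).1
    (P.isStrongFEPair_toStrongFEPair.hasMellin b).1

end MellinBound

section CompletedGrowth
open Complex

lemma exists_norm_completedLFunction_le {N : ℕ} [NeZero N] {χ : DirichletCharacter ℂ N}
    (hχ : χ ≠ 1) (a b : ℝ) :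
    ∃ C, ∀ s : ℂ, a ≤ s.re → s.re ≤ b → ‖DirichletCharacter.completedLFunction χ s‖ ≤ C := by
  have hN : N ≠ 1 := hχ ∘ DirichletCharacter.level_one' _
  choose C hC using fun j : ZMod N =>
    exists_norm_Λ₀_le (HurwitzZeta.hurwitzEvenFEPair (ZMod.toAddCircle j)) (a / 2) (b / 2)
  choose C' hC' using fun j : ZMod N => exists_norm_Λ_le
    (HurwitzZeta.isStrong_hurwitzOddFEPair (ZMod.toAddCircle j)) ((a + 1) / 2) ((b + 1) / 2)
  refine ⟨((N : ℝ) ^ (-a) * ∑ j, ‖χ j‖ * (C j / 2)) + (N : ℝ) ^ (-a) * ∑ j, ‖χ j‖ * (C' j / 2),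
    fun s hs hs' => ?_⟩
  have hN1 : (1 : ℝ) ≤ N := by exact_mod_cast NeZero.one_le
  have h1 : ‖(N : ℂ) ^ (-s)‖ ≤ (N : ℝ) ^ (-a) := by
    rw [norm_natCast_cpow_of_pos (NeZero.pos N)]
    exact Real.rpow_le_rpow_of_exponent_le hN1 (by simpa using hs)
  rw [DirichletCharacter.completedLFunction, ZMod.completedLFunction_eq, χ.map_zero' hN,
    χ.sum_eq_zero_of_ne_one hχ, mul_zero, zero_div, zero_div, sub_zero, sub_zero,
    ZMod.completedLFunction₀]
  refine (norm_add_le _ _).trans (add_le_add ?_ ?_) <;> rw [norm_mul] <;>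
    refine mul_le_mul h1 ((norm_sum_le _ _).trans (Finset.sum_le_sum fun j _ => ?_))
      (norm_nonneg _) (by positivity) <;> rw [norm_mul] <;>
    refine mul_le_mul_of_nonneg_left ?_ (norm_nonneg _)
  · rw [HurwitzZeta.completedHurwitzZetaEven₀, norm_div, RCLike.norm_ofNat]
    have := hC j (s / 2) (by simp; linarith) (by simp; linarith)
    linarith
  · rw [HurwitzZeta.completedHurwitzZetaOdd, norm_div, RCLike.norm_ofNat]
    have := hC' j ((s + 1) / 2) (by simp; linarith) (by simp; linarith)
    linarith

lemma norm_Gamma_le {s : ℂ} (hs : 0 < s.re) : ‖Gamma s‖ ≤ Real.Gamma s.re := by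
  rw [Gamma_eq_integral hs, GammaIntegral, Real.Gamma_eq_integral hs]
  refine (norm_integral_le_integral_norm _).trans_eq ?_
  refine setIntegral_congr_fun measurableSet_Ioi fun t ht => ?_
  simp only [norm_mul, norm_real, Real.norm_of_nonneg (Real.exp_pos _).le]
  rw [norm_cpow_eq_rpow_re_of_pos ht]
  simp

lemma Real.Gamma_le_exp {x : ℝ} (hx : 1 ≤ x) : Real.Gamma x ≤ Real.exp (8 * x ^ (3/2 : ℝ)) := by
  have h1 : Real.Gamma x ≤ Real.Gamma (x + 1) := by
    rw [Real.Gamma_add_one (by linarith)]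
    exact le_mul_of_one_le_left (Real.Gamma_pos_of_pos (by linarith)).le hx
  set n := ⌈x⌉₊
  have hn : x ≤ n := Nat.le_ceil x
  have hn' : (n : ℝ) ≤ 2 * x := by
    have := Nat.ceil_lt_add_one (show 0 ≤ x by linarith)
    simp only [n]
    linarith
  have h2 : Real.Gamma (x + 1) ≤ n.factorial := by
    rw [← Real.Gamma_nat_eq_factorial]
    exact Real.Gamma_strictMonoOn_Ici.monotoneOn (by simp; linarith) (by simp; linarith)
      (by linarith)
  have h3 : (n.factorial : ℝ) ≤ (n : ℝ) ^ n := by exact_mod_cast Nat.factorial_le_pow n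
  refine h1.trans (h2.trans (h3.trans ?_))
  have hn0 : (0 : ℝ) < n := by linarith
  rw [← Real.exp_log (pow_pos hn0 n), Real.exp_le_exp, Real.log_pow]
  have h4 : Real.log n ≤ 4 * √x := by
    have h5 : Real.log n ≤ Real.log (2 * x) := Real.log_le_log hn0 hn'
    have h6 : Real.log (2 * x) = 2 * Real.log √(2 * x) := by
      rw [Real.log_sqrt (by linarith)]; ring
    have h7 := Real.log_le_self (Real.sqrt_nonneg (2 * x))
    have h8 : √(2 * x) ≤ 2 * √x := by
      rw [Real.sqrt_le_left (by positivity), mul_pow, Real.sq_sqrt (by linarith)]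
      linarith
    linarith
  have h9 : x ^ (3/2 : ℝ) = x * √x := by
    rw [Real.sqrt_eq_rpow, ← Real.rpow_one_add' (by linarith) (by norm_num)]
    norm_num
  rw [h9]
  calc (n : ℝ) * Real.log n ≤ (2 * x) * (4 * √x) :=
        mul_le_mul hn' h4 (Real.log_natCast_nonneg n) (by linarith)
    _ = _ := by ring

lemma norm_Gammaℝ_le {s : ℂ} (hs : 2 ≤ s.re) : ‖Gammaℝ s‖ ≤ Real.exp (8 * s.re ^ (3/2 : ℝ)) := by
  have h0 : 0 < (s / 2).re := by simp; linarith
  rw [Gammaℝ_def, norm_mul, norm_cpow_eq_rpow_re_of_pos Real.pi_pos]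
  have h1 : Real.pi ^ (-s / 2).re ≤ 1 :=
    Real.rpow_le_one_of_one_le_of_nonpos (by linarith [Real.pi_gt_three]) (by simp; linarith)
  refine (mul_le_of_le_one_left (norm_nonneg _) h1).trans ((norm_Gamma_le h0).trans ?_)
  refine (Real.Gamma_le_exp (by simp; linarith)).trans (Real.exp_le_exp.2 ?_)
  have h2 : (s / 2).re ≤ s.re := by simp; linarith
  gcongr

lemma norm_gammaFactor_le {N : ℕ} (χ : DirichletCharacter ℂ N) {s : ℂ} (hs : 2 ≤ s.re) :
    ‖χ.gammaFactor s‖ ≤ Real.exp (8 * (s.re + 1) ^ (3/2 : ℝ)) := by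
  rcases χ.even_or_odd with h | h <;> rw [h.gammaFactor_def]
  · refine (norm_Gammaℝ_le hs).trans ?_
    gcongr
    linarith
  · simpa using norm_Gammaℝ_le (s := s + 1) (by simp; linarith)

lemma gammaFactor_ne_zero {N : ℕ} (χ : DirichletCharacter ℂ N) {s : ℂ} (hs : 0 < s.re) :
    χ.gammaFactor s ≠ 0 := by
  rcases χ.even_or_odd with h | h <;> rw [h.gammaFactor_def]
  · exact Gammaℝ_ne_zero_of_re_pos hs
  · exact Gammaℝ_ne_zero_of_re_pos (by simp; linarith)

lemma exists_norm_LFunction_le {N : ℕ} [NeZero N] (χ : DirichletCharacter ℂ N) :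
    ∃ C, ∀ s : ℂ, 2 ≤ s.re → ‖χ.LFunction s‖ ≤ C := by
  refine ⟨∑' n : ℕ, 1 / (n : ℝ) ^ 2, fun s hs => ?_⟩
  rw [χ.LFunction_eq_LSeries (by linarith), LSeries]
  have hsum : Summable fun n : ℕ => 1 / (n : ℝ) ^ 2 := Real.summable_one_div_nat_pow.2 one_lt_two
  refine tsum_of_norm_bounded hsum.hasSum fun n => ?_
  rcases eq_or_ne n 0 with rfl | hn
  · simp
  have hn1 : (1 : ℝ) ≤ n := by exact_mod_cast Nat.one_le_iff_ne_zero.2 hn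
  rw [LSeries.term_of_ne_zero hn, norm_div, norm_natCast_cpow_of_pos (Nat.pos_of_ne_zero hn)]
  refine div_le_div₀ zero_le_one (χ.norm_le_one _) (by positivity) ?_
  rw [← Real.rpow_natCast]
  exact Real.rpow_le_rpow_of_exponent_le hn1 (by simpa using hs)

lemma completedLFunction_eq_gammaFactor_mul {N : ℕ} [NeZero N] (χ : DirichletCharacter ℂ N)
    {s : ℂ} (hs : 0 < s.re) :
    χ.completedLFunction s = χ.gammaFactor s * χ.LFunction s := by
  rw [χ.LFunction_eq_completed_div_gammaFactor s (Or.inl (by rintro rfl; simp at hs)),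
    mul_div_cancel₀ _ (gammaFactor_ne_zero χ hs)]

end CompletedGrowth

section Xi
open Complex ComplexConjugate

variable {N : ℕ} [NeZero N] {χ : DirichletCharacter ℂ N}

/-- The completed `L`-function of `χ`, normalised by a power of the modulus and centred at `1/2`. -/
noncomputable def xiFunction (χ : DirichletCharacter ℂ N) (z : ℂ) : ℂ :=
  (N : ℂ) ^ ((1/2 + z) / 2) * χ.completedLFunction (1/2 + z)

lemma differentiable_xiFunction (hχ : χ ≠ 1) : Differentiable ℂ (xiFunction χ) := by
  have h := DirichletCharacter.differentiable_completedLFunction hχ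
  have hN : (N : ℂ) ≠ 0 := NeZero.ne _
  have h1 : Differentiable ℂ fun z : ℂ => (N : ℂ) ^ ((1/2 + z) / 2) := fun z =>
    DifferentiableAt.const_cpow (by fun_prop) (Or.inl hN)
  exact h1.mul (h.comp (by fun_prop))

lemma xiFunction_neg (hχ : χ.IsPrimitive) (z : ℂ) :
    xiFunction χ (-z) = χ.rootNumber * xiFunction χ⁻¹ z := by
  have hN : (N : ℂ) ≠ 0 := NeZero.ne _
  rw [xiFunction, xiFunction, show (1/2 + -z : ℂ) = 1 - (1/2 + z) by ring,
    hχ.completedLFunction_one_sub, show (1 / 2 + z - 1 / 2 : ℂ) = z by ring]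
  have : (N : ℂ) ^ ((1/2 + z) / 2) = (N : ℂ) ^ ((1 - (1/2 + z)) / 2) * (N : ℂ) ^ z := by
    rw [← cpow_add _ _ hN]
    congr 1
    ring
  rw [this]
  ring

lemma xiFunction_ne_zero_of_half_le_re (hχ : χ ≠ 1) {z : ℂ} (hz : 1/2 ≤ z.re) :
    xiFunction χ z ≠ 0 := by
  have hN : (N : ℂ) ≠ 0 := NeZero.ne _
  have h1 : 1 ≤ (1/2 + z).re := by simp; linarith
  rw [xiFunction, completedLFunction_eq_gammaFactor_mul χ (by linarith)]
  refine mul_ne_zero (by simp [cpow_eq_zero_iff, hN]) (mul_ne_zero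
    (gammaFactor_ne_zero χ (by linarith)) ?_)
  exact DirichletCharacter.LFunction_ne_zero_of_one_le_re χ (Or.inl hχ) h1

lemma rootNumber_ne_zero (hχ : χ.IsPrimitive) (hχ1 : χ ≠ 1) : χ.rootNumber ≠ 0 := by
  intro h
  have := xiFunction_neg hχ (-1)
  rw [h, zero_mul, neg_neg] at this
  exact xiFunction_ne_zero_of_half_le_re hχ1 (by norm_num) this

lemma xiFunction_eq_zero_iff {z : ℂ} (hz : -1/2 < z.re) :
    xiFunction χ z = 0 ↔ χ.LFunction (1/2 + z) = 0 := by
  have hN : (N : ℂ) ≠ 0 := NeZero.ne _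
  have h1 : 0 < (1/2 + z).re := by simp; linarith
  rw [xiFunction, completedLFunction_eq_gammaFactor_mul χ h1]
  rw [mul_eq_zero, mul_eq_zero, or_iff_right (gammaFactor_ne_zero χ h1),
    or_iff_right (by simp [cpow_eq_zero_iff, hN])]

lemma re_eq_zero_of_xiFunction_eq_zero (hGRH : GRH) (hχ : χ.IsPrimitive) (hχ1 : χ ≠ 1) {z : ℂ}
    (hz : xiFunction χ z = 0) : z.re = 0 := by
  have h1 : z.re < 1/2 := not_le.1 fun h => xiFunction_ne_zero_of_half_le_re hχ1 h hz
  have h2 : -1/2 < z.re := by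
    by_contra h
    have h3 := xiFunction_neg hχ (-z)
    rw [neg_neg, hz, eq_comm, mul_eq_zero] at h3
    refine h3.elim (rootNumber_ne_zero hχ hχ1)
      (xiFunction_ne_zero_of_half_le_re (inv_ne_one.2 hχ1) ?_)
    rw [neg_re]
    linarith
  have h3 := hGRH N χ (1/2 + z) ((xiFunction_eq_zero_iff h2).1 hz) (by simp; linarith)
    (by simp; linarith)
  simpa using h3

omit [NeZero N] in
lemma gammaFactor_inv_conj (χ : DirichletCharacter ℂ N) (s : ℂ) :
    χ⁻¹.gammaFactor (conj s) = conj (χ.gammaFactor s) := by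
  have h : ∀ s, Gammaℝ (conj s) = conj (Gammaℝ s) := fun s => by
    rw [Gammaℝ_def, Gammaℝ_def, map_mul, ← Gamma_conj, map_div₀, conj_ofNat]
    congr 1
    have := cpow_conj (x := (Real.pi : ℂ)) (n := -s / 2)
      (by rw [arg_ofReal_of_nonneg Real.pi_pos.le]; exact Real.pi_pos.ne)
    rw [conj_ofReal, map_div₀, conj_ofNat, map_neg] at this
    exact this
  have hinv : χ⁻¹ (-1) = (χ (-1))⁻¹ := by
    rw [MulChar.inv_apply_eq_inv']
  rcases χ.even_or_odd with hχ | hχ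
  · have : χ⁻¹.Even := by rw [DirichletCharacter.Even, hinv, hχ, inv_one]
    rw [this.gammaFactor_def, hχ.gammaFactor_def, h]
  · have : χ⁻¹.Odd := by rw [DirichletCharacter.Odd, hinv, hχ]; norm_num
    rw [this.gammaFactor_def, hχ.gammaFactor_def, ← h, map_add, map_one]

lemma xiFunction_inv_conj (hχ : χ ≠ 1) (z : ℂ) :
    xiFunction χ⁻¹ (conj z) = conj (xiFunction χ z) := by
  have hN : (N : ℂ) ≠ 0 := NeZero.ne _
  have h1 : (fun z => xiFunction χ⁻¹ z) = fun z => conj (xiFunction χ (conj z)) := by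
    refine entire_eq_of_eqOn_re_gt_one (differentiable_xiFunction (inv_ne_one.2 hχ))
      (fun z => ?_) fun s hs => ?_
    · have := (differentiable_xiFunction hχ (conj z)).conj_conj
      rwa [conj_conj] at this
    have h2 : ∀ s : ℂ, 1 < s.re → 0 < (1/2 + s).re := fun s hs => by simp; linarith
    have h3 : (1/2 + s : ℂ) = conj (1/2 + conj s) := by
      rw [map_add, conj_conj, map_div₀, map_one, conj_ofNat]
    rw [xiFunction, xiFunction, completedLFunction_eq_gammaFactor_mul _ (h2 s hs),
      completedLFunction_eq_gammaFactor_mul _ (h2 _ (by simpa using hs)), map_mul, map_mul,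
      ← LFunction_inv_conj hχ, ← gammaFactor_inv_conj, ← h3]
    congr 1
    have := cpow_conj (x := (N : ℂ)) (n := (1/2 + conj s) / 2)
      (by rw [natCast_arg]; exact Real.pi_pos.ne)
    rw [conj_natCast, map_div₀, ← h3, conj_ofNat] at this
    exact this
  have := congrFun h1 (conj z)
  rwa [conj_conj] at this

lemma logDeriv_xiFunction_neg_conj (hχ : χ.IsPrimitive) (hχ1 : χ ≠ 1) (z : ℂ) :
    logDeriv (xiFunction χ) (-conj z) = -conj (logDeriv (xiFunction χ) z) := by
  have hW := rootNumber_ne_zero hχ hχ1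
  have h1 : ∀ z, xiFunction χ (-conj z) = χ.rootNumber * conj (xiFunction χ z) := fun z => by
    rw [xiFunction_neg hχ, xiFunction_inv_conj hχ1]
  have h2 : ∀ z, deriv (xiFunction χ) (-conj z) =
      -(χ.rootNumber * conj (deriv (xiFunction χ) z)) := fun z => by
    have h3 : HasDerivAt (fun w => χ.rootNumber * conj (xiFunction χ (conj (-w))))
        (χ.rootNumber * (conj (deriv (xiFunction χ) z) * (-1))) (-conj z) := by
      refine HasDerivAt.const_mul _ ?_
      have h4 : HasDerivAt (fun w => conj (xiFunction χ (conj w)))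
          (conj (deriv (xiFunction χ) z)) (conj z) := by
        have := (differentiable_xiFunction hχ1 z).hasDerivAt.conj_conj
        exact this
      have h5 : HasDerivAt (fun w : ℂ => -w) (-1) (-conj z) := (hasDerivAt_id _).neg
      exact HasDerivAt.comp (h₂ := fun w => conj (xiFunction χ (conj w))) (-conj z)
        (by rwa [neg_neg]) h5
    have h6 : (fun w => χ.rootNumber * conj (xiFunction χ (conj (-w)))) = xiFunction χ := by
      funext w
      rw [← h1, conj_conj, neg_neg]
    rw [h6] at h3
    rw [h3.deriv]
    ring
  rw [logDeriv_apply, logDeriv_apply, h1, h2, map_div₀, neg_div, mul_div_mul_left _ _ hW]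

lemma exists_norm_xiFunction_le (hχ : χ.IsPrimitive) (hχ1 : χ ≠ 1) :
    ∃ C, ∀ z, ‖xiFunction χ z‖ ≤ Real.exp (C * (1 + ‖z‖) ^ (3/2 : ℝ)) := by
  have hN1 : (1 : ℝ) ≤ N := by exact_mod_cast NeZero.one_le
  have hN0 := Real.log_nonneg hN1
  have hpow : ∀ z : ℂ, 1 + ‖z‖ ≤ (1 + ‖z‖) ^ (3/2 : ℝ) := fun z => by
    conv_lhs => rw [← Real.rpow_one (1 + ‖z‖)]
    exact Real.rpow_le_rpow_of_exponent_le (by linarith [norm_nonneg z]) (by norm_num)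
  have hNz : ∀ z : ℂ, ‖(N : ℂ) ^ ((1/2 + z) / 2)‖ ≤
      Real.exp (Real.log N * (1 + ‖z‖) ^ (3/2 : ℝ)) := fun z => by
    rw [norm_natCast_cpow_of_pos (NeZero.pos N), Real.rpow_def_of_pos (by linarith)]
    refine Real.exp_le_exp.2 (mul_le_mul_of_nonneg_left (le_trans ?_ (hpow z)) hN0)
    have := re_le_norm z
    have := norm_nonneg z
    simp
    linarith
  have hle : ∀ C : ℝ, ∀ z : ℂ, C ≤ Real.exp (|C| * (1 + ‖z‖) ^ (3/2 : ℝ)) := fun C z => by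
    refine (le_abs_self C).trans ((by linarith [Real.add_one_le_exp |C|] :
      |C| ≤ Real.exp |C|).trans (Real.exp_le_exp.2 ?_))
    exact le_mul_of_one_le_right (abs_nonneg C) (by linarith [hpow z, norm_nonneg z])
  have hright : ∀ χ : DirichletCharacter ℂ N, ∃ C, 0 ≤ C ∧ ∀ z : ℂ, 3/2 ≤ z.re →
      ‖xiFunction χ z‖ ≤ Real.exp (C * (1 + ‖z‖) ^ (3/2 : ℝ)) := fun χ => by
    obtain ⟨C, hC⟩ := exists_norm_LFunction_le χ
    refine ⟨Real.log N + (8 * 2 ^ (3/2 : ℝ) + |C|), by positivity, fun z hz => ?_⟩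
    have h2 : 2 ≤ (1/2 + z).re := by simp; linarith
    rw [xiFunction, completedLFunction_eq_gammaFactor_mul _ (by linarith), norm_mul, norm_mul,
      add_mul, add_mul, Real.exp_add, Real.exp_add]
    refine mul_le_mul (hNz z) (mul_le_mul ((norm_gammaFactor_le χ h2).trans ?_)
      ((hC _ h2).trans (hle C z)) (norm_nonneg _) (Real.exp_pos _).le) (by positivity)
      (Real.exp_pos _).le
    rw [mul_assoc, ← Real.mul_rpow (by norm_num) (by positivity)]
    have h3 : 0 ≤ (1/2 + z).re + 1 := by linarith
    have h4 : (1/2 + z).re + 1 ≤ 2 * (1 + ‖z‖) := by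
      have := re_le_norm z
      have := norm_nonneg z
      simp
      linarith
    gcongr
  obtain ⟨C₁, h₁, hC₁⟩ := hright χ
  obtain ⟨C₂, h₂, hC₂⟩ := hright χ⁻¹
  obtain ⟨C₃, hC₃⟩ := exists_norm_completedLFunction_le hχ1 (-1) 2
  have hmono : ∀ {A B : ℝ}, A ≤ B → ∀ z : ℂ, Real.exp (A * (1 + ‖z‖) ^ (3/2 : ℝ)) ≤
      Real.exp (B * (1 + ‖z‖) ^ (3/2 : ℝ)) := fun h z => by gcongr
  refine ⟨C₁ + (|‖χ.rootNumber‖| + C₂) + (Real.log N + |C₃|), fun z => ?_⟩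
  rcases le_total (3/2) z.re with h | h
  · exact (hC₁ z h).trans (hmono (by linarith [abs_nonneg C₃, abs_nonneg ‖χ.rootNumber‖]) z)
  rcases le_total z.re (-3/2) with h' | h'
  · have h3 := xiFunction_neg hχ (-z)
    rw [neg_neg] at h3
    have h4 := hC₂ (-z) (by rw [neg_re]; linarith)
    rw [h3, norm_mul]
    refine (mul_le_mul (hle _ z) h4 (norm_nonneg _) (Real.exp_pos _).le).trans ?_
    rw [norm_neg, ← Real.exp_add, ← add_mul]
    exact hmono (by linarith [abs_nonneg C₃]) z
  · rw [xiFunction, norm_mul]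
    refine (mul_le_mul (hNz z) ((hC₃ _ (by simp; linarith) (by simp; linarith)).trans (hle C₃ z))
      (norm_nonneg _) (Real.exp_pos _).le).trans ?_
    rw [← Real.exp_add, ← add_mul]
    exact hmono (by linarith [abs_nonneg ‖χ.rootNumber‖]) z

end Xi

section XiLogDeriv
open Complex

lemma logDeriv_const_cpow {c : ℂ} (hc : c ≠ 0) {g : ℂ → ℂ} {g' x : ℂ} (hg : HasDerivAt g g' x) :
    logDeriv (fun z => c ^ g z) x = log c * g' := by
  have h0 : c ^ g x ≠ 0 := by simp [cpow_eq_zero_iff, hc]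
  rw [logDeriv_apply, (hg.const_cpow (Or.inl hc)).deriv]
  field_simp

lemma differentiableAt_Gammaℝ {w : ℂ} (hw : 0 < w.re) : DifferentiableAt ℂ Gammaℝ w := by
  have h1 : 0 < (w / 2).re := by simpa using hw
  have h2 : DifferentiableAt ℂ (fun s : ℂ => Gamma (s / 2)) w :=
    DifferentiableAt.comp w (differentiableAt_Gamma_of_re_pos h1) (by fun_prop)
  exact (DifferentiableAt.const_cpow (by fun_prop)
    (Or.inl (by exact_mod_cast Real.pi_ne_zero))).mul h2

lemma logDeriv_Gammaℝ {w : ℂ} (hw : 0 < w.re) :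
    logDeriv Gammaℝ w = -((Real.log Real.pi : ℝ) : ℂ) / 2 + digamma (w / 2) / 2 := by
  have h1 : 0 < (w / 2).re := by simpa using hw
  have hpi : (Real.pi : ℂ) ≠ 0 := by exact_mod_cast Real.pi_ne_zero
  have hd : HasDerivAt (fun s : ℂ => s / 2) (1 / 2) w := (hasDerivAt_id w).div_const 2
  have hd' : HasDerivAt (fun s : ℂ => -s / 2) (-1 / 2) w := (hasDerivAt_id w).neg.div_const 2
  have h2 : DifferentiableAt ℂ (fun s : ℂ => Gamma (s / 2)) w :=
    DifferentiableAt.comp w (differentiableAt_Gamma_of_re_pos h1) hd.differentiableAt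
  rw [show Gammaℝ = fun s : ℂ => (Real.pi : ℂ) ^ (-s / 2) * Gamma (s / 2) from
    funext Gammaℝ_def, logDeriv_mul (f := fun s : ℂ => (Real.pi : ℂ) ^ (-s / 2))
    (g := fun s : ℂ => Gamma (s / 2)) w (by simp [cpow_eq_zero_iff, hpi])
    (Gamma_ne_zero_of_re_pos h1)
    (DifferentiableAt.const_cpow hd'.differentiableAt (Or.inl hpi)) h2,
    logDeriv_const_cpow hpi hd']
  have h3 := logDeriv_comp (f := Gamma) (g := fun s : ℂ => s / 2) (x := w)
    (differentiableAt_Gamma_of_re_pos h1) hd.differentiableAt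
  rw [hd.deriv] at h3
  rw [show (fun s : ℂ => Gamma (s / 2)) = Gamma ∘ fun s : ℂ => s / 2 from rfl, h3, digamma_def,
    ofReal_log Real.pi_pos.le]
  ring

variable {N : ℕ} [NeZero N] {χ : DirichletCharacter ℂ N}

open scoped Classical in
/-- The shift `0` or `1` in the archimedean factor of an even or odd Dirichlet character. -/
noncomputable def archShift {N : ℕ} (χ : DirichletCharacter ℂ N) : ℝ := if χ.Even then 0 else 1

omit [NeZero N] in
lemma archShift_nonneg (χ : DirichletCharacter ℂ N) : 0 ≤ archShift χ := by
  rw [archShift]; split_ifs <;> norm_num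

omit [NeZero N] in
lemma gammaFactor_eq_archShift (χ : DirichletCharacter ℂ N) (s : ℂ) :
    χ.gammaFactor s = Gammaℝ (s + archShift χ) := by
  rcases χ.even_or_odd with h | h <;> rw [h.gammaFactor_def, archShift]
  · simp [h]
  · simp [h.not_even]

lemma re_logDeriv_xiFunction (hχ : χ ≠ 1) {z : ℂ} (hz : 1/2 < z.re) :
    (logDeriv (xiFunction χ) z).re = (Real.log N - Real.log Real.pi) / 2 +
      (digamma ((1/2 + z + archShift χ) / 2)).re / 2 -
      (LSeries (fun n : ℕ => χ n * (ArithmeticFunction.vonMangoldt n : ℂ)) (1/2 + z)).re := by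
  have hN : (N : ℂ) ≠ 0 := NeZero.ne _
  have hs : 1 < (1/2 + z).re := by simp; linarith
  have hs' : 0 < (1/2 + z + archShift χ).re := by
    rw [add_re, ofReal_re]
    linarith [archShift_nonneg χ]
  have hev : xiFunction χ =ᶠ[nhds z] fun z => (N : ℂ) ^ ((1/2 + z) / 2) *
      (Gammaℝ (1/2 + z + archShift χ) * χ.LFunction (1/2 + z)) := by
    filter_upwards [(isOpen_lt continuous_const continuous_re).mem_nhds
      (show z ∈ {s : ℂ | 1/2 < s.re} from hz)] with w hw
    have hw : 1/2 < w.re := hw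
    rw [xiFunction, completedLFunction_eq_gammaFactor_mul _ (by simp; linarith),
      gammaFactor_eq_archShift]
  have hd : HasDerivAt (fun w : ℂ => (1/2 + w) / 2) (1/2) z :=
    ((hasDerivAt_id z).const_add _).div_const 2
  have hdL : HasDerivAt (fun w : ℂ => 1/2 + w) 1 z := (hasDerivAt_id z).const_add _
  have hdG : HasDerivAt (fun w : ℂ => 1/2 + w + archShift χ) 1 z := hdL.add_const _
  have hL := DirichletCharacter.differentiable_LFunction hχ
  have hL' : DifferentiableAt ℂ (fun w => χ.LFunction (1/2 + w)) z :=
    (hL _).comp z hdL.differentiableAt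
  have hG' : DifferentiableAt ℂ (fun w => Gammaℝ (1/2 + w + archShift χ)) z :=
    DifferentiableAt.comp z (differentiableAt_Gammaℝ hs') hdG.differentiableAt
  have hL0 : χ.LFunction (1/2 + z) ≠ 0 :=
    DirichletCharacter.LFunction_ne_zero_of_one_le_re χ (Or.inl hχ) hs.le
  have h1 := logDeriv_comp (f := Gammaℝ) (g := fun w : ℂ => 1/2 + w + archShift χ) (x := z)
    (differentiableAt_Gammaℝ hs') hdG.differentiableAt
  have h2 := logDeriv_comp (f := χ.LFunction) (g := fun w : ℂ => 1/2 + w) (x := z)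
    (hL _) hdL.differentiableAt
  rw [hdG.deriv, mul_one, logDeriv_Gammaℝ hs'] at h1
  rw [hdL.deriv, mul_one] at h2
  have h3 : logDeriv χ.LFunction (1/2 + z) =
      -LSeries (fun n : ℕ => χ n * (ArithmeticFunction.vonMangoldt n : ℂ)) (1/2 + z) := by
    have := DirichletCharacter.LSeries_twist_vonMangoldt_eq χ hs
    rw [show LSeries (fun n : ℕ => χ n * (ArithmeticFunction.vonMangoldt n : ℂ)) (1/2 + z) = _
      from this, logDeriv_apply,
      DirichletCharacter.deriv_LFunction_eq_deriv_LSeries χ hs, χ.LFunction_eq_LSeries hs]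
    ring
  rw [(logDeriv_congr_nhds hev).eq_of_nhds, logDeriv_mul (f := fun w : ℂ => (N : ℂ) ^ ((1/2 + w) / 2))
    (g := fun w : ℂ => Gammaℝ (1/2 + w + archShift χ) * χ.LFunction (1/2 + w)) z
    (by simp [cpow_eq_zero_iff, hN])
    (mul_ne_zero (Gammaℝ_ne_zero_of_re_pos hs') hL0)
    (DifferentiableAt.const_cpow hd.differentiableAt (Or.inl hN)) (hG'.mul hL'),
    logDeriv_mul (f := fun w : ℂ => Gammaℝ (1/2 + w + archShift χ))
    (g := fun w : ℂ => χ.LFunction (1/2 + w)) z (Gammaℝ_ne_zero_of_re_pos hs') hL0 hG' hL', logDeriv_const_cpow hN hd]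
  rw [Function.comp_def] at h1 h2
  rw [h1, h2, h3, ← natCast_log]
  have h4 : ((Real.log N : ℝ) : ℂ) * (1 / 2) + (-((Real.log Real.pi : ℝ) : ℂ) / 2 +
      digamma ((1/2 + z + archShift χ) / 2) / 2 + -LSeries (fun n : ℕ => χ n *
        (ArithmeticFunction.vonMangoldt n : ℂ)) (1/2 + z)) =
      (((Real.log N - Real.log Real.pi) / 2 : ℝ) : ℂ) +
      ((1 / 2 : ℝ) : ℂ) * digamma ((1/2 + z + archShift χ) / 2) - LSeries (fun n : ℕ => χ n *
        (ArithmeticFunction.vonMangoldt n : ℂ)) (1/2 + z) := by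
    push_cast
    ring
  rw [h4, sub_re, add_re, ofReal_re, re_ofReal_mul]
  ring

end XiLogDeriv

section PrimitiveZeros
open Complex ComplexConjugate

variable {q : ℕ} [NeZero q] {χ : DirichletCharacter ℂ q}

instance neZero_conductor (χ : DirichletCharacter ℂ q) : NeZero χ.conductor :=
  ⟨χ.conductor_ne_zero⟩

omit [NeZero q] in
lemma primitiveCharacter_ne_one (hχ : χ ≠ 1) : χ.primitiveCharacter ≠ 1 := fun h => by
  refine hχ ?_
  rw [← χ.changeLevel_primitiveCharacter, h, DirichletCharacter.changeLevel_one]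

lemma exists_LFunction_eq_mul (hχ : χ ≠ 1) : ∃ E : ℂ → ℂ, Differentiable ℂ E ∧
    (∀ s, χ.LFunction s = χ.primitiveCharacter.LFunction s * E s) ∧
    ∀ s : ℂ, 0 < s.re → E s ≠ 0 := by
  refine ⟨fun s => ∏ p ∈ q.primeFactors, (1 - χ.primitiveCharacter p * (p : ℂ) ^ (-s)),
    ?_, fun s => ?_, fun s hs => Finset.prod_ne_zero_iff.2 fun p hp h => ?_⟩
  · refine Differentiable.fun_finsetProd fun p hp => ?_
    have hp0 : (p : ℂ) ≠ 0 := by exact_mod_cast (Nat.prime_of_mem_primeFactors hp).ne_zero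
    refine (differentiable_const _).sub (Differentiable.const_mul (fun s => ?_) _)
    exact DifferentiableAt.const_cpow (by fun_prop) (Or.inl hp0)
  · conv_lhs => rw [← χ.changeLevel_primitiveCharacter]
    exact DirichletCharacter.LFunction_changeLevel _ _ (Or.inl (primitiveCharacter_ne_one hχ))
  · have hp1 := (Nat.prime_of_mem_primeFactors hp).one_lt
    have h1 : ‖χ.primitiveCharacter p * (p : ℂ) ^ (-s)‖ < 1 := by
      rw [norm_mul, norm_natCast_cpow_of_pos (by omega)]
      have h2 : (p : ℝ) ^ (-s).re < 1 :=
        Real.rpow_lt_one_of_one_lt_of_neg (by exact_mod_cast hp1) (by simpa using hs)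
      exact (mul_le_of_le_one_left (by positivity) (χ.primitiveCharacter.norm_le_one _)).trans_lt h2
    rw [← sub_eq_zero.1 h, norm_one] at h1
    exact lt_irrefl _ h1

lemma xiFunction_primitiveCharacter_eq_zero_iff (hχ : χ ≠ 1) (γ : ℝ) :
    xiFunction χ.primitiveCharacter (I * γ) = 0 ↔ χ.LFunction (1/2 + I * γ) = 0 := by
  obtain ⟨E, -, hE, hE0⟩ := exists_LFunction_eq_mul hχ
  rw [xiFunction_eq_zero_iff (by norm_num), hE, mul_eq_zero, or_iff_left (hE0 _ (by simp))]

lemma deriv_xiFunction_ne_zero (hLI : LI) (hq : 3 ≤ q) (hχ : χ ≠ 1) {γ : ℝ}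
    (h : xiFunction χ.primitiveCharacter (I * γ) = 0) :
    deriv (xiFunction χ.primitiveCharacter) (I * γ) ≠ 0 := fun h0 => by
  have hL := (xiFunction_primitiveCharacter_eq_zero_iff hχ γ).1 h
  refine CriticalZero.deriv_ne_zero hLI hq ⟨(χ, γ), hχ, hL⟩ ?_
  obtain ⟨E, hEd, hE, -⟩ := exists_LFunction_eq_mul hχ
  set ψ := χ.primitiveCharacter with hψ
  have hψ1 : ψ ≠ 1 := primitiveCharacter_ne_one hχ
  have hN : (χ.conductor : ℂ) ≠ 0 := NeZero.ne _
  set s₀ : ℂ := 1/2 + I * γ with hs₀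
  have hs₀re : 0 < s₀.re := by simp [hs₀]
  have hG0 : Gammaℝ (s₀ + archShift ψ) ≠ 0 := by
    refine Gammaℝ_ne_zero_of_re_pos ?_
    rw [add_re, ofReal_re]
    linarith [archShift_nonneg ψ]
  have hev : χ.LFunction =ᶠ[nhds s₀] fun s => xiFunction ψ (s - 1/2) *
      (((χ.conductor : ℂ) ^ (s / 2))⁻¹ * (Gammaℝ (s + archShift ψ))⁻¹ * E s) := by
    filter_upwards [(isOpen_lt continuous_const continuous_re).mem_nhds
      (show s₀ ∈ {s : ℂ | 0 < s.re} from hs₀re)] with s hs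
    have hs : 0 < s.re := hs
    have h1 : (χ.conductor : ℂ) ^ (s / 2) ≠ 0 := by simp [cpow_eq_zero_iff, hN]
    have h2 : Gammaℝ (s + archShift ψ) ≠ 0 := by
      refine Gammaℝ_ne_zero_of_re_pos ?_
      rw [add_re, ofReal_re]
      linarith [archShift_nonneg ψ]
    rw [hE, xiFunction, show (1/2 + (s - 1/2) : ℂ) = s by ring,
      completedLFunction_eq_gammaFactor_mul _ hs, gammaFactor_eq_archShift]
    field_simp
  have hB : DifferentiableAt ℂ (fun s => ((χ.conductor : ℂ) ^ (s / 2))⁻¹ *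
      (Gammaℝ (s + archShift ψ))⁻¹ * E s) s₀ := by
    refine ((DifferentiableAt.inv (DifferentiableAt.const_cpow (by fun_prop) (Or.inl hN))
      (by simp [cpow_eq_zero_iff, hN])).mul ?_).mul (hEd _)
    exact (differentiable_Gammaℝ_inv.comp (by fun_prop : Differentiable ℂ fun s : ℂ =>
      s + archShift ψ)) s₀
  have hz : s₀ - 1/2 = I * γ := by rw [hs₀]; ring
  have hX : HasDerivAt (fun s => xiFunction ψ (s - 1/2)) 0 s₀ := by
    have := (differentiable_xiFunction hψ1 (s₀ - 1/2)).hasDerivAt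
    rw [hz, h0, ← hz] at this
    exact this.comp_sub_const s₀ (1/2)
  have hd := hX.mul hB.hasDerivAt
  rw [hz, h, zero_mul, zero_mul, add_zero] at hd
  rw [hev.deriv_eq]
  exact hd.deriv

/-- The sum of Poisson kernels over the ordinates of the zeros of `L(s, χ)`. -/
theorem hasSum_poisson (hGRH : GRH) (hLI : LI) (hq : 3 ≤ q) (hχ : χ ≠ 1) {a : ℝ} (ha : 1/2 < a)
    (t : ℝ) :
    HasSum (fun γ : {γ : ℝ // χ.LFunction (1/2 + I * γ) = 0} => a / (a ^ 2 + (t - γ) ^ 2))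
      ((Real.log χ.conductor - Real.log Real.pi) / 2 +
        (digamma ((1/2 + a + t * I + archShift χ.primitiveCharacter) / 2)).re / 2 -
        (LSeries (fun n : ℕ => χ.primitiveCharacter n *
          (ArithmeticFunction.vonMangoldt n : ℂ)) (1/2 + a + t * I)).re) := by
  have hψ1 := primitiveCharacter_ne_one hχ
  have hψ := χ.primitiveCharacter_isPrimitive
  have hre : ∀ ρ, xiFunction χ.primitiveCharacter ρ = 0 → ρ.re = 0 := fun ρ hρ =>
    re_eq_zero_of_xiFunction_eq_zero hGRH hψ hψ1 hρ
  obtain ⟨C, hC⟩ := exists_norm_xiFunction_le hψ hψ1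
  have hz : 1/2 < (a + t * I : ℂ).re := by simpa using ha
  have h0 : xiFunction χ.primitiveCharacter 0 ≠ 0 := fun h => by
    have h1 := (xiFunction_primitiveCharacter_eq_zero_iff hχ 0).1 (by simpa using h)
    exact CriticalZero.im_ne_zero hLI hq ⟨(χ, 0), hχ, h1⟩ rfl
  have hsum := hasSum_re_logDeriv (differentiable_xiFunction hψ1) h0 (fun ρ hρ => by
    have h1 : ρ = I * ((ρ.im : ℝ) : ℂ) := by
      apply Complex.ext <;> simp [hre ρ hρ]
    rw [h1] at hρ ⊢
    exact deriv_xiFunction_ne_zero hLI hq hχ hρ) hre hC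
    (logDeriv_xiFunction_neg_conj hψ hψ1) (z := a + t * I) (by linarith)
  rw [re_logDeriv_xiFunction hψ1 hz, ← add_assoc] at hsum
  rw [← (Equiv.subtypeEquivRight (xiFunction_primitiveCharacter_eq_zero_iff hχ)).hasSum_iff]
  refine hsum.congr_fun ?_
  simp

end PrimitiveZeros

namespace IsCosineKernel

variable {F G : ℝ → ℝ} {a : ℝ}

open ArithmeticFunction in
lemma hasSum_integral_LSeries {ε : ℝ} (hG : IsCosineKernel F (1/2 + ε) G) (hε : 0 < ε)
    {c : ℕ → ℂ} (hc : ∀ n, ‖c n‖ ≤ 1) :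
    Integrable (fun t : ℝ => G t *
      (LSeries (fun n => c n * (vonMangoldt n : ℂ)) (1 + ε + t * Complex.I)).re) ∧
    HasSum (fun n : ℕ => 2 * Real.pi *
        (vonMangoldt n * (c n).re * (n : ℝ) ^ (-1/2 : ℝ) * F (Real.log n)))
      (∫ t : ℝ, G t *
        (LSeries (fun n => c n * (vonMangoldt n : ℂ)) (1 + ε + t * Complex.I)).re) := by
  set u : ℕ → ℝ := fun n => vonMangoldt n * (n : ℝ) ^ (-(1 + ε)) with hu
  have hu0 : ∀ n, 0 ≤ u n := fun n => mul_nonneg vonMangoldt_nonneg (by positivity)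
  have hus : Summable u := by
    have h1 : 1 < ((1 + ε : ℝ) : ℂ).re := by simpa using hε
    have := (LSeriesSummable_vonMangoldt h1).norm
    refine this.congr fun n => ?_
    rcases eq_or_ne n 0 with rfl | hn
    · simp [hu]
    · simp only [hu]
      rw [LSeries.norm_term_eq, if_neg hn, Complex.norm_real,
        Real.norm_of_nonneg vonMangoldt_nonneg, Complex.ofReal_re, Real.rpow_neg (by positivity),
        div_eq_mul_inv]
  set f : ℕ → ℝ → ℝ := fun n t =>
    u n * ((c n).re * Real.cos (t * Real.log n) + (c n).im * Real.sin (t * Real.log n)) with hf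
  have hterm : ∀ n : ℕ, ∀ t : ℝ, (LSeries.term (fun n => c n * (vonMangoldt n : ℂ))
      (1 + ε + t * Complex.I) n).re = f n t := fun n t => by
    rcases eq_or_ne n 0 with rfl | hn
    · simp [hf, hu]
    have hn0 : (n : ℂ) ≠ 0 := by exact_mod_cast hn
    have hnp : (0 : ℝ) < n := by positivity
    have h1 : (n : ℂ) ^ (-(1 + ε + t * Complex.I)) =
        (((n : ℝ) ^ (-(1 + ε)) : ℝ) : ℂ) *
          (Real.cos (t * Real.log n) - Real.sin (t * Real.log n) * Complex.I) := by
      rw [neg_add, Complex.cpow_add _ _ hn0, Complex.ofReal_cpow hnp.le,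
        Complex.cpow_def_of_ne_zero hn0 (-(t * Complex.I)), ← Complex.natCast_log]
      congr 1
      · push_cast; rfl
      · rw [show (Real.log n : ℂ) * -(t * Complex.I) =
          ((-(t * Real.log n) : ℝ) : ℂ) * Complex.I by push_cast; ring, Complex.exp_mul_I,
          ← Complex.ofReal_cos, ← Complex.ofReal_sin, Real.cos_neg, Real.sin_neg]
        push_cast
        ring
    rw [LSeries.term_of_ne_zero hn, div_eq_mul_inv, ← Complex.cpow_neg, h1]
    simp only [hf, hu, Complex.mul_re, Complex.mul_im, Complex.sub_re, Complex.sub_im,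
      Complex.ofReal_re, Complex.ofReal_im, Complex.I_re, Complex.I_im]
    ring
  have hfb : ∀ n t, |f n t| ≤ 2 * u n := fun n t => by
    rw [hf, abs_mul, abs_of_nonneg (hu0 n), mul_comm 2]
    refine mul_le_mul_of_nonneg_left ((abs_add_le _ _).trans ?_) (hu0 n)
    rw [abs_mul, abs_mul]
    have h1 := (Complex.abs_re_le_norm (c n)).trans (hc n)
    have h2 := (Complex.abs_im_le_norm (c n)).trans (hc n)
    have h3 := mul_le_mul h1 (Real.abs_cos_le_one (t * Real.log n)) (abs_nonneg _) zero_le_one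
    have h4 := mul_le_mul h2 (Real.abs_sin_le_one (t * Real.log n)) (abs_nonneg _) zero_le_one
    linarith
  have hfc : ∀ n, Continuous (f n) := fun n => by fun_prop
  have hS : ∀ t : ℝ, HasSum (fun n => f n t)
      (LSeries (fun n => c n * (vonMangoldt n : ℂ)) (1 + ε + t * Complex.I)).re := fun t => by
    have hsum : LSeriesSummable (fun n => c n * (vonMangoldt n : ℂ)) (1 + ε + t * Complex.I) := by
      refine Summable.of_norm_bounded hus fun n => ?_
      rcases eq_or_ne n 0 with rfl | hn
      · simp [hu]
      simp only [hu]
      rw [LSeries.norm_term_eq, if_neg hn, norm_mul, Complex.norm_real,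
        Real.norm_of_nonneg vonMangoldt_nonneg, Real.rpow_neg (by positivity), ← div_eq_mul_inv]
      simp only [Complex.add_re, Complex.one_re, Complex.ofReal_re, Complex.mul_re, Complex.I_re,
        Complex.I_im, Complex.ofReal_im, mul_zero, zero_mul, sub_zero, add_zero]
      exact div_le_div_of_nonneg_right (mul_le_of_le_one_left vonMangoldt_nonneg (hc n))
        (by positivity)
    have := Complex.hasSum_re hsum.hasSum
    exact this.congr_fun fun n => (hterm n t).symm
  have hLc : Continuous fun t : ℝ =>
      (LSeries (fun n => c n * (vonMangoldt n : ℂ)) (1 + ε + t * Complex.I)).re := by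
    have : (fun t : ℝ => (LSeries (fun n => c n * (vonMangoldt n : ℂ))
        (1 + ε + t * Complex.I)).re) = fun t => ∑' n, f n t := funext fun t => (hS t).tsum_eq.symm
    rw [this]
    exact continuous_tsum hfc (hus.mul_left 2) fun n t => hfb n t
  refine ⟨hG.integrable_mul_of_le (D := ∑' n, 2 * u n) hLc.aestronglyMeasurable fun t => ?_, ?_⟩
  · rw [← (hS t).tsum_eq, ← Real.norm_eq_abs]
    refine (tsum_of_norm_bounded (hus.mul_left 2).hasSum fun n => hfb n t).trans ?_
    refine le_mul_of_one_le_right (tsum_nonneg fun n => by linarith [hu0 n]) ?_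
    rw [Real.one_le_sqrt]
    linarith [abs_nonneg t]
  have hmain := hasSum_integral_of_dominated_convergence (μ := volume)
    (F := fun n t => G t * f n t) (fun n t => |G t| * (2 * u n))
    (fun n => (hG.continuous.mul (hfc n)).aestronglyMeasurable)
    (fun n => .of_forall fun t => by
      rw [norm_mul]
      exact mul_le_mul_of_nonneg_left (hfb n t) (abs_nonneg _))
    (.of_forall fun t => (hus.mul_left 2).mul_left _)
    (by simpa only [tsum_mul_left] using hG.integrable.abs.mul_const _)
    (.of_forall fun t => (hS t).mul_left (G t))
  refine hmain.congr_fun fun n => ?_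
  rcases eq_or_ne n 0 with rfl | hn
  · simp [hf, hu]
  have hnp : (0 : ℝ) < n := by positivity
  have hlog : 0 ≤ Real.log n := Real.log_natCast_nonneg n
  have hone : ∀ t : ℝ, 1 ≤ √(1 + |t|) := fun t => by
    rw [Real.one_le_sqrt]
    linarith [abs_nonneg t]
  have hic : Integrable fun t => G t * Real.cos (Real.log n * t) :=
    hG.integrable_mul_of_le (D := 1) (by fun_prop) fun t => by
      rw [one_mul]; exact (Real.abs_cos_le_one _).trans (hone t)
  have his : Integrable fun t => G t * Real.sin (Real.log n * t) :=
    hG.integrable_mul_of_le (D := 1) (by fun_prop) fun t => by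
      rw [one_mul]; exact (Real.abs_sin_le_one _).trans (hone t)
  have h1 : ∀ t, G t * f n t = u n * (c n).re * (G t * Real.cos (Real.log n * t)) +
      u n * (c n).im * (G t * Real.sin (Real.log n * t)) := fun t => by
    simp only [hf, mul_comm t]
    ring
  simp only [h1]
  rw [integral_add (hic.const_mul _) (his.const_mul _), integral_const_mul, integral_const_mul,
    hG.integral_cos, integral_mul_sin_eq_zero hG.even, mul_zero, add_zero, abs_of_nonneg hlog]
  have h2 : (n : ℝ) ^ (-1/2 : ℝ) = (n : ℝ) ^ (-(1 + ε)) * Real.exp ((1/2 + ε) * Real.log n) := by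
    rw [mul_comm (1/2 + ε), ← Real.rpow_def_of_pos hnp, ← Real.rpow_add hnp]
    congr 1
    ring
  rw [h2]
  simp only [hu]
  ring

end IsCosineKernel

/-- The prime power side of the explicit formula for `χ`, with weight `F`. -/
noncomputable def primeSide {q : ℕ} (χ : DirichletCharacter ℂ q) (F : ℝ → ℝ) : ℝ :=
  ∑' n : ℕ, ArithmeticFunction.vonMangoldt n * (χ.primitiveCharacter n).re *
    (n : ℝ) ^ (-1/2 : ℝ) * F (Real.log n)

/-- The archimedean side of the explicit formula, where `κ` is the parity. -/
noncomputable def archSide (ε : ℝ) (G : ℝ → ℝ) (κ : ℝ) : ℝ :=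
  1 / (2 * Real.pi) * ∫ t : ℝ, G t * (Complex.digamma ((1 + ε + t * Complex.I + κ) / 2)).re

theorem hasSum_fourierR_sq {q : ℕ} [NeZero q] {η : ℝ → ℝ} (hGRH : GRH) (hLI : LI)
    (hq : 3 ≤ q) {χ : DirichletCharacter ℂ q} (hχ : χ ≠ 1) {ε : ℝ} {G : ℝ → ℝ}
    (hε : 0 < ε) (hε1 : ε ≤ 1) (hG : IsCosineKernel (autocorr η) (1/2 + ε) G)
    (hGη : ∀ γ, ∫ t, G t * ((1/2 + ε) / ((1/2 + ε) ^ 2 + (t - γ) ^ 2)) =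
      Real.pi * fourierR η (γ / (2 * Real.pi)) ^ 2) :
    Summable (fun n : ℕ => ArithmeticFunction.vonMangoldt n * (χ.primitiveCharacter n).re *
      (n : ℝ) ^ (-1/2 : ℝ) * autocorr η (Real.log n)) ∧
    HasSum (fun γ : {γ : ℝ // χ.LFunction (1/2 + Complex.I * γ) = 0} =>
        fourierR η (γ / (2 * Real.pi)) ^ 2)
      (autocorr η 0 * (Real.log χ.conductor - Real.log Real.pi) +
        archSide ε G (archShift χ.primitiveCharacter) - 2 * primeSide χ (autocorr η)) := by
  have ha : (1/2 : ℝ) < 1/2 + ε := by linarith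
  have hapos : (0 : ℝ) < 1/2 + ε := by linarith
  have hpi := Real.pi_pos
  set κ := archShift χ.primitiveCharacter
  set ψ : ℝ → ℝ := fun t => (Complex.digamma ((1 + ε + t * Complex.I + κ) / 2)).re with hψ
  set L : ℝ → ℝ := fun t => (LSeries (fun n : ℕ => χ.primitiveCharacter n *
    (ArithmeticFunction.vonMangoldt n : ℂ)) (1 + ε + t * Complex.I)).re with hL
  set c₀ : ℝ := (Real.log χ.conductor - Real.log Real.pi) / 2
  have hP : ∀ t : ℝ, HasSum (fun γ : {γ : ℝ // χ.LFunction (1/2 + Complex.I * γ) = 0} =>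
      (1/2 + ε) / ((1/2 + ε) ^ 2 + (t - γ) ^ 2)) (c₀ + ψ t / 2 - L t) := fun t => by
    have h := hasSum_poisson hGRH hLI hq hχ ha t
    have e : (1/2 : ℂ) + ((1/2 + ε : ℝ) : ℂ) = 1 + ε := by push_cast; ring
    rw [e] at h
    exact h
  have hψi : Integrable fun t => G t * ψ t := by
    obtain ⟨h0, h1, -⟩ := hG.integral_mul_re_digamma_half hε hε1
    by_cases he : χ.primitiveCharacter.Even
    · have : κ = 0 := by simp [κ, archShift, he]
      simpa [hψ, this] using h0
    · have : κ = 1 := by simp [κ, archShift, he]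
      simpa [hψ, this] using h1
  obtain ⟨hLi, hLs⟩ := hG.hasSum_integral_LSeries hε
    (c := fun n => χ.primitiveCharacter n) (fun n => DirichletCharacter.norm_le_one _ _)
  have hsplit : ∀ t, G t * (c₀ + ψ t / 2 - L t) = c₀ * G t + 1/2 * (G t * ψ t) - G t * L t :=
    fun t => by ring
  have hRi : Integrable fun t => G t * (c₀ + ψ t / 2 - L t) := by
    simp only [hsplit]
    exact ((hG.integrable.const_mul _).add (hψi.const_mul _)).sub hLi
  have hterm : ∀ (γ t : ℝ), 0 < (1/2 + ε) / ((1/2 + ε) ^ 2 + (t - γ) ^ 2) := fun γ t => by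
    positivity
  have hR0 : ∀ t, 0 ≤ c₀ + ψ t / 2 - L t := fun t => by
    rw [← (hP t).tsum_eq]
    exact tsum_nonneg fun γ => (hterm γ.1 t).le
  have hcount : Countable {γ : ℝ // χ.LFunction (1/2 + Complex.I * γ) = 0} := by
    have := (hP 0).summable.countable_support
    refine Set.countable_univ_iff.mp (this.mono fun γ _ => ?_)
    exact (hterm γ.1 0).ne'
  have hmain := hasSum_integral_of_dominated_convergence (μ := volume)
    (F := fun (γ : {γ : ℝ // χ.LFunction (1/2 + Complex.I * γ) = 0}) t =>
      G t * ((1/2 + ε) / ((1/2 + ε) ^ 2 + (t - γ) ^ 2)))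
    (f := fun t => G t * (c₀ + ψ t / 2 - L t))
    (fun γ t => |G t| * ((1/2 + ε) / ((1/2 + ε) ^ 2 + (t - γ) ^ 2)))
    (fun γ => (hG.continuous.mul (continuous_const.div (by fun_prop) fun t => by
      positivity)).aestronglyMeasurable)
    (fun γ => .of_forall fun t => by
      rw [norm_mul, Real.norm_eq_abs, Real.norm_of_nonneg (hterm γ t).le])
    (.of_forall fun t => (hP t).summable.mul_left _)
    (by
      refine hRi.abs.congr (.of_forall fun t => ?_)
      simp only [tsum_mul_left, (hP t).tsum_eq, abs_mul]
      rw [abs_of_nonneg (hR0 t)])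
    (.of_forall fun t => (hP t).mul_left (G t))
  simp only [hGη, hsplit] at hmain
  have hGψ : Integrable fun t => c₀ * G t + 1/2 * (G t * ψ t) :=
    (hG.integrable.const_mul _).add (hψi.const_mul _)
  have hGL : Integrable fun t => G t * L t := hLi
  rw [integral_sub hGψ hGL, integral_add (hG.integrable.const_mul _) (hψi.const_mul _), integral_const_mul,
    integral_const_mul, hG.integral_eq] at hmain
  have hpp : Summable (fun n : ℕ => ArithmeticFunction.vonMangoldt n *
      (χ.primitiveCharacter n).re * (n : ℝ) ^ (-1/2 : ℝ) * autocorr η (Real.log n)) := by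
    have := hLs.summable.mul_left (2 * Real.pi)⁻¹
    refine this.congr fun n => ?_
    field_simp
  refine ⟨hpp, ?_⟩
  have hLe : ∫ t, G t * L t = 2 * Real.pi * primeSide χ (autocorr η) := by
    rw [primeSide, ← tsum_mul_left]
    exact hLs.tsum_eq.symm
  have h := hmain.mul_left Real.pi⁻¹
  rw [hLe] at h
  have harch : archSide ε G κ = 1 / (2 * Real.pi) * ∫ t, G t * ψ t := rfl
  have hval : autocorr η 0 * (Real.log χ.conductor - Real.log Real.pi) + archSide ε G κ
      - 2 * primeSide χ (autocorr η) = Real.pi⁻¹ * (c₀ * (2 * Real.pi * autocorr η 0) +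
        1/2 * (∫ t, G t * ψ t) - 2 * Real.pi * primeSide χ (autocorr η)) := by
    rw [harch]
    simp only [c₀]
    field_simp
  rw [hval]
  refine h.congr_fun fun γ => ?_
  field_simp

section SumOverCharacters

open DirichletCharacter

lemma conductor_dvd_iff_mem_range_changeLevel {q e : ℕ} [NeZero q] (he : e ∣ q)
    (χ : DirichletCharacter ℂ q) :
    χ.conductor ∣ e ↔ ∃ ψ : DirichletCharacter ℂ e, changeLevel he ψ = χ := by
  rw [← mem_conductorSet_iff_conductor_dvd χ he]
  exact ⟨fun h => ⟨h.2.choose, h.2.choose_spec.symm⟩, fun ⟨ψ, h⟩ => ⟨he, ψ, h.symm⟩⟩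

lemma sum_filter_conductor_dvd {q e : ℕ} [NeZero q] (he : e ∣ q)
    (f : DirichletCharacter ℂ q → ℂ) [NeZero e] :
    ∑ χ : DirichletCharacter ℂ q with χ.conductor ∣ e, f χ =
      ∑ ψ : DirichletCharacter ℂ e, f (changeLevel he ψ) := by
  symm
  refine Finset.sum_bij (fun ψ _ => changeLevel he ψ) (fun ψ _ => ?_)
    (fun ψ _ ψ' _ h => changeLevel_injective he h) (fun χ hχ => ?_) fun _ _ => rfl
  · rw [Finset.mem_filter]
    exact ⟨Finset.mem_univ _, (conductor_dvd_iff_mem_range_changeLevel he _).2 ⟨ψ, rfl⟩⟩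
  · obtain ⟨ψ, h⟩ := (conductor_dvd_iff_mem_range_changeLevel he χ).1 (Finset.mem_filter.1 hχ).2
    exact ⟨ψ, Finset.mem_univ _, h⟩

lemma card_conductor_dvd {q e : ℕ} [NeZero q] (he : e ∣ q) :
    (Finset.univ.filter fun χ : DirichletCharacter ℂ q => χ.conductor ∣ e).card = e.totient := by
  have he0 : NeZero e := ⟨fun h => NeZero.ne q (by simpa [h] using he)⟩
  have h := sum_filter_conductor_dvd he fun _ => 1
  rw [Finset.sum_const, Finset.sum_const, nsmul_one, nsmul_one, Finset.card_univ,
    ← Nat.card_eq_fintype_card, card_eq_totient_of_hasEnoughRootsOfUnity] at h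
  exact_mod_cast h

lemma sum_primitiveCharacter_apply {q r n : ℕ} [NeZero q] (hr : r ∣ q) (hrn : n.Coprime r)
    (h : ∀ d, d ∣ q → n.Coprime d → d ∣ r) :
    ∑ χ : DirichletCharacter ℂ q, χ.primitiveCharacter n =
      if (n : ZMod r) = 1 then (r.totient : ℂ) else 0 := by
  have hr0 : NeZero r := ⟨fun h => NeZero.ne q (by simpa [h] using hr)⟩
  rw [← sum_characters_eq, ← Finset.sum_filter_add_sum_filter_not _ (fun χ => χ.conductor ∣ r),
    sum_filter_conductor_dvd hr (fun χ => χ.primitiveCharacter n)]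
  rw [Finset.sum_eq_zero (s := Finset.univ.filter fun χ : DirichletCharacter ℂ q =>
    ¬ χ.conductor ∣ r), add_zero]
  · refine Finset.sum_congr rfl fun ψ _ => ?_
    have h1 := primitiveCharacter_changeLevel_apply hr ψ n
    have h2 := primitiveCharacter_apply_of_isCoprime ψ (a := n) (Nat.isCoprime_iff_coprime.2 hrn)
    simpa using h1.trans h2
  · intro χ hχ
    by_contra h0
    refine (Finset.mem_filter.1 hχ).2 (h _ χ.conductor_dvd_level ?_)
    exact Nat.isCoprime_iff_coprime.1 ((apply_ne_zero_iff χ.primitiveCharacter (n : ℤ)).1 (by simpa using h0))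

lemma sub_one_mul_sum_totient_div_pow {q p : ℕ} (hq : q ≠ 0) (hp : p.Prime) (hpq : p ∣ q) :
    (p - 1) * ∑ j ∈ Finset.Icc 1 (q.factorization p), (q / p ^ j).totient = q.totient := by
  obtain ⟨v, hv⟩ : ∃ v, q.factorization p = v + 1 :=
    Nat.exists_eq_succ_of_ne_zero (hp.factorization_pos_of_dvd hq hpq).ne'
  have hcop : p.Coprime (ordCompl[p] q) := Nat.coprime_ordCompl hp hq
  have hqe : p ^ (v + 1) * ordCompl[p] q = q := by
    rw [← hv]; exact Nat.ordProj_mul_ordCompl_eq_self q p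
  set r := ordCompl[p] q
  have h1 : ∀ i ∈ Finset.range (v + 1), (q / p ^ (v + 1 - i)).totient =
      (p ^ i).totient * r.totient := fun i hi => by
    have hi' : i ≤ v := Nat.lt_succ_iff.1 (Finset.mem_range.1 hi)
    rw [← Nat.totient_mul (hcop.pow_left i)]
    congr 1
    refine Nat.div_eq_of_eq_mul_right (pow_pos hp.pos _) ?_
    rw [← mul_assoc, ← pow_add, Nat.sub_add_cancel (by omega), hqe]
  have h2 : ∑ j ∈ Finset.Icc 1 (q.factorization p), (q / p ^ j).totient =
      ∑ i ∈ Finset.range (v + 1), (q / p ^ (v + 1 - i)).totient := by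
    refine Finset.sum_nbij' (fun j => v + 1 - j) (fun i => v + 1 - i) ?_ ?_ ?_ ?_ ?_
    all_goals simp only [Finset.mem_Icc, Finset.mem_range, hv]
    all_goals intro j hj
    any_goals omega
    congr 3
    omega
  have h3 : ∑ i ∈ Finset.range (v + 1), (p ^ i).totient = p ^ v := by
    rw [← Nat.sum_divisors_prime_pow hp, Nat.sum_totient]
  rw [h2, Finset.sum_congr rfl h1, ← Finset.sum_mul, h3]
  conv_rhs => rw [← hqe, Nat.totient_mul (hcop.pow_left _), Nat.totient_prime_pow_succ hp]
  ring

lemma sum_log_conductor (q : ℕ) [NeZero q] :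
    ∑ χ : DirichletCharacter ℂ q, Real.log χ.conductor =
      q.totient * (Real.log q - ∑ p ∈ q.primeFactors, Real.log p / ((p : ℝ) - 1)) := by
  have hq := NeZero.ne q
  have hfac : ∀ χ : DirichletCharacter ℂ q, Real.log q - Real.log χ.conductor =
      ∑ p ∈ q.primeFactors, ∑ j ∈ Finset.Icc 1 (q.factorization p),
        if χ.conductor ∣ q / p ^ j then Real.log p else 0 := fun χ => by
    have hd := χ.conductor_dvd_level
    have hd0 : χ.conductor ≠ 0 := χ.conductor_ne_zero
    have h0 : q / χ.conductor ≠ 0 := (Nat.div_pos (Nat.le_of_dvd (NeZero.pos q) hd)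
      (Nat.pos_of_ne_zero hd0)).ne'
    have h1 : Real.log q - Real.log χ.conductor = Real.log (q / χ.conductor : ℕ) := by
      rw [Nat.cast_div hd (by exact_mod_cast hd0), Real.log_div (by exact_mod_cast hq)
        (by exact_mod_cast hd0)]
    rw [h1, Real.log_nat_eq_sum_factorization]
    rw [Finsupp.sum_of_support_subset (s := q.primeFactors) _ ?_ _ (by simp)]
    · refine Finset.sum_congr rfl fun p hp => ?_
      have hpp := Nat.prime_of_mem_primeFactors hp
      rw [← Finset.sum_filter, Finset.sum_const, nsmul_eq_mul]
      congr 2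
      have hset : ((Finset.Icc 1 (q.factorization p)).filter fun j => χ.conductor ∣ q / p ^ j) =
          Finset.Icc 1 ((q / χ.conductor).factorization p) := by
        ext j
        simp only [Finset.mem_filter, Finset.mem_Icc, ← hpp.pow_dvd_iff_le_factorization h0,
          ← hpp.pow_dvd_iff_le_factorization hq, and_assoc]
        refine and_congr_right fun _ => ⟨fun ⟨h2, h3⟩ => ?_, fun h2 => ?_⟩
        · rw [Nat.dvd_div_iff_mul_dvd hd, mul_comm, ← Nat.dvd_div_iff_mul_dvd h2]
          exact h3
        · have h3 : p ^ j ∣ q := h2.trans (Nat.div_dvd_of_dvd hd)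
          rw [Nat.dvd_div_iff_mul_dvd hd, mul_comm, ← Nat.dvd_div_iff_mul_dvd h3] at h2
          exact ⟨h3, h2⟩
      rw [hset, Nat.card_Icc, Nat.add_sub_cancel]
    · exact Nat.primeFactors_mono (Nat.div_dvd_of_dvd hd) hq
  have hmain : ∑ χ : DirichletCharacter ℂ q, (Real.log q - Real.log χ.conductor) =
      q.totient * ∑ p ∈ q.primeFactors, Real.log p / ((p : ℝ) - 1) := by
    simp only [hfac]
    rw [Finset.sum_comm, Finset.mul_sum]
    refine Finset.sum_congr rfl fun p hp => ?_
    have hpp := Nat.prime_of_mem_primeFactors hp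
    have hpq := Nat.dvd_of_mem_primeFactors hp
    rw [Finset.sum_comm]
    have h1 : ∀ j ∈ Finset.Icc 1 (q.factorization p), (∑ χ : DirichletCharacter ℂ q,
        if χ.conductor ∣ q / p ^ j then Real.log p else 0) =
          ((q / p ^ j).totient : ℝ) * Real.log p := fun j hj => by
      rw [← Finset.sum_filter, Finset.sum_const, nsmul_eq_mul, card_conductor_dvd]
      exact Nat.div_dvd_of_dvd ((hpp.pow_dvd_iff_le_factorization hq).2 (Finset.mem_Icc.1 hj).2)
    rw [Finset.sum_congr rfl h1, ← Finset.sum_mul]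
    have h2 := congrArg (Nat.cast (R := ℝ)) (sub_one_mul_sum_totient_div_pow hq hpp hpq)
    rw [Nat.cast_mul, Nat.cast_sub hpp.one_le, Nat.cast_sum, Nat.cast_one] at h2
    have h3 : (0 : ℝ) < (p : ℝ) - 1 := by
      have : (1 : ℝ) < p := by exact_mod_cast hpp.one_lt
      linarith
    rw [← h2]
    field_simp
  rw [Finset.sum_sub_distrib, Finset.sum_const, Finset.card_univ, ← Nat.card_eq_fintype_card,
    card_eq_totient_of_hasEnoughRootsOfUnity, nsmul_eq_mul] at hmain
  linarith

end SumOverCharacters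

section SumOverCharacters

open DirichletCharacter

lemma archShift_primitiveCharacter {q : ℕ} (χ : DirichletCharacter ℂ q) :
    archShift χ.primitiveCharacter = archShift χ := by
  have h := primitiveCharacter_apply_of_isCoprime χ (a := -1) isCoprime_one_left.neg_left
  push_cast at h
  simp only [archShift, DirichletCharacter.Even, h]
  congr

lemma sum_archShift {q : ℕ} [NeZero q] (hq : 3 ≤ q) (f : ℝ → ℝ) :
    ∑ χ : DirichletCharacter ℂ q, f (archShift χ) = q.totient / 2 * (f 0 + f 1) := by
  have hne : (-1 : ZMod q) ≠ 1 := by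
    have : Fact (2 < q) := ⟨hq⟩
    exact ZMod.neg_one_ne_one
  have h1 : ∀ χ : DirichletCharacter ℂ q, f (archShift χ) =
      (f 0 + f 1) / 2 + (f 0 - f 1) / 2 * (χ (-1)).re := fun χ => by
    rcases χ.even_or_odd with h | h
    · rw [archShift, if_pos h, show χ (-1) = 1 from h]
      simp; ring
    · rw [archShift, if_neg h.not_even, show χ (-1) = -1 from h]
      simp; ring
  simp only [h1]
  rw [Finset.sum_add_distrib, ← Finset.mul_sum, ← Complex.re_sum, sum_characters_eq_zero ℂ hne,
    Finset.sum_const, Finset.card_univ, ← Nat.card_eq_fintype_card,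
    card_eq_totient_of_hasEnoughRootsOfUnity, nsmul_eq_mul]
  simp
  ring

end SumOverCharacters

lemma summable_and_tsum_le_of_injective {f : ℕ → ℝ} {b : ℕ → ℝ} {g : ℕ → ℕ}
    (hg : Function.Injective g) (hf : ∀ n, 0 ≤ f n) (h0 : ∀ n, n ∉ Set.range g → f n = 0)
    (hb : Summable b) (hfb : ∀ k, f (g k) ≤ b k) : Summable f ∧ ∑' n, f n ≤ ∑' k, b k := by
  have h1 : Summable (f ∘ g) := .of_nonneg_of_le (fun k => hf _) hfb hb
  refine ⟨(hg.summable_iff h0).1 h1, ?_⟩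
  rw [← hg.tsum_eq (f := f) fun n hn => by_contra fun h => hn (h0 n h)]
  exact h1.tsum_le_tsum hfb hb

section PrimeSum

open ArithmeticFunction

lemma tsum_vonMangoldt_congr_one_le {θ : ℝ} (hθ : 0 < θ) {q : ℕ} (hq : 0 < q) {f : ℕ → ℝ}
    (hf : ∀ n, f n = if q ∣ n - 1 ∧ 2 ≤ n then
      q * (vonMangoldt n * (n : ℝ) ^ (-(1 + 2 * θ))) else 0) :
    Summable f ∧ ∑' n, f n ≤ θ⁻¹ * ∑' k : ℕ, ((k + 1 : ℕ) : ℝ) ^ (-(1 + θ)) := by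
  rw [← tsum_mul_left]
  refine summable_and_tsum_le_of_injective (g := fun k => 1 + (k + 1) * q)
    (fun k l h => ?_) (fun n => ?_) (fun n hn => ?_) ?_ fun k => ?_
  · have h' : (k + 1) * q = (l + 1) * q := Nat.add_left_cancel h
    simpa using Nat.eq_of_mul_eq_mul_right hq h'
  · rw [hf]
    split_ifs
    · have := vonMangoldt_nonneg (n := n)
      positivity
    · exact le_rfl
  · rw [hf, if_neg]
    rintro ⟨⟨c, hc⟩, h2⟩
    refine hn ⟨c - 1, ?_⟩
    have hc0 : c ≠ 0 := by rintro rfl; omega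
    simp only
    rw [Nat.sub_add_cancel (Nat.one_le_iff_ne_zero.2 hc0), mul_comm, ← hc]
    omega
  · refine Summable.mul_left _ ?_
    rw [summable_nat_add_iff 1 (f := fun k : ℕ => (k : ℝ) ^ (-(1 + θ)))]
    exact Real.summable_nat_rpow.2 (by linarith)
  · set n : ℕ := 1 + (k + 1) * q with hn
    have hn1 : (1 : ℝ) ≤ n := by exact_mod_cast (show 1 ≤ n by omega)
    have hn0 : (0 : ℝ) < n := by linarith
    have hqr : (0 : ℝ) < q := by exact_mod_cast hq
    have hkq : ((k + 1 : ℕ) : ℝ) * q ≤ n := by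
      rw [hn]; push_cast; linarith
    have h0 : f n ≤ q * (vonMangoldt n * (n : ℝ) ^ (-(1 + 2 * θ))) := by
      rw [hf]
      split_ifs
      · exact le_rfl
      · have := vonMangoldt_nonneg (n := n)
        positivity
    have h1 : vonMangoldt n ≤ (n : ℝ) ^ θ / θ :=
      vonMangoldt_le_log.trans (Real.log_le_rpow_div hn0.le hθ)
    have h2 : (n : ℝ) ^ (-(1 + θ)) ≤ (((k + 1 : ℕ) : ℝ) * q) ^ (-(1 + θ)) :=
      Real.rpow_le_rpow_of_nonpos (by positivity) hkq (by linarith)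
    have h3 : (q : ℝ) * (q : ℝ) ^ (-(1 + θ)) ≤ 1 := by
      nth_rewrite 1 [← Real.rpow_one (q : ℝ)]
      rw [← Real.rpow_add hqr]
      exact Real.rpow_le_one_of_one_le_of_nonpos (by exact_mod_cast hq) (by linarith)
    calc f n ≤ q * ((n : ℝ) ^ θ / θ * (n : ℝ) ^ (-(1 + 2 * θ))) := h0.trans (by gcongr)
      _ = θ⁻¹ * (q * (n : ℝ) ^ (-(1 + θ))) := by
        rw [show -(1 + θ) = θ + -(1 + 2 * θ) by ring, Real.rpow_add hn0]
        ring
      _ ≤ θ⁻¹ * (q * (((k + 1 : ℕ) : ℝ) * q) ^ (-(1 + θ))) := by gcongr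
      _ = θ⁻¹ * (((k + 1 : ℕ) : ℝ) ^ (-(1 + θ)) * (q * (q : ℝ) ^ (-(1 + θ)))) := by
        rw [Real.mul_rpow (by positivity) hqr.le]
        ring
      _ ≤ θ⁻¹ * (((k + 1 : ℕ) : ℝ) ^ (-(1 + θ)) * 1) := by gcongr
      _ = _ := by rw [mul_one]

open scoped Classical in
lemma tsum_log_prime_pow_le {θ : ℝ} (hθ : 0 < θ) {p : ℕ} (hp : p.Prime) {f : ℕ → ℝ}
    (hf : ∀ n, f n = if ∃ k, n = p ^ (k + 1) then
      Real.log p * (n : ℝ) ^ (-(2 * θ)) else 0) :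
    Summable f ∧ ∑' n, f n ≤ (1 - (2 : ℝ) ^ (-(2 * θ)))⁻¹ * Real.log p := by
  have hx0 : (0 : ℝ) ≤ (2 : ℝ) ^ (-(2 * θ)) := by positivity
  have hx1 : (2 : ℝ) ^ (-(2 * θ)) < 1 :=
    Real.rpow_lt_one_of_one_lt_of_neg (by norm_num) (by linarith)
  have hlog : 0 ≤ Real.log p := Real.log_natCast_nonneg p
  rw [← tsum_geometric_of_lt_one hx0 hx1, ← tsum_mul_right]
  refine summable_and_tsum_le_of_injective (g := fun k => p ^ (k + 1))
    (fun k l h => ?_) (fun n => ?_) (fun n hn => ?_) ?_ fun k => ?_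
  · simpa using Nat.pow_right_injective hp.two_le h
  · rw [hf]
    split_ifs
    · positivity
    · exact le_rfl
  · rw [hf, if_neg]
    rintro ⟨k, rfl⟩
    exact hn ⟨k, rfl⟩
  · exact (summable_geometric_of_lt_one hx0 hx1).mul_right _
  · rw [hf, if_pos ⟨k, rfl⟩, mul_comm]
    refine mul_le_mul_of_nonneg_right ?_ hlog
    have h2 : (2 : ℝ) ≤ p := by exact_mod_cast hp.two_le
    calc ((p ^ (k + 1) : ℕ) : ℝ) ^ (-(2 * θ)) = ((p : ℝ) ^ (-(2 * θ))) ^ (k + 1) := by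
          rw [Nat.cast_pow, ← Real.rpow_natCast_mul (by positivity), mul_comm,
            Real.rpow_mul_natCast (by positivity)]
      _ ≤ ((2 : ℝ) ^ (-(2 * θ))) ^ (k + 1) :=
          pow_le_pow_left₀ (by positivity)
            (Real.rpow_le_rpow_of_nonpos (by norm_num) h2 (by linarith)) _
      _ ≤ ((2 : ℝ) ^ (-(2 * θ))) ^ k := pow_le_pow_of_le_one hx0 hx1.le (Nat.le_succ k)

lemma sum_log_primeFactors_le {q : ℕ} (hq : q ≠ 0) :
    ∑ p ∈ q.primeFactors, Real.log p ≤ Real.log q := by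
  rw [← Real.log_prod fun p hp => by exact_mod_cast (Nat.prime_of_mem_primeFactors hp).ne_zero,
    ← Nat.cast_prod]
  have h0 : 0 < ∏ p ∈ q.primeFactors, p :=
    Finset.prod_pos fun p hp => (Nat.prime_of_mem_primeFactors hp).pos
  have h1 : ∏ p ∈ q.primeFactors, p ≤ q :=
    Nat.le_of_dvd (Nat.pos_of_ne_zero hq) (Nat.prod_primeFactors_dvd q)
  exact Real.log_le_log (by exact_mod_cast h0) (by exact_mod_cast h1)

end PrimeSum

section PrimeSum

open ArithmeticFunction DirichletCharacter

open scoped Classical in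
lemma vonMangoldt_mul_norm_sum_le {q : ℕ} [NeZero q] {θ : ℝ} (n : ℕ) :
    vonMangoldt n * ‖∑ χ : DirichletCharacter ℂ q, χ.primitiveCharacter n‖ *
      (n : ℝ) ^ (-(1 + 2 * θ)) ≤
    (if q ∣ n - 1 ∧ 2 ≤ n then q * (vonMangoldt n * (n : ℝ) ^ (-(1 + 2 * θ))) else 0) +
      ∑ p ∈ q.primeFactors, if ∃ k, n = p ^ (k + 1) then
        Real.log p * (n : ℝ) ^ (-(2 * θ)) else 0 := by
  have hΛ := vonMangoldt_nonneg (n := n)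
  have hA : 0 ≤ (if q ∣ n - 1 ∧ 2 ≤ n then
      q * (vonMangoldt n * (n : ℝ) ^ (-(1 + 2 * θ))) else 0) := by
    split_ifs <;> positivity
  have hB : ∀ p ∈ q.primeFactors, 0 ≤ if ∃ k, n = p ^ (k + 1) then
      Real.log p * (n : ℝ) ^ (-(2 * θ)) else 0 := fun p _ => by
    have := Real.log_natCast_nonneg p
    split_ifs <;> positivity
  by_cases hn : IsPrimePow n
  swap
  · refine le_trans (le_of_eq ?_) (add_nonneg hA (Finset.sum_nonneg hB))
    rw [vonMangoldt_eq_zero_iff.2 hn, zero_mul, zero_mul]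
  have hn2 : 2 ≤ n := hn.two_le
  have hn0 : (0 : ℝ) < n := by positivity
  obtain ⟨p, k, hp, hk, rfl⟩ := (isPrimePow_nat_iff n).1 hn
  have hq := NeZero.ne q
  have hcast : ∀ r : ℕ, ((p ^ k : ℕ) : ZMod r) = 1 → r ∣ p ^ k - 1 := fun r h => by
    rw [← CharP.cast_eq_zero_iff (ZMod r), Nat.cast_sub (by omega), h, Nat.cast_one, sub_self]
  by_cases hpq : p ∣ q
  · rw [sum_primitiveCharacter_apply (r := ordCompl[p] q) (Nat.ordCompl_dvd q p)
      ((Nat.coprime_ordCompl hp hq).pow_left k) fun d hd hc => Nat.dvd_ordCompl_of_dvd_not_dvd hd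
        ((hp.coprime_iff_not_dvd).1 (Nat.Coprime.coprime_dvd_left (dvd_pow_self p hk.ne') hc))]
    refine le_trans ?_ (le_add_of_nonneg_left hA)
    refine le_trans ?_ (Finset.single_le_sum hB (Nat.mem_primeFactors.2 ⟨hp, hpq, hq⟩))
    have hex : ∃ l, p ^ k = p ^ (l + 1) := ⟨k - 1, by rw [Nat.sub_add_cancel hk]⟩
    rw [if_pos hex, vonMangoldt_apply_pow hk.ne',
      vonMangoldt_apply_prime hp, mul_assoc]
    have hlog := Real.log_natCast_nonneg p
    refine mul_le_mul_of_nonneg_left ?_ hlog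
    have h1 : ‖(if ((p ^ k : ℕ) : ZMod (ordCompl[p] q)) = 1 then ((ordCompl[p] q).totient : ℂ)
        else 0)‖ ≤ (p ^ k : ℕ) := by
      split_ifs with h
      · rw [Complex.norm_natCast, Nat.cast_le]
        exact (Nat.totient_le _).trans ((Nat.le_of_dvd (by omega) (hcast _ h)).trans (Nat.sub_le _ _))
      · simp
    calc _ ≤ ((p ^ k : ℕ) : ℝ) * ((p ^ k : ℕ) : ℝ) ^ (-(1 + 2 * θ)) := by gcongr
      _ = _ := by
        nth_rewrite 1 [← Real.rpow_one ((p ^ k : ℕ) : ℝ)]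
        rw [← Real.rpow_add hn0]
        congr 1
        ring
  · have hcop : (p ^ k).Coprime q := ((hp.coprime_iff_not_dvd).2 hpq).pow_left k
    rw [sum_primitiveCharacter_apply dvd_rfl hcop fun d hd _ => hd]
    refine le_trans ?_ (le_add_of_nonneg_right (Finset.sum_nonneg hB))
    split_ifs with h h' h'
    · rw [Complex.norm_natCast]
      have : (q.totient : ℝ) ≤ q := by exact_mod_cast Nat.totient_le q
      calc _ ≤ vonMangoldt (p ^ k) * q * ((p ^ k : ℕ) : ℝ) ^ (-(1 + 2 * θ)) := by gcongr
        _ = _ := by ring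
    · exact absurd ⟨hcast q h, hn2⟩ h'
    · simpa using by positivity
    · simp

lemma exists_abs_sum_primeSide_le {θ K : ℝ} (hθ : 0 < θ) (hK : 0 ≤ K) :
    ∃ C, 0 < C ∧ ∀ (q : ℕ) [NeZero q], 3 ≤ q → ∀ F : ℝ → ℝ,
      (∀ y, |F y| ≤ K * Real.exp (-(1/2 + 2 * θ) * |y|)) →
      (∀ χ : DirichletCharacter ℂ q, χ ≠ 1 → Summable (fun n : ℕ => vonMangoldt n *
        (χ.primitiveCharacter n).re * (n : ℝ) ^ (-1/2 : ℝ) * F (Real.log n))) →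
      |∑ χ ∈ Finset.univ.erase (1 : DirichletCharacter ℂ q), primeSide χ F| ≤
        C * Real.log q := by
  classical
  set V := ∑' n : ℕ, vonMangoldt n * (n : ℝ) ^ (-(1 + 2 * θ)) with hV
  set A := θ⁻¹ * ∑' k : ℕ, ((k + 1 : ℕ) : ℝ) ^ (-(1 + θ)) with hA
  set B := (1 - (2 : ℝ) ^ (-(2 * θ)))⁻¹ with hB
  have hVs : Summable fun n : ℕ => vonMangoldt n * (n : ℝ) ^ (-(1 + 2 * θ)) := by
    have h1 : 1 < ((1 + 2 * θ : ℝ) : ℂ).re := by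
      rw [Complex.ofReal_re]; linarith
    refine (LSeriesSummable_vonMangoldt h1).norm.congr fun n => ?_
    rcases eq_or_ne n 0 with rfl | hn
    · simp
    · rw [LSeries.norm_term_eq, if_neg hn, Complex.norm_real,
        Real.norm_of_nonneg vonMangoldt_nonneg, Complex.ofReal_re, Real.rpow_neg (by positivity),
        div_eq_mul_inv]
  have hV0 : 0 ≤ V := tsum_nonneg fun n => mul_nonneg vonMangoldt_nonneg (by positivity)
  have hA0 : 0 ≤ A := mul_nonneg (by positivity) (tsum_nonneg fun n => by positivity)
  have hB0 : 0 ≤ B := inv_nonneg.2 (sub_nonneg.2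
    (Real.rpow_le_one_of_one_le_of_nonpos (by norm_num) (by linarith)))
  refine ⟨K * (V + A + B) + 1, by positivity, fun q _ hq F hF hs => ?_⟩
  have hlq : 1 ≤ Real.log q := by
    rw [Real.le_log_iff_exp_le (by positivity)]
    exact Real.exp_one_lt_three.le.trans (by exact_mod_cast hq)
  have hqpos : 0 < q := by omega
  set f₁ : ℕ → ℝ := fun n => if q ∣ n - 1 ∧ 2 ≤ n then
    q * (vonMangoldt n * (n : ℝ) ^ (-(1 + 2 * θ))) else 0
  set f₂ : ℕ → ℕ → ℝ := fun p n => if ∃ k, n = p ^ (k + 1) then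
    Real.log p * (n : ℝ) ^ (-(2 * θ)) else 0
  obtain ⟨hs1, ht1⟩ := tsum_vonMangoldt_congr_one_le hθ hqpos (f := f₁) fun n => rfl
  have h2 : ∀ p ∈ q.primeFactors, Summable (f₂ p) ∧ ∑' n, f₂ p n ≤ B * Real.log p := fun p hp =>
    tsum_log_prime_pow_le hθ (Nat.prime_of_mem_primeFactors hp) fun n => rfl
  have hs2 : Summable fun n => ∑ p ∈ q.primeFactors, f₂ p n := summable_sum fun p hp => (h2 p hp).1
  have ht2 : ∑' n, ∑ p ∈ q.primeFactors, f₂ p n ≤ B * Real.log q := by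
    rw [Summable.tsum_finsetSum fun p hp => (h2 p hp).1]
    refine (Finset.sum_le_sum fun p hp => (h2 p hp).2).trans ?_
    rw [← Finset.mul_sum]
    exact mul_le_mul_of_nonneg_left (sum_log_primeFactors_le hqpos.ne') hB0
  have hbound : ∀ n : ℕ, ‖∑ χ ∈ Finset.univ.erase (1 : DirichletCharacter ℂ q),
      vonMangoldt n * (χ.primitiveCharacter n).re * (n : ℝ) ^ (-1/2 : ℝ) * F (Real.log n)‖ ≤
      K * (vonMangoldt n * (n : ℝ) ^ (-(1 + 2 * θ)) + f₁ n + ∑ p ∈ q.primeFactors, f₂ p n) := by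
    intro n
    rcases eq_or_ne n 0 with rfl | hn
    · simp only [ArithmeticFunction.map_zero, zero_mul, Finset.sum_const_zero, norm_zero]
      refine mul_nonneg hK (add_nonneg (add_nonneg le_rfl ?_) (Finset.sum_nonneg fun p _ => ?_))
      · simp [f₁]
      · have := Real.log_natCast_nonneg p
        simp only [f₂]
        split_ifs <;> positivity
    have hn0 : (0 : ℝ) < n := by positivity
    have hFn : |(n : ℝ) ^ (-1/2 : ℝ) * F (Real.log n)| ≤ K * (n : ℝ) ^ (-(1 + 2 * θ)) := by
      rw [abs_mul, abs_of_nonneg (by positivity)]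
      have h3 := hF (Real.log n)
      rw [abs_of_nonneg (Real.log_natCast_nonneg n), mul_comm (-(1/2 + 2 * θ)),
        ← Real.rpow_def_of_pos hn0] at h3
      calc _ ≤ (n : ℝ) ^ (-1/2 : ℝ) * (K * (n : ℝ) ^ (-(1/2 + 2 * θ))) := by gcongr
        _ = K * ((n : ℝ) ^ (-1/2 : ℝ) * (n : ℝ) ^ (-(1/2 + 2 * θ))) := by ring
        _ = _ := by
          rw [← Real.rpow_add hn0]
          congr 2
          ring
    have hT : |∑ χ ∈ Finset.univ.erase (1 : DirichletCharacter ℂ q), (χ.primitiveCharacter n).re| ≤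
        1 + ‖∑ χ : DirichletCharacter ℂ q, χ.primitiveCharacter n‖ := by
      have h3 := Finset.sum_erase_add Finset.univ
        (fun χ : DirichletCharacter ℂ q => (χ.primitiveCharacter n).re) (Finset.mem_univ 1)
      rw [eq_sub_of_add_eq h3, ← Complex.re_sum, add_comm]
      refine (abs_sub _ _).trans (add_le_add (Complex.abs_re_le_norm _) ?_)
      exact (Complex.abs_re_le_norm _).trans (DirichletCharacter.norm_le_one _ _)
    have hmain := vonMangoldt_mul_norm_sum_le (q := q) (θ := θ) n
    simp only [mul_assoc]
    rw [← Finset.mul_sum, ← Finset.sum_mul, norm_mul, norm_mul, Real.norm_of_nonneg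
      vonMangoldt_nonneg, Real.norm_eq_abs, Real.norm_eq_abs]
    have hΛ := vonMangoldt_nonneg (n := n)
    calc _ ≤ vonMangoldt n * ((1 + ‖∑ χ : DirichletCharacter ℂ q, χ.primitiveCharacter n‖) *
          (K * (n : ℝ) ^ (-(1 + 2 * θ)))) := by gcongr
      _ = K * (vonMangoldt n * (n : ℝ) ^ (-(1 + 2 * θ)) + vonMangoldt n *
          ‖∑ χ : DirichletCharacter ℂ q, χ.primitiveCharacter n‖ *
            (n : ℝ) ^ (-(1 + 2 * θ))) := by ring
      _ ≤ _ := by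
        rw [add_assoc]
        gcongr
  have hsum := ((hVs.add hs1).add hs2).mul_left K
  have hval : ∑' n, K * (vonMangoldt n * (n : ℝ) ^ (-(1 + 2 * θ)) + f₁ n +
      ∑ p ∈ q.primeFactors, f₂ p n) ≤ K * (V + A + B * Real.log q) := by
    rw [tsum_mul_left, (hVs.add hs1).tsum_add hs2, hVs.tsum_add hs1]
    gcongr
  simp only [primeSide]
  rw [← Summable.tsum_finsetSum fun χ hχ => hs χ (Finset.ne_of_mem_erase hχ), ← Real.norm_eq_abs]
  refine (tsum_of_norm_bounded hsum.hasSum hbound).trans (hval.trans ?_)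
  have h4 : V ≤ V * Real.log q := le_mul_of_one_le_right hV0 hlq
  have h5 : A ≤ A * Real.log q := le_mul_of_one_le_right hA0 hlq
  calc K * (V + A + B * Real.log q) ≤ K * (V * Real.log q + A * Real.log q + B * Real.log q) := by
        gcongr
    _ = K * (V + A + B) * Real.log q := by ring
    _ ≤ _ := by gcongr; linarith

end PrimeSum

section SecondMoment

open DirichletCharacter

lemma CriticalZero.hasSum_of_forall {q : ℕ} [NeZero q] {f : ℝ → ℝ} (hf : ∀ x, 0 ≤ f x)
    {S : DirichletCharacter ℂ q → ℝ} (h : ∀ χ : DirichletCharacter ℂ q, χ ≠ 1 →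
      HasSum (fun γ : {γ : ℝ // χ.LFunction (1/2 + Complex.I * γ) = 0} => f γ) (S χ)) :
    HasSum (fun k : CriticalZero q => f k.1.2)
      (∑ χ ∈ Finset.univ.erase (1 : DirichletCharacter ℂ q), S χ) := by
  classical
  let e : CriticalZero q ≃ Σ χ : {χ : DirichletCharacter ℂ q // χ ≠ 1},
      {γ : ℝ // χ.1.LFunction (1/2 + Complex.I * γ) = 0} :=
    { toFun := fun k => ⟨⟨k.1.1, k.2.1⟩, ⟨k.1.2, k.2.2⟩⟩
      invFun := fun x => ⟨(x.1.1, x.2.1), x.1.2, x.2.2⟩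
      left_inv := fun _ => rfl
      right_inv := fun _ => rfl }
  rw [Finset.sum_subtype (p := fun χ => χ ≠ 1) _ (fun χ => by simp)]
  refine (e.hasSum_iff (f := fun x => f x.2.1)).2 (HasSum.sigma_of_hasSum (hasSum_fintype _)
    (fun χ => h χ.1 χ.2) ((summable_sigma_of_nonneg fun x => hf _).2
      ⟨fun χ => (h χ.1 χ.2).summable, (hasSum_fintype _).summable⟩))

lemma IsCosineKernel.archSide_add {F G : ℝ → ℝ} {ε : ℝ} (hG : IsCosineKernel F (1/2 + ε) G)
    (hε : 0 < ε) (hε1 : ε ≤ 1) :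
    archSide ε G 0 + archSide ε G 1 =
      2 * (-(Real.eulerMascheroniConstant + 3 * Real.log 2) * F 0 +
        ∫ y in Set.Ioi (0:ℝ), Real.exp (-y / 2) / (1 - Real.exp (-y)) * (F 0 - F y)) := by
  have hpi := Real.pi_ne_zero
  have h := (hG.integral_mul_re_digamma_half hε hε1).2.2
  simp only [archSide, Complex.ofReal_zero, Complex.ofReal_one, add_zero]
  rw [← mul_add, h]
  field_simp
  ring

lemma MemS.betaSq_eq {δ : ℝ} {η : ℝ → ℝ} (hδ : 0 < δ) (h : MemS δ η) (q : ℕ) :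
    betaSq q η = -autocorr η 0 * (3 * Real.log 2 + Real.log Real.pi +
        Real.eulerMascheroniConstant + ∑ p ∈ q.primeFactors, Real.log p / ((p : ℝ) - 1)) +
      ∫ y in Set.Ioi (0:ℝ), Real.exp (-y / 2) / (1 - Real.exp (-y)) *
        (autocorr η 0 - autocorr η y) := by
  have h8 : Real.log (8 * Real.pi) = 3 * Real.log 2 + Real.log Real.pi := by
    rw [Real.log_mul (by norm_num) Real.pi_ne_zero, show (8 : ℝ) = 2 ^ 3 by norm_num, Real.log_pow]
    norm_num
  rw [betaSq, h.alphaSq_eq hδ, h8, ← integral_const_mul]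
  congr 1
  refine integral_congr_ae (.of_forall fun y => ?_)
  simp only [h.hhatSq_eq hδ, autocorr_neg h.2.2.1]
  ring

lemma sum_log_div_sub_one_mem {q : ℕ} (hq : q ≠ 0) :
    ∑ p ∈ q.primeFactors, Real.log p / ((p : ℝ) - 1) ∈ Set.Icc 0 (Real.log q) := by
  have hp : ∀ p ∈ q.primeFactors, 1 ≤ (p : ℝ) - 1 := fun p hp => by
    have : (2 : ℝ) ≤ p := by exact_mod_cast (Nat.prime_of_mem_primeFactors hp).two_le
    linarith
  refine ⟨Finset.sum_nonneg fun p hp' => div_nonneg (Real.log_natCast_nonneg p)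
    (zero_le_one.trans (hp p hp')), ?_⟩
  refine (Finset.sum_le_sum fun p hp' => ?_).trans (sum_log_primeFactors_le hq)
  exact div_le_self (Real.log_natCast_nonneg p) (hp p hp')

lemma one_le_log_of_three_le {q : ℕ} (hq : 3 ≤ q) : 1 ≤ Real.log q := by
  rw [Real.le_log_iff_exp_le (by positivity)]
  exact Real.exp_one_lt_three.le.trans (by exact_mod_cast hq)

/-- The second moment of the weights over the critical zeros. -/
theorem MemS.exists_hasSum_criticalZero (hGRH : GRH) (hLI : LI) {δ : ℝ} {η : ℝ → ℝ} (hδ : 0 < δ)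
    (h : MemS δ η) :
    ∃ C, 0 < C ∧ ∀ (q : ℕ) [NeZero q], 3 ≤ q → ∃ Z,
      HasSum (fun k : CriticalZero q => fourierR η (k.1.2 / (2 * Real.pi)) ^ 2) Z ∧
      |Z - q.totient * (alphaSq η * Real.log q + betaSq q η)| ≤ C * Real.log q ∧
      |alphaSq η * Real.log q + betaSq q η| ≤ C * Real.log q := by
  classical
  obtain ⟨K, -, -, -, -, hK, -⟩ := h.exists_autocorr_bounds hδ
  have hK0 : 0 ≤ K := by simpa using (abs_nonneg _).trans (hK 0)
  set ε := min 1 (δ / 4)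
  have hε : 0 < ε := lt_min one_pos (by linarith)
  have hε1 : ε ≤ 1 := min_le_left _ _
  have hεδ : ε ≤ δ / 4 := min_le_right _ _
  obtain ⟨G, hG, hGη⟩ := h.exists_kernel hδ (a := 1/2 + ε) (by linarith) (by linarith)
  obtain ⟨P, hP0, hP⟩ := exists_abs_sum_primeSide_le (θ := δ / 4) (by linarith) hK0
  have harch := hG.archSide_add hε hε1
  set F := autocorr η
  set I := ∫ y in Set.Ioi (0:ℝ), Real.exp (-y / 2) / (1 - Real.exp (-y)) * (F 0 - F y)
  set J := archSide ε G
  set γ₀ := Real.eulerMascheroniConstant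
  set C₁ := |F 0 * Real.log Real.pi - J 0| + 2 * P
  set C₂ := |F 0| + |F 0| * |3 * Real.log 2 + Real.log Real.pi + γ₀| + |F 0| + |I|
  refine ⟨C₁ + C₂, by positivity, fun q _ hq => ?_⟩
  have hlq := one_le_log_of_three_le hq
  have hlq0 : 0 ≤ Real.log q := zero_le_one.trans hlq
  have hq0 : q ≠ 0 := by omega
  have hS := sum_log_div_sub_one_mem hq0
  have hcond := sum_log_conductor q
  have hα : alphaSq η = F 0 := h.alphaSq_eq hδ
  have hβ := h.betaSq_eq hδ q
  set S := ∑ p ∈ q.primeFactors, Real.log p / ((p : ℝ) - 1)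
  have hsum := fun (χ : DirichletCharacter ℂ q) (hχ : χ ≠ 1) =>
    hasSum_fourierR_sq hGRH hLI hq hχ hε hε1 hG hGη
  have hPq := hP q hq F (fun y => (hK y).trans (le_of_eq (by ring_nf))) fun χ hχ => (hsum χ hχ).1
  set Q := ∑ χ ∈ Finset.univ.erase (1 : DirichletCharacter ℂ q), primeSide χ F
  refine ⟨_, CriticalZero.hasSum_of_forall
    (f := fun x => fourierR η (x / (2 * Real.pi)) ^ 2) (fun x => sq_nonneg _)
    fun χ hχ => (hsum χ hχ).2, ?_, ?_⟩
  · have h1 : ∑ χ ∈ Finset.univ.erase (1 : DirichletCharacter ℂ q),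
        (F 0 * (Real.log χ.conductor - Real.log Real.pi) + J (archShift χ.primitiveCharacter)) =
        q.totient * (F 0 * Real.log q + betaSq q η) + (F 0 * Real.log Real.pi - J 0) := by
      have h2 := Finset.sum_erase_add Finset.univ (fun χ : DirichletCharacter ℂ q =>
        F 0 * (Real.log χ.conductor - Real.log Real.pi) + J (archShift χ.primitiveCharacter))
        (Finset.mem_univ 1)
      rw [eq_sub_of_add_eq h2]
      simp only [archShift_primitiveCharacter]
      rw [Finset.sum_add_distrib, sum_archShift hq J, harch, ← Finset.mul_sum,
        Finset.sum_sub_distrib, hcond, Finset.sum_const, Finset.card_univ,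
        ← Nat.card_eq_fintype_card, card_eq_totient_of_hasEnoughRootsOfUnity, nsmul_eq_mul,
        conductor_one, hβ, archShift, if_pos (show DirichletCharacter.Even 1 from MulChar.one_apply isUnit_one.neg)]
      simp
      ring
    rw [Finset.sum_sub_distrib, ← Finset.mul_sum, h1, hα]
    have h2 : |(F 0 * Real.log Real.pi - J 0) - 2 * Q| ≤ C₁ * Real.log q := by
      refine (abs_sub _ _).trans ?_
      rw [abs_mul, abs_two, add_mul]
      exact add_le_add (le_mul_of_one_le_right (abs_nonneg _) hlq) (by linarith)
    refine le_trans (le_of_eq ?_) (h2.trans (by gcongr; exact le_add_of_nonneg_right (by positivity)))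
    congr 1
    ring
  · rw [hα, hβ]
    have hS' : |F 0 * S| ≤ |F 0| * Real.log q := by
      rw [abs_mul, abs_of_nonneg hS.1]
      exact mul_le_mul_of_nonneg_left hS.2 (abs_nonneg _)
    have h3 : |F 0 * (3 * Real.log 2 + Real.log Real.pi + γ₀)| ≤
        |F 0| * |3 * Real.log 2 + Real.log Real.pi + γ₀| * Real.log q := by
      rw [abs_mul]
      exact le_mul_of_one_le_right (by positivity) hlq
    have h4 : |F 0 * Real.log q| = |F 0| * Real.log q := by rw [abs_mul, abs_of_nonneg hlq0]
    have h5 : |I| ≤ |I| * Real.log q := le_mul_of_one_le_right (abs_nonneg _) hlq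
    calc _ = |F 0 * Real.log q + -(F 0 * (3 * Real.log 2 + Real.log Real.pi + γ₀)) +
          -(F 0 * S) + I| := by congr 1; ring
      _ ≤ |F 0 * Real.log q| + |-(F 0 * (3 * Real.log 2 + Real.log Real.pi + γ₀))| +
          |-(F 0 * S)| + |I| :=
        (abs_add_le _ _).trans (by gcongr; exact (abs_add_three _ _ _))
      _ ≤ C₂ * Real.log q := by
        rw [abs_neg, abs_neg]
        simp only [C₂, add_mul]
        linarith
      _ ≤ _ := by gcongr; exact le_add_of_nonneg_left (by positivity)

end SecondMoment

section Moments

open scoped ENNReal Nat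

lemma factorial_two_mul_div_eq_doubleFactorial (m : ℕ) :
    ((2 * m).factorial : ℝ) / (2 ^ m * (m.factorial : ℝ)) = ((2 * m - 1)‼ : ℕ) := by
  rw [div_eq_iff (by positivity)]
  rcases m with _ | m
  · simp
  · have h := Nat.doubleFactorial_two_mul (m + 1)
    rw [show 2 * (m + 1) = 2 * m + 1 + 1 by ring, Nat.factorial_eq_mul_doubleFactorial,
      show 2 * m + 1 + 1 = 2 * (m + 1) by ring, h]
    push_cast
    rw [show 2 * (m + 1) - 1 = 2 * m + 1 by omega]
    ring

lemma MemS.fourierR_sq_le {δ : ℝ} {η : ℝ → ℝ} (hδ : 0 < δ) (h : MemS δ η) (ξ : ℝ) :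
    fourierR η ξ ^ 2 ≤ (∫ t, |η t|) ^ 2 := by
  refine pow_le_pow_left₀ (h.2.2.2.2.1 ξ) ((le_abs_self _).trans ?_) 2
  rw [fourierR, ← Real.norm_eq_abs]
  refine norm_integral_le_of_norm_le (h.integrable hδ).abs (.of_forall fun t => ?_)
  rw [norm_mul]
  exact mul_le_of_le_one_right (norm_nonneg _) (Real.abs_cos_le_one _)

/-- Moment bounds for the balanced sum, in terms of the second moment `Z`. -/
lemma exists_abs_balancedSum_toReal_sub_le (m : ℕ) (W : ℝ) :
    ∃ D : ℝ, 0 ≤ D ∧ ∀ (K : Type) (ι : K → K) (f : K → ℝ) (_ : Function.Involutive ι)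
      (_ : ∀ k, ι k ≠ k) (_ : ∀ k, f (ι k) = f k) (_ : ∀ k, 0 ≤ f k) (_ : ∀ k, f k ^ 2 ≤ W)
      (Z : ℝ) (_ : HasSum (fun k => f k ^ 2) Z),
      balancedSum ι (fun k => ENNReal.ofReal (f k)) (2 * m) ≠ ∞ ∧
      |(balancedSum ι (fun k => ENNReal.ofReal (f k)) (2 * m)).toReal -
        ((2 * m - 1)‼ : ℕ) * Z ^ m| ≤ D * |Z| ^ (m - 1) := by
  obtain ⟨C, hC⟩ := exists_le_balancedSum_two_mul m
  refine ⟨(m * C : ℕ) * max W 0, by positivity, fun K ι f hι hfix hf hf0 hW Z hZ => ?_⟩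
  have hZ0 : 0 ≤ Z := hZ.nonneg fun k => sq_nonneg _
  set w : K → ℝ≥0∞ := fun k => ENNReal.ofReal (f k) with hw
  have hww : ∀ k, w (ι k) = w k := fun k => by simp only [hw, hf]
  have hsq : ∀ k, w k ^ 2 = ENNReal.ofReal (f k ^ 2) := fun k => (ENNReal.ofReal_pow (hf0 k) 2).symm
  have hsum : ∑' k, w k ^ 2 = ENNReal.ofReal Z := by
    simp only [hsq]
    rw [← ENNReal.ofReal_tsum_of_nonneg (fun k => sq_nonneg _) hZ.summable, hZ.tsum_eq]
  have h1 := balancedSum_two_mul_le hι hfix hww m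
  have h2 := hC K ι w hι hfix hww (ENNReal.ofReal (max W 0)) fun k => by
    rw [hsq]
    exact ENNReal.ofReal_le_ofReal ((hW k).trans (le_max_left _ _))
  rw [hsum, ← ENNReal.ofReal_natCast, ← ENNReal.ofReal_pow hZ0,
    ← ENNReal.ofReal_mul (by positivity)] at h1
  have hfin := ne_top_of_le_ne_top ENNReal.ofReal_ne_top h1
  refine ⟨hfin, ?_⟩
  rw [hsum, ← ENNReal.ofReal_natCast, ← ENNReal.ofReal_natCast, ← ENNReal.ofReal_pow hZ0,
    ← ENNReal.ofReal_pow hZ0, ← ENNReal.ofReal_mul (by positivity),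
    ← ENNReal.ofReal_mul (by positivity), ← ENNReal.ofReal_mul (by positivity),
    ← ENNReal.ofReal_toReal hfin, ← ENNReal.ofReal_add ENNReal.toReal_nonneg (by positivity),
    ENNReal.ofReal_le_ofReal_iff (by positivity)] at h2
  have h3 := ENNReal.toReal_le_of_le_ofReal (by positivity) h1
  rw [abs_of_nonneg hZ0, abs_sub_le_iff]
  have : 0 ≤ ((m * C : ℕ) : ℝ) * max W 0 * Z ^ (m - 1) := by positivity
  constructor <;> linarith

lemma abs_div_pow_sub_le {m : ℕ} (hm : 1 ≤ m) {T Z N y L c C D : ℝ} (hN : 1 ≤ N) (hL : 1 ≤ L)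
    (hc : 0 ≤ c) (hC : 0 ≤ C) (hD : 0 ≤ D) (hT : |T - c * Z ^ m| ≤ D * |Z| ^ (m - 1))
    (hZ : |Z - N * y| ≤ C * L) (hy : |y| ≤ C * L) :
    |1 / N ^ (2 * m) * T - c * (y / N) ^ m| ≤
      (D + c * m * C) * (2 * C) ^ (m - 1) * L ^ m / N ^ (m + 1) := by
  obtain ⟨m, rfl⟩ := Nat.exists_eq_add_of_le' hm
  rw [Nat.add_sub_cancel] at *
  have hN0 : 0 < N := by linarith
  have hCL : C * L ≤ N * (C * L) := le_mul_of_one_le_left (by positivity) hN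
  have hNy : |N * y| ≤ N * (C * L) := by
    rw [abs_mul, abs_of_pos hN0]
    gcongr
  have hZ' : |Z| ≤ 2 * C * (N * L) := by
    have := abs_sub_abs_le_abs_sub Z (N * y)
    linarith
  have h1 := (abs_pow_sub_pow_le Z (N * y) (m + 1)).trans
    (mul_le_mul (mul_le_mul_of_nonneg_right hZ (Nat.cast_nonneg _))
      (pow_le_pow_left₀ (by positivity) (max_le hZ' (hNy.trans (by nlinarith))) _)
      (by positivity) (by positivity))
  rw [Nat.add_sub_cancel] at h1
  have h2 : 1 / N ^ (2 * (m + 1)) * T - c * (y / N) ^ (m + 1) =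
      ((T - c * Z ^ (m + 1)) + c * (Z ^ (m + 1) - (N * y) ^ (m + 1))) / N ^ (2 * (m + 1)) := by
    rw [mul_pow, div_pow, two_mul, pow_add]
    field_simp
    ring
  rw [h2, abs_div, abs_of_pos (pow_pos hN0 (2 * (m + 1))), div_le_div_iff₀ (by positivity) (by positivity)]
  have h3 : |(T - c * Z ^ (m + 1)) + c * (Z ^ (m + 1) - (N * y) ^ (m + 1))| ≤
      (D + c * (m + 1 : ℕ) * C) * (2 * C) ^ m * L ^ (m + 1) * N ^ m := by
    refine (abs_add_le _ _).trans ?_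
    rw [abs_mul c, abs_of_nonneg hc]
    have h4 : |T - c * Z ^ (m + 1)| ≤ D * (2 * C * (N * L)) ^ m * L :=
      hT.trans ((by gcongr : _ ≤ D * (2 * C * (N * L)) ^ m).trans
        (le_mul_of_one_le_right (by positivity) hL))
    calc _ ≤ D * (2 * C * (N * L)) ^ m * L +
          c * (C * L * (m + 1 : ℕ) * (2 * C * (N * L)) ^ m) := by gcongr
      _ = _ := by ring
  calc _ ≤ (D + c * (m + 1 : ℕ) * C) * (2 * C) ^ m * L ^ (m + 1) * N ^ m * N ^ (m + 1 + 1) := by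
        exact mul_le_mul_of_nonneg_right h3 (by positivity)
    _ = _ := by ring

end Moments

theorem moments_of_primes_stmt7 (hGRH : GRH) (hLI : LI)
    (δ : ℝ) (hδ : 0 < δ) (η : ℝ → ℝ) (hη : MemS δ η) (m : ℕ) (hm : 1 ≤ m) :
    (∀ (q : ℕ) [NeZero q], 3 ≤ q → Emom q (2*m+1) η = 0) ∧
    ∃ A : ℝ, 0 < A ∧ ∀ (q : ℕ) [NeZero q], 3 ≤ q →
      |Emom q (2*m) η - (((2*m).factorial : ℝ) / (2^m * (m.factorial : ℝ))) *
          ((alphaSq η * Real.log q + betaSq q η) / (q.totient : ℝ)) ^ m|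
        ≤ A * (Real.log q) ^ m / (q.totient : ℝ) ^ (m+1) := by
  have hη0 : ∀ ξ, 0 ≤ fourierR η ξ := hη.2.2.2.2.1
  constructor
  · intro q _ hq
    have h := CriticalZero.balancedSum_odd hLI hq η m
    rw [CriticalZero.Emom_eq hLI hq hη0 (by rw [h]; exact ENNReal.zero_ne_top), h]
    simp
  · obtain ⟨C, hC0, hC⟩ := hη.exists_hasSum_criticalZero hGRH hLI hδ
    obtain ⟨D, hD0, hD⟩ := exists_abs_balancedSum_toReal_sub_le m ((∫ t, |η t|) ^ 2)
    have hdf : (0 : ℝ) < ((2 * m - 1).doubleFactorial : ℕ) := by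
      exact_mod_cast Nat.doubleFactorial_pos _
    have hm0 : (0 : ℝ) < m := by exact_mod_cast hm
    refine ⟨(D + ((2 * m - 1).doubleFactorial : ℕ) * m * C) * (2 * C) ^ (m - 1), by positivity,
      fun q _ hq => ?_⟩
    · obtain ⟨Z, hZ, hZ1, hZ2⟩ := hC q hq
      obtain ⟨hfin, hT⟩ := hD (CriticalZero q) CriticalZero.dual
        (fun k => fourierR η (k.1.2 / (2 * Real.pi))) CriticalZero.dual_involutive
        (CriticalZero.dual_ne hLI hq)
        (fun k => by
          simp only [CriticalZero.dual]
          rw [neg_div, fourierR_neg])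
        (fun k => hη0 _) (fun k => hη.fourierR_sq_le hδ _) Z hZ
      rw [CriticalZero.Emom_eq hLI hq hη0 hfin, factorial_two_mul_div_eq_doubleFactorial]
      have hN : (1 : ℝ) ≤ q.totient := by
        exact_mod_cast Nat.totient_pos.2 (by omega)
      exact abs_div_pow_sub_le hm hN (one_le_log_of_three_le hq) hdf.le hC0.le hD0 hT hZ1 hZ2
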